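/- There exists N₀ ∈ ℕ such that for every n ≥ N₀ and every permutation σ ∈ S_n, the maximum of the normalized character χ̃(σ) = χ(σ)/χ(1) over all irreducible complex characters χ of S_n other than the trivial and sign characters is equal to max{F₁(σ), F₂(σ), F₃(σ), F₄(σ), F₅(σ), F₆(σ), F₇(σ), F₈(σ)}. (Equivalently: if Σ ⊂ S_n is a full single conjugacy class, the largest non-trivial eigenvalue of the Cayley graph Cay(S_n, Σ) is attained by one of the eight irreducible representations in EIGHT_n.) -/

import Mathlib

open CategoryTheory

/-- `c₁(σ)`: the number of fixed points of a permutation. -/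
def fixCount {n : ℕ} (σ : Equiv.Perm (Fin n)) : ℕ :=
  (Finset.univ.filter fun x => σ x = x).card

/-- `c_ℓ(σ)`: the number of `ℓ`-cycles of a permutation (for `ℓ ≥ 2`). -/
def cyc {n : ℕ} (ℓ : ℕ) (σ : Equiv.Perm (Fin n)) : ℕ :=
  Multiset.count ℓ σ.cycleType

/-- The (real-valued) normalized character `χ̃(σ) = χ(σ)/χ(1)` of `V` at `σ`. -/
noncomputable def normChar {n : ℕ} (V : FDRep ℂ (Equiv.Perm (Fin n)))
    (σ : Equiv.Perm (Fin n)) : ℝ :=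
  (V.character σ / V.character 1).re

/-- `V` is an irreducible representation whose character is neither the trivial
character nor the sign character. -/
def IsNontrivIrr {n : ℕ} (V : FDRep ℂ (Equiv.Perm (Fin n))) : Prop :=
  Simple V ∧ V.character ≠ (fun _ => 1) ∧
    V.character ≠ (fun σ => ((Equiv.Perm.sign σ : ℤ) : ℂ))

/-- The maximum of the normalized characters `F₁(σ), …, F₈(σ)` at `σ` of the eight
irreps `EIGHT_n = {(n-1,1), (n-2,2), (n-3,3), (n-3,2,1), (n-4,4),
(n-1,1)ᵗ, (n-2,2)ᵗ, (n-2,1,1)ᵗ}`. -/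
noncomputable def maxF (n : ℕ) (σ : Equiv.Perm (Fin n)) : ℝ :=
  let c1 : ℝ := fixCount σ
  let c2 : ℝ := cyc 2 σ
  let c3 : ℝ := cyc 3 σ
  let c4 : ℝ := cyc 4 σ
  let e : ℝ := ((Equiv.Perm.sign σ : ℤ) : ℝ)
  let N : ℝ := n
  let F1 := (c1 - 1) / (N - 1)
  let F2 := (c1 * (c1 - 3) / 2 + c2) / (N * (N - 3) / 2)
  let F3 := (c1 * (c1 - 1) * (c1 - 5) / 6 + (c1 - 1) * c2 + c3) / (N * (N - 1) * (N - 5) / 6)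
  let F4 := (c1 * (c1 - 2) * (c1 - 4) / 3 - c3) / (N * (N - 2) * (N - 4) / 3)
  let F5 := (c1 * (c1 - 1) * (c1 - 2) * (c1 - 7) / 24 + (c1 ^ 2 - 3 * c1 - 1) * c2 / 2
      + c2 ^ 2 / 2 + (c1 - 1) * c3 + c4) / (N * (N - 1) * (N - 2) * (N - 7) / 24)
  let F6 := e * F1
  let F7 := e * F2
  let F8 := e * ((c1 - 1) * (c1 - 2) / 2 - c2) / ((N - 1) * (N - 2) / 2)
  max (max (max F1 F2) (max F3 F4)) (max (max F5 F6) (max F7 F8))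

section ComplexCharacters

open Representation

/-- `χ` is the character of a finite-dimensional complex representation. -/
def IsCChar {G : Type} [Group G] (χ : G → ℂ) : Prop :=
  ∃ (V : Type) (_ : AddCommGroup V) (_ : Module ℂ V) (_ : FiniteDimensional ℂ V)
    (ρ : Representation ℂ G V), ρ.character = χ

/-- `χ` is the character of an irreducible finite-dimensional complex representation. -/
def IsCIrr {G : Type} [Group G] (χ : G → ℂ) : Prop :=
  ∃ (V : Type) (_ : AddCommGroup V) (_ : Module ℂ V) (_ : FiniteDimensional ℂ V)
    (ρ : Representation ℂ G V), ρ.IsIrreducible ∧ ρ.character = χ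

section Complex

variable {G : Type} [Group G]

theorem IsCIrr.isCChar {χ : G → ℂ} (h : IsCIrr χ) : IsCChar χ := by
  obtain ⟨V, i1, i2, i3, ρ, -, h⟩ := h
  exact ⟨V, i1, i2, i3, ρ, h⟩

theorem character_add_of_isCompl {V : Type} [AddCommGroup V] [Module ℂ V] [FiniteDimensional ℂ V]
    {ρ : Representation ℂ G V} {p q : Subrepresentation ρ}
    (h : IsCompl p.toSubmodule q.toSubmodule) :
    ρ.character = p.toRepresentation.character + q.toRepresentation.character := by
  funext g
  let e := Submodule.prodEquivOfIsCompl _ _ h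
  have : ρ g = e.conj ((p.toRepresentation g).prodMap (q.toRepresentation g)) := by
    ext v
    obtain ⟨⟨x, y⟩, rfl⟩ := e.surjective v
    simp only [LinearEquiv.conj_apply_apply, LinearEquiv.symm_apply_apply]
    simp [e, Subrepresentation.toRepresentation]
  simp only [character, Pi.add_apply]
  rw [this, LinearMap.trace_conj', LinearMap.trace_prodMap']

theorem exists_multiset_irr [Finite G] (d : ℕ) : ∀ (V : Type) [AddCommGroup V] [Module ℂ V]
    [FiniteDimensional ℂ V] (ρ : Representation ℂ G V), Module.finrank ℂ V ≤ d →
    ∃ s : Multiset (G → ℂ), (∀ ψ ∈ s, IsCIrr ψ) ∧ s.sum = ρ.character := by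
  induction d with
  | zero =>
    intro V _ _ _ ρ h
    refine ⟨0, by simp, ?_⟩
    have : Subsingleton V := Module.finrank_zero_iff.1 (Nat.le_zero.1 h)
    funext g
    simp only [Multiset.sum_zero, Pi.zero_apply, character]
    rw [Subsingleton.elim (ρ g) 0, map_zero]
  | succ d ih =>
    intro V _ _ _ ρ h
    by_cases hi : ρ.IsIrreducible
    · exact ⟨{ρ.character}, by simpa using ⟨V, _, _, inferInstance, ρ, hi, rfl⟩, by simp⟩
    · by_cases hn : Subsingleton V
      · exact ih V ρ (by rw [Module.finrank_zero_iff.2 hn]; omega)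
      · have hnt : Nontrivial (Subrepresentation ρ) := by
          refine ⟨⊥, ⊤, fun e => hn ?_⟩
          have : (⊥ : Submodule ℂ V) = ⊤ := congrArg Subrepresentation.toSubmodule e
          exact (Submodule.subsingleton_iff ℂ).1 (subsingleton_of_bot_eq_top this)
        have : ∃ p : Subrepresentation ρ, p ≠ ⊥ ∧ p ≠ ⊤ := by
          by_contra! hc
          exact hi ⟨fun p => by by_cases hp : p = ⊥; exacts [Or.inl hp, Or.inr (hc p hp)]⟩
        obtain ⟨p, hp0, hp1⟩ := this
        obtain ⟨q, hq⟩ := ComplementedLattice.exists_isCompl p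
        have hpq : IsCompl p.toSubmodule q.toSubmodule := by
          constructor
          · rw [disjoint_iff]
            exact congrArg Subrepresentation.toSubmodule (disjoint_iff.1 hq.1)
          · rw [codisjoint_iff]
            exact congrArg Subrepresentation.toSubmodule (codisjoint_iff.1 hq.2)
        have h1 : Module.finrank ℂ p.toSubmodule < Module.finrank ℂ V :=
          Submodule.finrank_lt fun e => hp1 (Subrepresentation.toSubmodule_injective e)
        have h2 := Submodule.finrank_add_eq_of_isCompl hpq
        have h3 : Module.finrank ℂ p.toSubmodule ≠ 0 := fun e => hp0
          (Subrepresentation.toSubmodule_injective (Submodule.finrank_eq_zero.1 e))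
        obtain ⟨s, hs, hs'⟩ := ih _ p.toRepresentation (by omega)
        obtain ⟨t, ht, ht'⟩ := ih _ q.toRepresentation (by omega)
        refine ⟨s + t, fun ψ hψ => ?_, ?_⟩
        · rcases Multiset.mem_add.1 hψ with h | h
          exacts [hs _ h, ht _ h]
        · rw [Multiset.sum_add, hs', ht', character_add_of_isCompl hpq]

theorem IsCChar.exists_multiset [Finite G] {χ : G → ℂ} (h : IsCChar χ) :
    ∃ s : Multiset (G → ℂ), (∀ ψ ∈ s, IsCIrr ψ) ∧ s.sum = χ := by
  obtain ⟨V, _, _, _, ρ, rfl⟩ := h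
  exact exists_multiset_irr _ V ρ le_rfl

theorem IsCChar.comp {H : Type} [Group H] {χ : G → ℂ} (h : IsCChar χ) (f : H →* G) :
    IsCChar (fun x => χ (f x)) := by
  obtain ⟨V, _, _, _, ρ, rfl⟩ := h
  exact ⟨V, _, _, inferInstance, ρ.comp f, rfl⟩

theorem IsCIrr.abelian [Finite G] [IsMulCommutative G] {χ : G → ℂ} (h : IsCIrr χ) (g : G) :
    χ g⁻¹ = starRingEnd ℂ (χ g) ∧ ‖χ g‖ ≤ 1 ∧ χ 1 = 1 := by
  obtain ⟨V, _, _, _, ρ, hi, rfl⟩ := h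
  have hd := IsIrreducible.finrank_eq_one_of_isMulCommutative ρ
  have hs : ∀ x : G, ρ x = ρ.character x • (1 : V →ₗ[ℂ] V) := by
    intro x
    obtain ⟨v, hv⟩ := finrank_eq_one_iff'.1 hd
    obtain ⟨c, hc⟩ := hv.2 (ρ x v)
    have h2 : ρ x = c • (1 : V →ₗ[ℂ] V) := by
      ext w
      obtain ⟨a, rfl⟩ := hv.2 w
      rw [map_smul, ← hc]
      exact smul_comm a c v
    have h3 : ρ.character x = c := by
      change LinearMap.trace ℂ V (ρ x) = c
      rw [h2, map_smul, LinearMap.trace_one, hd]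
      simp
    rw [h3, h2]
  have h1 : ρ.character 1 = 1 := by rw [char_one, hd]; simp
  have hnt : Nontrivial V := Module.nontrivial_of_finrank_pos (R := ℂ) (by omega)
  obtain ⟨v, hv⟩ := exists_ne (0 : V)
  have hm : ∀ x y, ρ.character (x * y) = ρ.character x * ρ.character y := by
    intro x y
    have := congrArg (fun f => f v) (map_mul ρ x y)
    rw [hs (x * y), hs x, hs y] at this
    simpa [smul_smul, (smul_left_injective ℂ hv).eq_iff, mul_comm] using this
  have hp : ∀ m : ℕ, ρ.character (g ^ m) = ρ.character g ^ m := by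
    intro m
    induction m with
    | zero => simp [h1]
    | succ m ih => rw [pow_succ, hm, ih, pow_succ]
  have hn : ‖ρ.character g‖ = 1 := by
    have h5 := hp (Nat.card G)
    rw [pow_card_eq_one', h1] at h5
    have h6 : ‖ρ.character g‖ ^ Nat.card G = 1 := by rw [← norm_pow, ← h5]; simp
    exact (pow_eq_one_iff_of_nonneg (norm_nonneg _) Nat.card_pos.ne').1 h6
  refine ⟨?_, hn.le, h1⟩
  have h7 : ρ.character g⁻¹ * ρ.character g = 1 := by rw [← hm]; simp [h1]
  have h8 : starRingEnd ℂ (ρ.character g) * ρ.character g = 1 := by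
    rw [← Complex.normSq_eq_conj_mul_self, Complex.normSq_eq_norm_sq, hn]; simp
  have h9 : ρ.character g ≠ 0 := fun h => by rw [h] at h8; simp at h8
  exact mul_right_cancel₀ h9 (h7.trans h8.symm)

theorem IsCChar.inv_and_norm_le [Finite G] {χ : G → ℂ} (h : IsCChar χ) (g : G) :
    χ g⁻¹ = starRingEnd ℂ (χ g) ∧ ‖χ g‖ ≤ (χ 1).re := by
  obtain ⟨s, hs, hs'⟩ := (h.comp (Subgroup.zpowers g).subtype).exists_multiset
  have key : ∀ s : Multiset (Subgroup.zpowers g → ℂ), (∀ ψ ∈ s, IsCIrr ψ) →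
      ∀ x, s.sum x⁻¹ = starRingEnd ℂ (s.sum x) ∧ ‖s.sum x‖ ≤ (s.sum 1).re := by
    intro s
    induction s using Multiset.induction with
    | empty => intro _ x; simp
    | cons a s ih =>
      intro hs x
      have h1 := ih (fun ψ hψ => hs ψ (Multiset.mem_cons_of_mem hψ)) x
      have h2 := IsCIrr.abelian (hs a (Multiset.mem_cons_self a s)) x
      simp only [Multiset.sum_cons, Pi.add_apply, map_add, h1.1, h2.1, true_and, h2.2.2,
        Complex.add_re, Complex.one_re]
      exact (norm_add_le _ _).trans (add_le_add h2.2.1 h1.2)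
  have := key s hs ⟨g, Subgroup.mem_zpowers g⟩
  rw [hs'] at this
  simpa using this

end Complex

end ComplexCharacters

section RealCharacters

open Representation

/-- `χ` is a real-valued character of a finite-dimensional complex representation. -/
def IsChar {G : Type} [Group G] (χ : G → ℝ) : Prop := IsCChar fun g => (χ g : ℂ)

/-- `χ` is a real-valued irreducible character. -/
def IsIrr {G : Type} [Group G] (χ : G → ℝ) : Prop := IsCIrr fun g => (χ g : ℂ)

/-- A group in which every element is conjugate to its inverse. -/
class Ambivalent (G : Type) [Group G] : Prop where
  conj_inv : ∀ g : G, IsConj g g⁻¹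

instance {α : Type} [Fintype α] [DecidableEq α] : Ambivalent (Equiv.Perm α) :=
  ⟨fun g => Equiv.Perm.isConj_iff_cycleType_eq.2 (Equiv.Perm.cycleType_inv g).symm⟩

instance {G H : Type} [Group G] [Group H] [Ambivalent G] [Ambivalent H] : Ambivalent (G × H) :=
  ⟨fun g => by
    obtain ⟨c, hc⟩ := isConj_iff.1 (Ambivalent.conj_inv g.1)
    obtain ⟨d, hd⟩ := isConj_iff.1 (Ambivalent.conj_inv g.2)
    exact isConj_iff.2 ⟨(c, d), Prod.ext hc hd⟩⟩

section Real

variable {G : Type} [Group G]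

theorem IsIrr.isChar {χ : G → ℝ} (h : IsIrr χ) : IsChar χ := IsCIrr.isCChar h

theorem IsCChar.conj_eq {χ : G → ℂ} (h : IsCChar χ) (g k : G) : χ (k * g * k⁻¹) = χ g := by
  obtain ⟨V, _, _, _, ρ, rfl⟩ := h
  exact ρ.char_conj g k

theorem IsCChar.exists_real [Finite G] [Ambivalent G] {χ : G → ℂ} (h : IsCChar χ) :
    ∃ ψ : G → ℝ, χ = fun g => (ψ g : ℂ) := by
  refine ⟨fun g => (χ g).re, funext fun g => ?_⟩
  obtain ⟨c, hc⟩ := isConj_iff.1 (Ambivalent.conj_inv g)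
  have h1 := (h.inv_and_norm_le g).1
  rw [← hc, h.conj_eq] at h1
  exact (Complex.conj_eq_iff_re.1 h1.symm).symm

theorem IsChar.exists_multiset [Finite G] [Ambivalent G] {χ : G → ℝ} (h : IsChar χ) :
    ∃ s : Multiset (G → ℝ), (∀ ψ ∈ s, IsIrr ψ) ∧ s.sum = χ := by
  obtain ⟨s, hs, hs'⟩ := IsCChar.exists_multiset h
  refine ⟨s.map fun ψ g => (ψ g).re, ?_, ?_⟩
  · intro ψ hψ
    obtain ⟨φ, hφ, rfl⟩ := Multiset.mem_map.1 hψ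
    obtain ⟨φ', rfl⟩ := (hs φ hφ).isCChar.exists_real
    exact hs _ hφ
  · funext g
    have h1 : (s.sum g).re = χ g := by rw [hs']; simp
    rw [← h1]
    clear h1 hs hs'
    induction s using Multiset.induction with
    | empty => simp
    | cons a s ih => simp [ih]

theorem IsChar.conj_eq {χ : G → ℝ} (h : IsChar χ) (g k : G) : χ (k * g * k⁻¹) = χ g := by
  simpa using IsCChar.conj_eq h g k

theorem IsChar.eq_of_isConj {χ : G → ℝ} (h : IsChar χ) {g k : G} (hc : IsConj g k) :
    χ g = χ k := by
  obtain ⟨c, rfl⟩ := isConj_iff.1 hc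
  exact (h.conj_eq g c).symm

theorem IsChar.inv [Finite G] {χ : G → ℝ} (h : IsChar χ) (g : G) : χ g⁻¹ = χ g := by
  have := (IsCChar.inv_and_norm_le h g).1
  rw [Complex.conj_ofReal] at this
  exact_mod_cast this

theorem IsChar.abs_le [Finite G] {χ : G → ℝ} (h : IsChar χ) (g : G) : |χ g| ≤ χ 1 := by
  simpa using (IsCChar.inv_and_norm_le h g).2

theorem IsChar.one_eq_nat {χ : G → ℝ} (h : IsChar χ) : ∃ d : ℕ, χ 1 = d := by
  obtain ⟨V, _, _, _, ρ, h⟩ := h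
  refine ⟨Module.finrank ℂ V, ?_⟩
  have := congrFun h 1
  rw [char_one] at this
  exact_mod_cast this.symm

theorem IsChar.one_nonneg {χ : G → ℝ} (h : IsChar χ) : 0 ≤ χ 1 := by
  obtain ⟨d, hd⟩ := h.one_eq_nat
  rw [hd]
  positivity

theorem IsChar.comp {H : Type} [Group H] {χ : G → ℝ} (h : IsChar χ) (f : H →* G) :
    IsChar fun x => χ (f x) :=
  IsCChar.comp h f

theorem IsChar.mul {χ ψ : G → ℝ} (h : IsChar χ) (h' : IsChar ψ) :
    IsChar fun x => χ x * ψ x := by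
  obtain ⟨V, _, _, _, ρ, h⟩ := h
  obtain ⟨W, _, _, _, σ, h'⟩ := h'
  refine ⟨_, _, _, inferInstance, tprod ρ σ, ?_⟩
  rw [char_tensor, h, h']
  funext x
  simp

theorem IsChar.add {χ ψ : G → ℝ} (h : IsChar χ) (h' : IsChar ψ) :
    IsChar fun x => χ x + ψ x := by
  obtain ⟨V, _, _, _, ρ, h⟩ := h
  obtain ⟨W, _, _, _, σ, h'⟩ := h'
  refine ⟨_, _, _, inferInstance, ρ.prod σ, ?_⟩
  funext x
  have h1 := congrFun h x
  have h2 := congrFun h' x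
  simp only [character] at h1 h2 ⊢
  rw [Complex.ofReal_add, ← h1, ← h2]
  exact LinearMap.trace_prodMap' _ _

theorem isChar_unitHom (ε : G →* ℤˣ) : IsChar fun g => ((ε g : ℤ) : ℝ) := by
  let f : G →* (ℂ →ₗ[ℂ] ℂ) :=
    { toFun := fun g => ((ε g : ℤ) : ℂ) • (1 : ℂ →ₗ[ℂ] ℂ)
      map_one' := by simp
      map_mul' := fun x y => by ext; simp [mul_comm] }
  refine ⟨ℂ, _, _, inferInstance, f, ?_⟩
  funext x
  simp only [character]
  change LinearMap.trace ℂ ℂ (((ε x : ℤ) : ℂ) • (1 : ℂ →ₗ[ℂ] ℂ)) = _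
  rw [map_smul, LinearMap.trace_one]
  simp

theorem isChar_one : IsChar fun _ : G => 1 := by
  simpa using isChar_unitHom (1 : G →* ℤˣ)

theorem IsChar.sum_eq [Fintype G] {χ : G → ℝ} (h : IsChar χ) :
    ∃ d : ℕ, ∑ g, χ g = Fintype.card G * d := by
  obtain ⟨V, _, _, _, ρ, h⟩ := h
  have : Invertible ((Nat.card G : ℕ) : ℂ) := invertibleOfNonzero (by simp)
  have h1 := ρ.card_inv_mul_sum_char_eq_finrank
  rw [h, inv_mul_eq_iff_eq_mul₀ (by simp)] at h1
  refine ⟨Module.finrank ℂ ρ.invariants, ?_⟩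
  rw [← Nat.card_eq_fintype_card]
  beta_reduce at h1
  exact_mod_cast h1

theorem IsIrr.one_pos {χ : G → ℝ} (h : IsIrr χ) : 1 ≤ χ 1 := by
  obtain ⟨V, _, _, _, ρ, hi, h⟩ := h
  have := congrFun h 1
  rw [char_one] at this
  have h2 : χ 1 = (Module.finrank ℂ V : ℝ) := by exact_mod_cast this.symm
  rw [h2]
  have : Nontrivial V := by
    by_contra hn
    rw [not_nontrivial_iff_subsingleton] at hn
    have := hi.toNontrivial
    obtain ⟨p, q, hpq⟩ := this
    exact hpq (Subrepresentation.toSubmodule_injective (Subsingleton.elim _ _))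
  exact_mod_cast (Module.finrank_pos : 0 < Module.finrank ℂ V)

open Classical in
theorem IsIrr.orth [Fintype G] {χ ψ : G → ℝ} (h : IsIrr χ) (h' : IsIrr ψ) :
    ∑ g, χ g * ψ g = if χ = ψ then (Fintype.card G : ℝ) else 0 := by
  have hI := h'.isChar.inv
  obtain ⟨V, _, _, _, ρ, hi, h⟩ := h
  obtain ⟨W, _, _, _, σ, hi', h'⟩ := h'
  have : Invertible ((Nat.card G : ℕ) : ℂ) := invertibleOfNonzero (by simp)
  have key : ∀ (V W : Type) [AddCommGroup V] [Module ℂ V] [FiniteDimensional ℂ V]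
      [AddCommGroup W] [Module ℂ W] [FiniteDimensional ℂ W] (ρ : Representation ℂ G V)
      (σ : Representation ℂ G W), ρ.IsIrreducible → σ.IsIrreducible → 
      ∑ g, ρ.character g * σ.character g⁻¹ = if ρ.character = σ.character then
        (Fintype.card G : ℂ) else 0 := by
    intro V W _ _ _ _ _ _ ρ σ _ _
    have h1 := char_orthonormal ρ σ
    rw [inv_mul_eq_iff_eq_mul₀ (by simp)] at h1
    rw [h1]
    split_ifs with h2 h3 h3
    · simp
    · exact absurd (char_iso h2.some).symm h3
    · have h4 := char_orthonormal ρ ρ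
      rw [inv_mul_eq_iff_eq_mul₀ (by simp), if_pos ⟨Representation.Equiv.refl ρ⟩] at h4
      nth_rw 2 [h3] at h4
      rw [h1, if_neg h2] at h4
      rw [h4]
      simp
    · simp
  have h2 := key V W ρ σ hi hi'
  rw [h, h'] at h2
  have h3 : ((fun g => (χ g : ℂ)) = fun g => (ψ g : ℂ)) ↔ χ = ψ := by
    simp only [funext_iff, Complex.ofReal_inj]
  simp only [h3, hI] at h2
  have h4 : ((∑ g, χ g * ψ g : ℝ) : ℂ) = ((if χ = ψ then (Fintype.card G : ℝ) else 0 : ℝ) : ℂ) := by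
    rw [Complex.ofReal_sum]
    split_ifs at h2 ⊢ <;> simpa using h2
  exact_mod_cast h4

theorem IsIrr.norm_eq [Fintype G] {χ : G → ℝ} (h : IsIrr χ) :
    ∑ g, χ g * χ g = Fintype.card G := by
  rw [h.orth h, if_pos rfl]

theorem IsChar.inner_eq [Fintype G] {χ ψ : G → ℝ} (h : IsChar χ) (h' : IsChar ψ) :
    ∃ d : ℕ, ∑ g, χ g * ψ g = Fintype.card G * d :=
  (h.mul h').sum_eq

theorem multiset_sum_apply {X : Type} (s : Multiset (X → ℝ)) (g : X) :
    s.sum g = (s.map fun ψ => ψ g).sum := by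
  induction s using Multiset.induction with
  | empty => simp
  | cons a s ih => simp [ih]

theorem isChar_zero : IsChar fun _ : G => 0 := by
  refine ⟨PUnit, _, _, inferInstance, (1 : Representation ℂ G PUnit), ?_⟩
  funext x
  simp only [character]
  rw [Subsingleton.elim ((1 : Representation ℂ G PUnit) x) 0, map_zero]
  simp

theorem isChar_multiset_sum {s : Multiset (G → ℝ)} (h : ∀ ψ ∈ s, IsChar ψ) : IsChar s.sum := by
  induction s using Multiset.induction with
  | empty => exact isChar_zero
  | cons a s ih =>
    rw [Multiset.sum_cons]
    exact (h a (by simp)).add (ih fun ψ hψ => h ψ (by simp [hψ]))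

theorem isIrr_of_norm [Fintype G] [Ambivalent G] {χ : G → ℝ} (h : IsChar χ)
    (hn : ∑ g, χ g * χ g = Fintype.card G) : IsIrr χ := by
  obtain ⟨s, hs, rfl⟩ := h.exists_multiset
  have hc : (0 : ℝ) < Fintype.card G := by exact_mod_cast Fintype.card_pos
  induction s using Multiset.induction with
  | empty => simp at hn; exact absurd hn.symm hc.ne'
  | cons a s _ =>
    induction s using Multiset.induction with
    | empty => simpa using hs a (by simp)
    | cons b s _ =>
      exfalso
      have ha := hs a (by simp)
      have hb := hs b (by simp)
      have hS : IsChar s.sum := isChar_multiset_sum fun ψ hψ => (hs ψ (by simp [hψ])).isChar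
      have key : ∀ x y z : ℝ, (x + (y + z)) * (x + (y + z)) =
        x * x + y * y + z * z + 2 * (x * y) + 2 * (x * z) + 2 * (y * z) := fun x y z => by ring
      simp only [Multiset.sum_cons, Pi.add_apply, key, Finset.sum_add_distrib,
        ← Finset.mul_sum] at hn
      rw [ha.norm_eq, hb.norm_eq] at hn
      obtain ⟨d1, h1⟩ := ha.isChar.inner_eq hb.isChar
      obtain ⟨d2, h2⟩ := ha.isChar.inner_eq hS
      obtain ⟨d3, h3⟩ := hb.isChar.inner_eq hS
      obtain ⟨d4, h4⟩ := hS.inner_eq hS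
      rw [h1, h2, h3, h4] at hn
      have : (0:ℝ) ≤ Fintype.card G * d1 := by positivity
      have : (0:ℝ) ≤ Fintype.card G * d2 := by positivity
      have : (0:ℝ) ≤ Fintype.card G * d3 := by positivity
      have : (0:ℝ) ≤ Fintype.card G * d4 := by positivity
      linarith

theorem IsIrr.unitHom_mul [Fintype G] [Ambivalent G] {χ : G → ℝ} (h : IsIrr χ) (ε : G →* ℤˣ) :
    IsIrr fun g => ((ε g : ℤ) : ℝ) * χ g := by
  refine isIrr_of_norm ((isChar_unitHom ε).mul h.isChar) ?_
  rw [← h.norm_eq]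
  refine Finset.sum_congr rfl fun g _ => ?_
  rcases Int.units_eq_one_or (ε g) with h | h <;> simp [h]

/-- A linear combination of group elements which is central acts as a scalar. -/
theorem IsIrr.central_sum [Fintype G] {χ : G → ℝ} (h : IsIrr χ) {ι : Type} [Fintype ι]
    (u : ι → G) (w : ι → ℝ)
    (hu : ∀ g, ∃ e : ι ≃ ι, ∀ i, w (e i) = w i ∧ g * u (e i) * g⁻¹ = u i) (y : G) :
    ∑ i, w i * χ (u i * y) = (∑ i, w i * χ (u i)) * χ y / χ 1 := by
  have h1 := h.one_pos
  obtain ⟨V, _, _, _, ρ, hi, h⟩ := h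
  let T : V →ₗ[ℂ] V := ∑ i, (w i : ℂ) • ρ (u i)
  have hT : ∀ g, T ∘ₗ ρ g = ρ g ∘ₗ T := by
    intro g
    change T * ρ g = ρ g * T
    obtain ⟨e, he⟩ := hu g
    simp only [T, Finset.sum_mul, Finset.mul_sum, smul_mul_assoc, mul_smul_comm, ← map_mul]
    rw [← e.sum_comp fun i => (w i : ℂ) • ρ (g * u i)]
    refine Finset.sum_congr rfl fun i _ => ?_
    rw [(he i).1, ← (he i).2]
    congr 2
    group
  obtain ⟨c, hc⟩ := (IsIrreducible.algebraMap_intertwiningMap_bijective_of_isAlgClosed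
    (ρ := ρ)).2 ⟨T, hT⟩
  have hTc : T = c • (1 : V →ₗ[ℂ] V) := by
    have := congrArg (fun f => f.toLinearMap) hc
    exact this.symm
  have e1 : ∀ g, LinearMap.trace ℂ V (ρ g) = (χ g : ℂ) := fun g => congrFun h g
  have e2 : ∀ y, ∑ i, (w i : ℂ) * (χ (u i * y) : ℂ) = c * χ y := by
    intro y
    have : ∑ i, (w i : ℂ) • ρ (u i * y) = T * ρ y := by
      simp only [T, Finset.sum_mul, smul_mul_assoc, ← map_mul]
    have h2 := congrArg (LinearMap.trace ℂ V) this
    rw [hTc, map_sum] at h2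
    simp only [map_smul, e1, smul_mul_assoc, one_mul, smul_eq_mul] at h2
    exact h2
  have e3 := e2 1
  simp only [mul_one] at e3
  have h0 : (χ 1 : ℂ) ≠ 0 := by
    have : χ 1 ≠ 0 := by linarith
    exact_mod_cast this
  have e4 : ∑ i, (w i : ℂ) * (χ (u i * y) : ℂ) = (∑ i, (w i : ℂ) * χ (u i)) * χ y / χ 1 := by
    rw [e2, e3]
    field_simp
  exact_mod_cast e4

theorem IsIrr.schur [Fintype G] {χ : G → ℝ} (h : IsIrr χ) (x y : G) :
    ∑ k, χ (k * x * k⁻¹ * y) = Fintype.card G * (χ x * χ y / χ 1) := by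
  have := h.central_sum (fun k => k * x * k⁻¹) (fun _ => 1)
    (fun g => ⟨Equiv.mulLeft g⁻¹, fun i => ⟨rfl, by simp; group⟩⟩) y
  simp only [one_mul] at this
  rw [this]
  simp [h.isChar.conj_eq]
  ring

theorem IsIrr.convolution [Fintype G] {χ : G → ℝ} (h : IsIrr χ) (x y : G) :
    ∑ k, χ (k * x) * χ (k * y) = Fintype.card G * χ (x⁻¹ * y) / χ 1 := by
  have := h.central_sum (fun k => k) (fun k => χ k) (fun g => ⟨MulAut.conj g⁻¹, fun i => by
    simp only [EquivLike.coe_coe, MulAut.conj_apply, h.isChar.conj_eq,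
      true_and]
    group⟩) (x⁻¹ * y)
  rw [← Equiv.sum_comp (Equiv.mulRight x⁻¹)]
  simpa [mul_assoc, h.norm_eq] using this

end Real

end RealCharacters

section CharacterAverages

open Representation

section Real

variable {G : Type} [Group G]

theorem IsChar.invariants {H : Type} [Group H] [Fintype H] [Finite G] [Ambivalent G]
    {χ : G × H → ℝ} (h : IsChar χ) :
    ∃ ψ : G → ℝ, IsChar ψ ∧ ∀ x, ∑ y, χ (x, y) = Fintype.card H * ψ x := by
  obtain ⟨V, _, _, _, ρ, h⟩ := h
  have : Invertible ((Nat.card H : ℕ) : ℂ) := invertibleOfNonzero (by simp)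
  let σ : Representation ℂ H V := ρ.comp (MonoidHom.inr G H)
  let W : Submodule ℂ V := σ.invariants
  have hW : ∀ g : G, ∀ v ∈ W, ρ (g, 1) v ∈ W := by
    intro g v hv k
    have : ρ (1, k) (ρ (g, 1) v) = ρ (g, 1) (ρ (1, k) v) := by
      rw [← Module.End.mul_apply, ← Module.End.mul_apply, ← map_mul, ← map_mul]; simp
    change ρ (1, k) (ρ (g, 1) v) = _
    rw [this]
    congr 1
    exact hv k
  let p : Subrepresentation (ρ.comp (MonoidHom.inl G H)) := ⟨W, hW⟩
  have hc : IsCChar p.toRepresentation.character := ⟨W, _, _, inferInstance, _, rfl⟩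
  obtain ⟨φ, hφ⟩ := hc.exists_real
  refine ⟨φ, by rw [hφ] at hc; exact hc, fun x => ?_⟩
  have h1 : LinearMap.trace ℂ V (ρ (x, 1) ∘ₗ σ.averageMap) = φ x := by
    have h2 : ∀ v, (ρ (x, 1) ∘ₗ σ.averageMap) v ∈ W := fun v =>
      hW x _ (σ.averageMap_invariant v)
    have h3 := LinearMap.trace_restrict_eq_of_forall_mem W _ h2
    rw [← h3]
    have h4 := congrFun hφ x
    rw [← h4]
    simp only [character]
    congr 1
    ext v
    have := σ.averageMap_id v.1 v.2
    change ρ (x, 1) (σ.averageMap v.1) = ρ (x, 1) v.1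
    rw [this]
  have h5 : (Fintype.card H : ℂ) • σ.averageMap = ∑ y, ρ (1, y) := by
    simp [averageMap, GroupAlgebra.average, smul_smul, σ]
  have h6 : ∑ y, (χ (x, y) : ℂ) = Fintype.card H * φ x := by
    rw [← h1, ← smul_eq_mul, ← map_smul]
    rw [← LinearMap.comp_smul, h5]
    change _ = LinearMap.trace ℂ V (ρ (x, 1) * _)
    rw [Finset.mul_sum, map_sum]
    refine Finset.sum_congr rfl fun y _ => ?_
    rw [← map_mul]
    rw [Prod.mk_mul_mk, mul_one, one_mul]
    exact (congrFun h (x, y)).symm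
  exact_mod_cast h6

theorem IsIrr.prod_eq {H : Type} [Group H] [Fintype G] [Fintype H] {χ : G × H → ℝ} (h : IsIrr χ)
    (x : G) (y : H) : χ (x, y) = χ (x, 1) * χ (1, y) / χ 1 := by
  have h1 := h.schur (x, 1) (1, y)
  have h2 : ∀ k : G × H, χ (k * (x, 1) * k⁻¹ * (1, y)) = χ (x, y) := by
    intro k
    rw [← h.isChar.conj_eq (x, y) (k.1, 1)]
    congr 1
    ext <;> simp
  simp only [h2] at h1
  rw [Finset.sum_const, nsmul_eq_mul, Finset.card_univ] at h1
  exact mul_left_cancel₀ (by exact_mod_cast Fintype.card_ne_zero) h1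

/-- If `ψ` is a nonzero character on which central elements act by scalars then it has an
irreducible constituent with the same normalized character. -/
theorem IsChar.exists_irr_of_scalar [Fintype G] [Ambivalent G] {ψ c : G → ℝ} (h : IsChar ψ)
    (h0 : ψ 1 ≠ 0)
    (hc : ∀ x y, ∑ k, ψ (k * x * k⁻¹ * y) = Fintype.card G * (c x * ψ y)) :
    ∃ α : G → ℝ, IsIrr α ∧ ∀ x, α x = c x * α 1 := by
  classical
  obtain ⟨s, hs, rfl⟩ := h.exists_multiset
  obtain ⟨α, hα⟩ : ∃ α, α ∈ s := by
    by_contra! hn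
    rw [Multiset.eq_zero_of_forall_notMem hn] at h0
    simp at h0
  have hαi := hs α hα
  refine ⟨α, hαi, fun x => ?_⟩
  have hcard : (Fintype.card G : ℝ) ≠ 0 := by exact_mod_cast Fintype.card_ne_zero
  have key : ∀ t : Multiset (G → ℝ), (∀ ψ ∈ t, IsIrr ψ) →
      (∑ y, (∑ k, t.sum (k * x * k⁻¹ * y)) * α y =
        t.count α * (Fintype.card G * (Fintype.card G * (α x / α 1)))) ∧
      (∑ y, t.sum y * α y = t.count α * Fintype.card G) := by
    intro t
    induction t using Multiset.induction with
    | empty => simp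
    | cons a t ih =>
      intro ht
      obtain ⟨i1, i2⟩ := ih fun ψ hψ => ht ψ (Multiset.mem_cons_of_mem hψ)
      have ha := ht a (Multiset.mem_cons_self a t)
      simp only [Multiset.sum_cons, Pi.add_apply, add_mul, Finset.sum_add_distrib, i1, i2,
        ha.schur, ha.orth hαi, Multiset.count_cons]
      have : ∑ y, (Fintype.card G : ℝ) * (a x * a y / a 1) * α y =
          Fintype.card G * (a x / a 1) * ∑ y, a y * α y := by
        rw [Finset.mul_sum]
        exact Finset.sum_congr rfl fun y _ => by ring
      rw [this, ha.orth hαi]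
      by_cases hh : a = α
      · subst hh; push_cast; simp; constructor <;> ring
      · simp [hh, Ne.symm hh]
  obtain ⟨k1, k2⟩ := key s hs
  simp only [hc] at k1
  have h2 : ∑ y, (Fintype.card G : ℝ) * (c x * s.sum y) * α y =
      Fintype.card G * c x * ∑ y, s.sum y * α y := by
    rw [Finset.mul_sum]
    exact Finset.sum_congr rfl fun y _ => by ring
  rw [h2, k2] at k1
  have hcount : (s.count α : ℝ) ≠ 0 := by
    exact_mod_cast (Multiset.count_pos.2 hα).ne'
  have h1 := hαi.one_pos
  have h3 : c x = α x / α 1 := by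
    have : (Fintype.card G : ℝ) * Fintype.card G * s.count α * c x =
      (Fintype.card G : ℝ) * Fintype.card G * s.count α * (α x / α 1) := by linarith
    exact mul_left_cancel₀ (by positivity) this
  rw [h3]
  field_simp

theorem IsIrr.exists_fst {H : Type} [Group H] [Fintype G] [Fintype H] [Ambivalent G]
    {χ : G × H → ℝ} (h : IsIrr χ) :
    ∃ α : G → ℝ, IsIrr α ∧ ∀ x, α x = χ (x, 1) / χ 1 * α 1 := by
  have h0 := h.one_pos
  refine (h.isChar.comp (MonoidHom.inl G H)).exists_irr_of_scalar (by
    simp only [map_one]; linarith) fun x y => ?_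
  have h1 := h.schur (x, 1) (y, 1)
  have h2 : ∀ k : G × H, χ (k * (x, 1) * k⁻¹ * (y, 1)) = χ (k.1 * x * k.1⁻¹ * y, 1) := by
    intro k
    congr 1
    ext <;> simp
  simp only [h2, Fintype.sum_prod_type, Finset.sum_const, nsmul_eq_mul, Finset.card_univ,
    ← Finset.mul_sum, Fintype.card_prod, Nat.cast_mul] at h1
  simp only [MonoidHom.inl_apply]
  have hc : (Fintype.card H : ℝ) ≠ 0 := by exact_mod_cast Fintype.card_ne_zero
  refine mul_left_cancel₀ hc (h1.trans ?_)
  ring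

theorem IsIrr.exists_snd {H : Type} [Group H] [Fintype G] [Fintype H] [Ambivalent H]
    {χ : G × H → ℝ} (h : IsIrr χ) :
    ∃ β : H → ℝ, IsIrr β ∧ ∀ x, β x = χ (1, x) / χ 1 * β 1 := by
  have h0 := h.one_pos
  refine (h.isChar.comp (MonoidHom.inr G H)).exists_irr_of_scalar (by
    simp only [map_one]; linarith) fun x y => ?_
  have h1 := h.schur (1, x) (1, y)
  have h2 : ∀ k : G × H, χ (k * (1, x) * k⁻¹ * (1, y)) = χ (1, k.2 * x * k.2⁻¹ * y) := by
    intro k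
    congr 1
    ext <;> simp
  simp only [h2, Fintype.sum_prod_type, Finset.sum_const, nsmul_eq_mul, Finset.card_univ,
    Fintype.card_prod, Nat.cast_mul] at h1
  simp only [MonoidHom.inr_apply]
  have hc : (Fintype.card G : ℝ) ≠ 0 := by exact_mod_cast Fintype.card_ne_zero
  refine mul_left_cancel₀ hc (h1.trans ?_)
  ring

theorem IsIrr.one_le_index [Fintype G] {χ : G → ℝ} (h : IsIrr χ) {K : Type} [Group K] [Fintype K]
    (f : K →* G) (hf : Function.Injective f) (h0 : ∑ k, χ (f k) ≠ 0) :
    χ 1 * Fintype.card K ≤ Fintype.card G := by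
  classical
  obtain ⟨d, hd⟩ := (h.isChar.comp f).sum_eq
  have h1 := h.one_pos
  rw [hd] at h0
  have hK : (0 : ℝ) < Fintype.card K := by exact_mod_cast Fintype.card_pos
  have hd1 : (1 : ℝ) ≤ d := by
    have : d ≠ 0 := fun e => h0 (by simp [e])
    exact_mod_cast Nat.one_le_iff_ne_zero.2 this
  have e1 : ∑ g, (∑ k, χ (g * f k)) ^ 2 =
      Fintype.card G * Fintype.card K * (Fintype.card K * d) / χ 1 := by
    simp only [sq, Finset.sum_mul_sum]
    rw [Finset.sum_comm]
    have : ∀ k, ∑ g, ∑ l, χ (g * f k) * χ (g * f l) =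
        Fintype.card G * (Fintype.card K * d) / χ 1 := by
      intro k
      rw [Finset.sum_comm]
      simp only [h.convolution]
      rw [← hd, ← Equiv.sum_comp (Equiv.mulLeft k⁻¹) (fun k => χ (f k)), Finset.mul_sum,
        Finset.sum_div]
      simp
    rw [Finset.sum_congr rfl fun k _ => this k]
    simp
    ring
  have e2 : ∑ k, (∑ l, χ (f k * f l)) ^ 2 ≤ ∑ g, (∑ k, χ (g * f k)) ^ 2 := by
    rw [← Finset.sum_image (s := Finset.univ) (g := f)
      (f := fun g => (∑ l, χ (g * f l)) ^ 2) (fun x _ y _ e => hf e)]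
    exact Finset.sum_le_sum_of_subset_of_nonneg (Finset.subset_univ _) fun _ _ _ => sq_nonneg _
  have e3 : ∀ k, ∑ l, χ (f k * f l) = Fintype.card K * d := by
    intro k
    rw [← hd, ← Equiv.sum_comp (Equiv.mulLeft k) (fun k => χ (f k))]
    simp
  simp only [e3, Finset.sum_const, nsmul_eq_mul, Finset.card_univ, e1] at e2
  rw [le_div_iff₀ (by linarith)] at e2
  have hG : (0 : ℝ) < Fintype.card G := by exact_mod_cast Fintype.card_pos
  have e4 : (Fintype.card K * (Fintype.card K * d)) * (χ 1 * Fintype.card K * d) ≤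
     (Fintype.card K * (Fintype.card K * d)) * (Fintype.card G : ℝ) := by
    calc _ = Fintype.card K * (Fintype.card K * d) ^ 2 * χ 1 := by ring
      _ ≤ _ := e2
      _ = _ := by ring
  have e5 := le_of_mul_le_mul_left e4 (by positivity)
  refine le_trans ?_ e5
  exact le_mul_of_one_le_right (by positivity) hd1

theorem IsIrr.sqrt_defect_mul [Fintype G] {χ : G → ℝ} (h : IsIrr χ) (x y : G) :
    √(1 - |χ (x * y)| / χ 1) ≤ √(1 - |χ x| / χ 1) + √(1 - |χ y| / χ 1) := by
  have h1 := h.one_pos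
  have hG : (0 : ℝ) < Fintype.card G := by exact_mod_cast Fintype.card_pos
  let v : G → EuclideanSpace ℝ G := fun g => WithLp.toLp 2 fun k => χ (k * g)
  have hin : ∀ g k, inner ℝ (v g) (v k) = Fintype.card G * (χ (g⁻¹ * k) / χ 1) := by
    intro g k
    rw [PiLp.inner_apply, ← mul_div_assoc, ← h.convolution]
    simp [v, mul_comm]
  have hself : ∀ g, ‖v g‖ ^ 2 = Fintype.card G := by
    intro g
    rw [← real_inner_self_eq_norm_sq, hin, inv_mul_cancel, div_self (by linarith), mul_one]
  have hd : ∀ g k (s : ℝ), s ^ 2 = 1 → ‖v g - s • v k‖ =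
      √(2 * Fintype.card G) * √(1 - s * χ (g⁻¹ * k) / χ 1) := by
    intro g k s hs
    rw [← Real.sqrt_mul (by positivity), ← Real.sqrt_sq (norm_nonneg _), norm_sub_sq_real,
      norm_smul, mul_pow, hself, hself, inner_smul_right, hin, Real.norm_eq_abs, sq_abs, hs]
    congr 1
    ring
  have hs : ∀ a : ℝ, ∃ s : ℝ, s ^ 2 = 1 ∧ s * a = |a| := by
    intro a
    rcases le_total 0 a with h | h
    · exact ⟨1, by norm_num, by rw [abs_of_nonneg h]; ring⟩
    · exact ⟨-1, by norm_num, by rw [abs_of_nonpos h]; ring⟩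
  obtain ⟨s, hs1, hs2⟩ := hs (χ x)
  obtain ⟨t, ht1, ht2⟩ := hs (χ y)
  have k1 := hd 1 x s hs1
  have k2 := hd x (x * y) t ht1
  have k3 := hd 1 (x * y) (s * t) (by rw [mul_pow, hs1, ht1]; norm_num)
  rw [inv_one, one_mul, hs2] at k1
  rw [inv_mul_cancel_left, ht2] at k2
  rw [inv_one, one_mul] at k3
  have tri : ‖v 1 - (s * t) • v (x * y)‖ ≤ ‖v 1 - s • v x‖ + ‖v x - t • v (x * y)‖ := by
    have : v 1 - (s * t) • v (x * y) = (v 1 - s • v x) + s • (v x - t • v (x * y)) := by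
      rw [smul_sub, smul_smul]; abel
    rw [this]
    refine (norm_add_le _ _).trans (add_le_add le_rfl ?_)
    rw [norm_smul]
    have : ‖s‖ = 1 := by
      rw [Real.norm_eq_abs, ← abs_one]; exact (sq_eq_sq_iff_abs_eq_abs _ _).1 (by rw [hs1]; simp)
    rw [this, one_mul]
  rw [k1, k2, k3, ← mul_add] at tri
  refine le_trans ?_ (le_of_mul_le_mul_left tri (by positivity))
  refine Real.sqrt_le_sqrt ?_
  have : s * t * χ (x * y) ≤ |χ (x * y)| := by
    refine (le_abs_self _).trans ?_
    have h2 : |s * t| = 1 := by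
      rw [← abs_one]; exact (sq_eq_sq_iff_abs_eq_abs _ _).1 (by rw [mul_pow, hs1, ht1]; simp)
    rw [abs_mul, h2, one_mul]
  gcongr

end Real

end CharacterAverages

section PermsOn

open Equiv

variable {α : Type} [Fintype α] [DecidableEq α]

/-- The permutations of `α` fixing every point outside `D`. -/
def permsOn (D : Finset α) : Finset (Perm α) :=
  Finset.univ.filter fun σ => ∀ x, x ∉ D → σ x = x

theorem mem_permsOn {D : Finset α} {σ : Perm α} : σ ∈ permsOn D ↔ ∀ x, x ∉ D → σ x = x := by
  simp [permsOn]

theorem one_mem_permsOn (D : Finset α) : (1 : Perm α) ∈ permsOn D := by simp [mem_permsOn]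

theorem mul_mem_permsOn {D : Finset α} {σ τ : Perm α} (h : σ ∈ permsOn D) (h' : τ ∈ permsOn D) :
    σ * τ ∈ permsOn D := by
  rw [mem_permsOn] at *
  intro x hx
  simp [h' x hx, h x hx]

theorem inv_mem_permsOn {D : Finset α} {σ : Perm α} (h : σ ∈ permsOn D) : σ⁻¹ ∈ permsOn D := by
  rw [mem_permsOn] at *
  intro x hx
  rw [Perm.inv_eq_iff_eq, h x hx]

theorem permsOn_mono {D E : Finset α} (h : D ⊆ E) : permsOn D ⊆ permsOn E := by
  intro σ hσ
  rw [mem_permsOn] at *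
  exact fun x hx => hσ x fun h' => hx (h h')

theorem apply_mem_of_permsOn {D : Finset α} {σ : Perm α} (h : σ ∈ permsOn D) {x : α} (hx : x ∈ D) :
    σ x ∈ D := by
  by_contra h'
  have := mem_permsOn.1 h _ h'
  rw [σ.injective this] at h'
  exact h' hx

theorem permsOn_commute {D E : Finset α} (h : Disjoint D E) {σ τ : Perm α} (hσ : σ ∈ permsOn D)
    (hτ : τ ∈ permsOn E) : σ * τ = τ * σ := by
  refine (Perm.Disjoint.commute fun x => ?_).eq
  by_cases hx : x ∈ D
  · exact Or.inr (mem_permsOn.1 hτ x (Finset.disjoint_left.1 h hx))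
  · exact Or.inl (mem_permsOn.1 hσ x hx)

theorem permsOn_univ : permsOn (Finset.univ : Finset α) = Finset.univ := by
  ext; simp [mem_permsOn]

theorem permsOn_empty : permsOn (∅ : Finset α) = {1} := by
  ext σ
  simp only [mem_permsOn, Finset.notMem_empty, not_false_eq_true, true_implies,
    Finset.mem_singleton]
  exact ⟨fun h => Equiv.ext h, fun h x => by simp [h]⟩

theorem sum_permsOn {M : Type} [AddCommMonoid M] (D : Finset α) (f : Perm α → M) :
    ∑ σ ∈ permsOn D, f σ = ∑ ρ : Perm {x // x ∈ D}, f (Perm.ofSubtype ρ) := by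
  symm
  refine Finset.sum_bij (fun ρ _ => Perm.ofSubtype ρ) ?_ ?_ ?_ ?_
  · intro ρ _
    rw [mem_permsOn]
    intro x hx
    exact Perm.ofSubtype_apply_of_not_mem ρ hx
  · intro a _ b _ h
    exact Perm.ofSubtype_injective h
  · intro σ hσ
    refine ⟨σ.subtypePerm (p := fun x => x ∈ D) ?_, Finset.mem_univ _, ?_⟩
    · intro x
      refine ⟨fun h => ?_, apply_mem_of_permsOn hσ⟩
      have := apply_mem_of_permsOn (inv_mem_permsOn hσ) h
      simpa using this
    · refine Perm.ofSubtype_subtypePerm _ fun x hx => ?_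
      by_contra h
      exact hx (mem_permsOn.1 hσ x h)
  · simp

theorem ofSubtype_mem_permsOn {D : Finset α} (ρ : Perm {x // x ∈ D}) :
    Perm.ofSubtype ρ ∈ permsOn D :=
  mem_permsOn.2 fun _ hx => Perm.ofSubtype_apply_of_not_mem ρ hx

theorem exists_ofSubtype_eq {D : Finset α} {σ : Perm α} (h : σ ∈ permsOn D) :
    ∃ ρ : Perm {x // x ∈ D}, Perm.ofSubtype ρ = σ := by
  have h1 := (Perm.mem_range_ofSubtype_iff (p := fun x => x ∈ D) (g := σ)).2
  obtain ⟨ρ, hρ⟩ := h1 fun x hx => by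
    by_contra h'
    simp only [Finset.mem_coe, Perm.mem_support] at hx
    exact hx (mem_permsOn.1 h x h')
  exact ⟨ρ, hρ⟩

theorem card_permsOn (D : Finset α) : (permsOn D).card = D.card.factorial := by
  rw [Finset.card_eq_sum_ones, sum_permsOn]
  simp [Fintype.card_perm]

theorem conj_mem_permsOn {D : Finset α} {σ : Perm α} (g : Perm α) :
    g * σ * g⁻¹ ∈ permsOn (D.map g.toEmbedding) ↔ σ ∈ permsOn D := by
  simp only [mem_permsOn]
  constructor
  · intro h x hx
    have := h (g x) (by simpa using hx)
    simpa using this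
  · intro h x hx
    have := h (g⁻¹ x) (by
      intro h'
      apply hx
      rw [Finset.mem_map]
      exact ⟨_, h', by simp⟩)
    rw [Perm.mul_apply, Perm.mul_apply, this]
    simp

theorem sum_permsOn_map {M : Type} [AddCommMonoid M] (D : Finset α) (g : Perm α)
    (f : Perm α → M) :
    ∑ σ ∈ permsOn (D.map g.toEmbedding), f σ = ∑ σ ∈ permsOn D, f (g * σ * g⁻¹) := by
  refine Finset.sum_nbij' (fun σ => g⁻¹ * σ * g) (fun σ => g * σ * g⁻¹) ?_ ?_ ?_ ?_ ?_
  · intro σ hσ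
    rw [← conj_mem_permsOn g]
    simpa [mul_assoc] using hσ
  · exact fun σ hσ => (conj_mem_permsOn g).2 hσ
  · intro σ _; simp [mul_assoc]
  · intro σ _; simp [mul_assoc]
  · intro σ _; simp [mul_assoc]

theorem map_eq_self_of_disjoint {D E : Finset α} (hd : Disjoint D E) {g : Perm α}
    (h : g ∈ permsOn D) : E.map g.toEmbedding = E := by
  ext x
  rw [Finset.mem_map]
  constructor
  · rintro ⟨y, hy, rfl⟩
    have := mem_permsOn.1 h y (Finset.disjoint_right.1 hd hy)
    simpa [this] using hy
  · intro hx
    exact ⟨x, hx, mem_permsOn.1 h x (Finset.disjoint_right.1 hd hx)⟩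

theorem exists_perm_map_eq {M A B : Finset α} (hA : A ⊆ M) (hB : B ⊆ M) (hc : A.card = B.card) :
    ∃ g ∈ permsOn M, A.map g.toEmbedding = B := by
  have hc' : (A.subtype (· ∈ M)).card = (B.subtype (· ∈ M)).card := by
    rw [Finset.card_subtype, Finset.card_subtype, Finset.filter_true_of_mem hA,
      Finset.filter_true_of_mem hB, hc]
  let e := Finset.equivOfCardEq hc'
  let ρ : Perm {x // x ∈ M} := e.extendSubtype
  refine ⟨Perm.ofSubtype ρ, ofSubtype_mem_permsOn ρ, ?_⟩
  apply Finset.eq_of_subset_of_card_le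
  · intro x hx
    obtain ⟨y, hy, rfl⟩ := Finset.mem_map.1 hx
    have h1 : (⟨y, hA hy⟩ : {x // x ∈ M}) ∈ A.subtype (· ∈ M) := by simpa using hy
    have := Equiv.extendSubtype_mem e ⟨y, hA hy⟩ h1
    rw [Finset.mem_subtype] at this
    simp only [Equiv.coe_toEmbedding]
    rw [Perm.ofSubtype_apply_of_mem ρ (hA hy)]
    exact this
  · simp [hc]

/-- Permutations supported on two disjoint sets, as a homomorphism. -/
noncomputable def blockHom {A B : Finset α} (h : Disjoint A B) :
    Perm {x // x ∈ A} × Perm {x // x ∈ B} →* Perm α :=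
  MonoidHom.noncommCoprod Perm.ofSubtype Perm.ofSubtype fun ρ θ =>
    permsOn_commute h (ofSubtype_mem_permsOn ρ) (ofSubtype_mem_permsOn θ)

theorem blockHom_apply {A B : Finset α} (h : Disjoint A B) (ρ : Perm {x // x ∈ A})
    (θ : Perm {x // x ∈ B}) : blockHom h (ρ, θ) = Perm.ofSubtype ρ * Perm.ofSubtype θ := rfl

theorem IsChar.partial_sum {χ : Perm α → ℝ} (hχ : IsChar χ) {A B : Finset α} (h : Disjoint A B) :
    ∃ ψ : Perm {x // x ∈ A} → ℝ, IsChar ψ ∧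
      ∀ τ, ∑ η ∈ permsOn B, χ (Perm.ofSubtype τ * η) = B.card.factorial * ψ τ := by
  obtain ⟨ψ, h1, h2⟩ := IsChar.invariants (hχ.comp (blockHom h))
  refine ⟨ψ, h1, fun τ => ?_⟩
  rw [sum_permsOn]
  have := h2 τ
  rw [Fintype.card_perm, Fintype.card_coe] at this
  exact this

theorem IsChar.abs_partial_sum_le {χ : Perm α → ℝ} (hχ : IsChar χ) {A B : Finset α}
    (h : Disjoint A B) {τ : Perm α} (hτ : τ ∈ permsOn A) :
    |∑ η ∈ permsOn B, χ (τ * η)| ≤ ∑ η ∈ permsOn B, χ η := by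
  obtain ⟨ψ, h1, h2⟩ := hχ.partial_sum h
  obtain ⟨ρ, rfl⟩ := exists_ofSubtype_eq hτ
  have h3 := h2 1
  simp only [map_one, one_mul] at h3
  rw [h2, h3, abs_mul, Nat.abs_cast]
  exact mul_le_mul_of_nonneg_left (h1.abs_le _) (by positivity)

theorem IsChar.partial_sum_eq_zero {χ : Perm α → ℝ} (hχ : IsChar χ) {A B : Finset α}
    (h : Disjoint A B) (h0 : ∑ η ∈ permsOn B, χ η = 0) {τ : Perm α} (hτ : τ ∈ permsOn A) :
    ∑ η ∈ permsOn B, χ (τ * η) = 0 := by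
  have := hχ.abs_partial_sum_le h hτ
  rw [h0] at this
  exact abs_eq_zero.1 (le_antisymm this (abs_nonneg _))

/-- The average of a character over the permutations supported in `D` is a natural number. -/
theorem IsChar.sum_permsOn_eq {χ : Perm α → ℝ} (hχ : IsChar χ) (D : Finset α) :
    ∃ d : ℕ, ∑ ρ ∈ permsOn D, χ ρ = D.card.factorial * d := by
  obtain ⟨d, hd⟩ := (hχ.comp (Perm.ofSubtype (p := fun x => x ∈ D))).sum_eq
  refine ⟨d, ?_⟩
  rw [sum_permsOn, hd, Fintype.card_perm, Fintype.card_coe]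

end PermsOn

section Restr

open Equiv

set_option linter.unusedSectionVars false

variable {α : Type} [Fintype α] [DecidableEq α]

/-- `A` is stable under `σ`. -/
def IsInv (σ : Perm α) (A : Finset α) : Prop := ∀ x ∈ A, σ x ∈ A

instance (σ : Perm α) (A : Finset α) : Decidable (IsInv σ A) := by unfold IsInv; infer_instance

theorem IsInv.map_eq {σ : Perm α} {A : Finset α} (h : IsInv σ A) : A.map σ.toEmbedding = A := by
  apply Finset.eq_of_subset_of_card_le
  · intro x hx
    obtain ⟨y, hy, rfl⟩ := Finset.mem_map.1 hx
    exact h y hy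
  · simp

theorem IsInv.mem_iff {σ : Perm α} {A : Finset α} (h : IsInv σ A) (x : α) : σ x ∈ A ↔ x ∈ A := by
  refine ⟨fun h' => ?_, h x⟩
  rw [← h.map_eq] at h'
  simpa using h'

/-- The restriction of `σ` to a stable set `A`, extended by the identity. -/
noncomputable def restr (σ : Perm α) (A : Finset α) : Perm α :=
  if h : IsInv σ A then Perm.ofSubtype (σ.subtypePerm (p := fun x => x ∈ A) h.mem_iff) else 1

theorem restr_apply {σ : Perm α} {A : Finset α} (h : IsInv σ A) (x : α) :
    restr σ A x = if x ∈ A then σ x else x := by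
  rw [restr, dif_pos h]
  split_ifs with hx
  · rw [Perm.ofSubtype_apply_of_mem _ hx]; simp
  · rw [Perm.ofSubtype_apply_of_not_mem _ hx]

theorem restr_mem (σ : Perm α) (A : Finset α) : restr σ A ∈ permsOn A := by
  rw [restr]
  split_ifs with h
  · exact ofSubtype_mem_permsOn _
  · exact one_mem_permsOn A

theorem IsInv.compl {σ : Perm α} {A : Finset α} (h : IsInv σ A) : IsInv σ Aᶜ := by
  intro x hx
  rw [Finset.mem_compl] at *
  rwa [h.mem_iff]

theorem IsInv.union {σ : Perm α} {A B : Finset α} (h : IsInv σ A) (h' : IsInv σ B) : IsInv σ (A ∪ B) := by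
  intro x hx
  rw [Finset.mem_union] at *
  exact hx.imp (h x) (h' x)

theorem IsInv.sdiff {σ : Perm α} {A B : Finset α} (h : IsInv σ A) (h' : IsInv σ B) : IsInv σ (A \ B) := by
  intro x hx
  rw [Finset.mem_sdiff] at *
  exact ⟨h x hx.1, by rw [h'.mem_iff]; exact hx.2⟩

theorem inv_of_permsOn {σ : Perm α} {A : Finset α} (h : σ ∈ permsOn A) : IsInv σ A :=
  fun _ hx => apply_mem_of_permsOn h hx

theorem IsInv.restr_union {σ : Perm α} {A B : Finset α} (h : IsInv σ A) (h' : IsInv σ B)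
    (hd : Disjoint A B) : restr σ (A ∪ B) = restr σ A * restr σ B := by
  ext x
  rw [Perm.mul_apply, restr_apply (h.union h'), restr_apply h', restr_apply h]
  by_cases hA : x ∈ A
  · have := Finset.disjoint_left.1 hd hA
    simp [hA, this]
  · by_cases hB : x ∈ B
    · have h1 := Finset.disjoint_right.1 hd (h' x hB)
      simp [hB, h1]
    · simp [hA, hB]

theorem restr_eq_self {σ : Perm α} {A : Finset α} (h : σ ∈ permsOn A) : restr σ A = σ := by
  ext x
  rw [restr_apply (inv_of_permsOn h)]
  split_ifs with hx
  · rfl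
  · rw [mem_permsOn.1 h x hx]

theorem IsInv.eq_mul {σ : Perm α} {A : Finset α} (h : IsInv σ A) : σ = restr σ A * restr σ Aᶜ := by
  rw [← h.restr_union h.compl disjoint_compl_right, Finset.union_compl, restr_eq_self]
  rw [permsOn_univ]; exact Finset.mem_univ _

theorem inv_mul_iff {A : Finset α} {τ θ : Perm α} (hτ : τ ∈ permsOn A) (hθ : θ ∈ permsOn Aᶜ)
    (B : Finset α) : IsInv (τ * θ) B ↔ IsInv τ (B ∩ A) ∧ IsInv θ (B ∩ Aᶜ) := by
  have h1 : ∀ x ∈ A, (τ * θ) x = τ x := fun x hx => by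
    rw [Perm.mul_apply, mem_permsOn.1 hθ x (by simpa using hx)]
  have h2 : ∀ x ∈ Aᶜ, (τ * θ) x = θ x := fun x hx => by
    rw [Perm.mul_apply]
    exact mem_permsOn.1 hτ _ (by simpa using apply_mem_of_permsOn hθ hx)
  constructor
  · intro h
    constructor
    · intro x hx
      rw [Finset.mem_inter] at *
      have := h x hx.1
      rw [h1 x hx.2] at this
      exact ⟨this, apply_mem_of_permsOn hτ hx.2⟩
    · intro x hx
      rw [Finset.mem_inter] at *
      have := h x hx.1
      rw [h2 x hx.2] at this
      exact ⟨this, apply_mem_of_permsOn hθ hx.2⟩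
  · rintro ⟨h, h'⟩ x hx
    by_cases hA : x ∈ A
    · rw [h1 x hA]; exact (Finset.mem_inter.1 (h x (Finset.mem_inter.2 ⟨hx, hA⟩))).1
    · have hA' : x ∈ Aᶜ := by simpa using hA
      rw [h2 x hA']; exact (Finset.mem_inter.1 (h' x (Finset.mem_inter.2 ⟨hx, hA'⟩))).1

theorem restr_mul {A B : Finset α} {τ θ : Perm α} (hτ : τ ∈ permsOn A) (hθ : θ ∈ permsOn Aᶜ)
    (h : IsInv (τ * θ) B) : restr (τ * θ) B = restr τ (B ∩ A) * restr θ (B ∩ Aᶜ) := by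
  obtain ⟨h1, h2⟩ := (inv_mul_iff hτ hθ B).1 h
  ext x
  rw [Perm.mul_apply, restr_apply h, restr_apply h1, restr_apply h2]
  by_cases hA : x ∈ A
  · have h3 : x ∉ B ∩ Aᶜ := by simp [hA]
    have h4 : θ x = x := mem_permsOn.1 hθ x (by simpa using hA)
    simp [h3, hA, h4]
  · have hA' : x ∈ Aᶜ := by simpa using hA
    by_cases hB : x ∈ B
    · have h5 := apply_mem_of_permsOn hθ hA'
      have h6 : θ x ∉ A := by simpa using h5
      have h7 := mem_permsOn.1 hτ _ h6
      simp [hA, hB, h6, h7]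
    · simp [hA, hB]

theorem restr_mul_left {A D : Finset α} {τ θ : Perm α} (hτ : τ ∈ permsOn A)
    (hθ : θ ∈ permsOn D) (hd : Disjoint A D) : IsInv (τ * θ) A ∧ restr (τ * θ) A = τ := by
  have h0 : IsInv (τ * θ) A := fun x hx => by
    rw [Perm.mul_apply, mem_permsOn.1 hθ x (Finset.disjoint_left.1 hd hx)]
    exact apply_mem_of_permsOn hτ hx
  refine ⟨h0, ?_⟩
  ext x
  rw [restr_apply h0]
  split_ifs with hx
  · rw [Perm.mul_apply, mem_permsOn.1 hθ x (Finset.disjoint_left.1 hd hx)]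
  · rw [mem_permsOn.1 hτ x hx]

/-- Summing over permutations with a stable set `A` amounts to summing over both blocks. -/
theorem sum_inv_restr {M : Type} [AddCommMonoid M] {A D : Finset α} (hA : A ⊆ D)
    (F : Perm α → Perm α → M) :
    ∑ ξ ∈ permsOn D with IsInv ξ A, F (restr ξ A) (restr ξ (D \ A)) =
      ∑ τ ∈ permsOn A, ∑ θ ∈ permsOn (D \ A), F τ θ := by
  have hd : Disjoint A (D \ A) := Finset.disjoint_sdiff
  rw [← Finset.sum_product']
  refine Finset.sum_nbij' (fun ξ => (restr ξ A, restr ξ (D \ A))) (fun p => p.1 * p.2) ?_ ?_ ?_ ?_ ?_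
  · intro ξ _
    exact Finset.mem_product.2 ⟨restr_mem _ _, restr_mem _ _⟩
  · rintro ⟨τ, θ⟩ h
    obtain ⟨h1, h2⟩ := Finset.mem_product.1 h
    refine Finset.mem_filter.2 ⟨mul_mem_permsOn (permsOn_mono hA h1)
      (permsOn_mono Finset.sdiff_subset h2), (restr_mul_left h1 h2 hd).1⟩
  · intro ξ h
    obtain ⟨h1, h2⟩ := Finset.mem_filter.1 h
    have h3 : IsInv ξ (D \ A) := (inv_of_permsOn h1).sdiff h2
    change restr ξ A * restr ξ (D \ A) = ξ
    rw [← h2.restr_union h3 hd, Finset.union_sdiff_of_subset hA, restr_eq_self h1]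
  · rintro ⟨τ, θ⟩ h
    obtain ⟨h1, h2⟩ := Finset.mem_product.1 h
    simp only [Prod.mk.injEq]
    refine ⟨(restr_mul_left h1 h2 hd).2, ?_⟩
    rw [permsOn_commute hd h1 h2]
    exact (restr_mul_left h2 h1 hd.symm).2
  · simp

theorem sum_inv_restr_card {A D : Finset α} (hA : A ⊆ D) (F : Perm α → ℝ) :
    ∑ ξ ∈ permsOn D with IsInv ξ A, F (restr ξ A) =
      ((D.card - A.card).factorial : ℕ) * ∑ τ ∈ permsOn A, F τ := by
  rw [sum_inv_restr hA fun τ _ => F τ]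
  simp only [Finset.sum_const, card_permsOn, Finset.card_sdiff_of_subset hA, nsmul_eq_mul,
    Finset.mul_sum]

/-- The orbit of `x` under `σ`. -/
def orb (σ : Perm α) (x : α) : Finset α := Finset.univ.filter fun y => σ.SameCycle x y

theorem mem_orb {σ : Perm α} {x y : α} : y ∈ orb σ x ↔ σ.SameCycle x y := by simp [orb]

theorem inv_orb (σ : Perm α) (x : α) : IsInv σ (orb σ x) := fun y hy => by
  rw [mem_orb] at *
  exact Perm.sameCycle_apply_right.2 hy

theorem restr_orb (σ : Perm α) (x : α) : restr σ (orb σ x) = σ.cycleOf x := by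
  ext y
  rw [restr_apply (inv_orb σ x), Perm.cycleOf_apply]
  simp only [mem_orb]

theorem orb_subset {σ : Perm α} {A : Finset α} (h : IsInv σ A) {x : α} (hx : x ∈ A) :
    orb σ x ⊆ A := by
  intro y hy
  rw [mem_orb] at hy
  obtain ⟨n, hn, rfl⟩ := hy.exists_pow_eq'
  clear hn hy
  induction n with
  | zero => simpa
  | succ n ih =>
    rw [pow_succ', Perm.mul_apply]
    exact h _ ih

theorem self_mem_orb (σ : Perm α) (x : α) : x ∈ orb σ x := mem_orb.2 (Perm.SameCycle.refl _ _)

theorem orb_eq_singleton {σ : Perm α} {x : α} (h : σ x = x) : orb σ x = {x} := by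
  apply Finset.Subset.antisymm
  · exact orb_subset (fun y hy => by simp_all) (Finset.mem_singleton_self x)
  · simpa using self_mem_orb σ x

theorem orb_eq_support {σ : Perm α} {x : α} (h : σ x ≠ x) : orb σ x = (σ.cycleOf x).support := by
  ext y
  rw [mem_orb, Perm.mem_support_cycleOf_iff]
  simp [h]

theorem sign_restr_orb (σ : Perm α) (x : α) :
    (-1 : ℤˣ) ^ (orb σ x).card * Perm.sign (restr σ (orb σ x)) = -1 := by
  rw [restr_orb]
  by_cases h : σ x = x
  · rw [orb_eq_singleton h, Perm.cycleOf_eq_one_iff _ |>.2 h]; simp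
  · rw [orb_eq_support h, (Perm.isCycle_cycleOf σ h).sign, mul_neg, ← mul_pow]
    simp

theorem disjoint_orb {σ : Perm α} {A : Finset α} (h : IsInv σ A) {x : α} (hx : x ∉ A) :
    Disjoint A (orb σ x) := by
  rw [Finset.disjoint_right]
  intro y hy hA
  refine hx (orb_subset h hA ?_)
  rw [mem_orb] at *
  exact hy.symm

/-- The sum over the stable subsets `C` of `E` of `(-1)^|C| sgn(ξ|_C)` vanishes. -/
theorem sum_sign_stable_eq_zero {E : Finset α} {ξ : Perm α} (hξ : ξ ∈ permsOn E)
    (hE : E.Nonempty) :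
    ∑ C ∈ E.powerset with IsInv ξ C,
      (-1 : ℝ) ^ C.card * ((Perm.sign (restr ξ C) : ℤ) : ℝ) = 0 := by
  obtain ⟨x, hx⟩ := hE
  set O := orb ξ x with hO
  have hOE : O ⊆ E := orb_subset (inv_of_permsOn hξ) hx
  have hOi : IsInv ξ O := inv_orb ξ x
  let w : Finset α → ℤˣ := fun C => (-1) ^ C.card * Perm.sign (restr ξ C)
  have hw : ∀ C, (-1 : ℝ) ^ C.card * ((Perm.sign (restr ξ C) : ℤ) : ℝ) = ((w C : ℤ) : ℝ) := by
    intro C; simp [w]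
  have hadd : ∀ C, IsInv ξ C → x ∉ C → w (C ∪ O) = - w C := by
    intro C hC hxC
    have hd : Disjoint C O := disjoint_orb hC hxC
    have h1 : w (C ∪ O) = w C * w O := by
      simp only [w]
      rw [Finset.card_union_of_disjoint hd, hC.restr_union hOi hd, pow_add, map_mul]
      exact mul_mul_mul_comm _ _ _ _
    have h2 : w O = -1 := sign_restr_orb ξ x
    rw [h1, h2, mul_neg, mul_one]
  simp only [hw]
  refine Finset.sum_involution (fun C _ => if x ∈ C then C \ O else C ∪ O) ?_ ?_ ?_ ?_
  · intro C hC
    obtain ⟨h1, h2⟩ := Finset.mem_filter.1 hC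
    split_ifs with h
    · have h3 : C = (C \ O) ∪ O := by
        rw [Finset.sdiff_union_of_subset (orb_subset h2 h)]
      have h4 := hadd (C \ O) (h2.sdiff hOi) (by simp [O, self_mem_orb])
      rw [← h3] at h4
      rw [h4]
      simp
    · rw [hadd C h2 h]
      simp
  · intro C hC _
    split_ifs with h
    · intro h'
      rw [← h'] at h
      simp [O, self_mem_orb] at h
    · intro h'
      rw [← h'] at h
      simp [O, self_mem_orb] at h
  · intro C hC
    obtain ⟨h1, h2⟩ := Finset.mem_filter.1 hC
    rw [Finset.mem_powerset] at h1
    rw [Finset.mem_filter, Finset.mem_powerset]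
    split_ifs with h
    · exact ⟨Finset.sdiff_subset.trans h1, h2.sdiff hOi⟩
    · exact ⟨Finset.union_subset h1 hOE, h2.union hOi⟩
  · intro C hC
    obtain ⟨h1, h2⟩ := Finset.mem_filter.1 hC
    by_cases h : x ∈ C
    · have h3 : x ∉ C \ O := by simp [O, self_mem_orb]
      simp only [h, if_true, h3, if_false]
      exact Finset.sdiff_union_of_subset (orb_subset h2 h)
    · have h3 : x ∈ C ∪ O := by simp [O, self_mem_orb]
      simp only [h, if_true, h3, if_false]
      exact Finset.union_sdiff_cancel_right (disjoint_orb h2 h)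

end Restr

section Stable

open Equiv

set_option linter.unusedSectionVars false

variable {α : Type} [Fintype α] [DecidableEq α]

/-- A function of a set and a permutation, invariant under relabelling. -/
def Equivariant (φ : Finset α → Perm α → ℝ) : Prop :=
  ∀ (g : Perm α) (E : Finset α) (τ : Perm α), φ (E.map g.toEmbedding) (g * τ * g⁻¹) = φ E τ

theorem Equivariant.eq {φ : Finset α → Perm α → ℝ} (h : Equivariant φ) {g τ τ' : Perm α}
    {E E' : Finset α} (hE : E.map g.toEmbedding = E') (hτ : g * τ * g⁻¹ = τ') :
    φ E' τ' = φ E τ := by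
  rw [← hE, ← hτ, h]

/-- The signed average of `φ` over the permutations of `C`. -/
noncomputable def signAvg (φ : Finset α → Perm α → ℝ) (A C : Finset α) (τ : Perm α) : ℝ :=
  (-1) ^ C.card / C.card.factorial *
    ∑ ρ ∈ permsOn C, ((Perm.sign ρ : ℤ) : ℝ) * φ (A ∪ C) (τ * ρ)

theorem signAvg_map {φ : Finset α → Perm α → ℝ} (h : Equivariant φ) (g : Perm α)
    (A C : Finset α) (τ : Perm α) :
    signAvg φ (A.map g.toEmbedding) (C.map g.toEmbedding) (g * τ * g⁻¹) = signAvg φ A C τ := by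
  unfold signAvg
  rw [Finset.card_map, sum_permsOn_map]
  congr 1
  refine Finset.sum_congr rfl fun ρ _ => ?_
  congr 1
  · rw [map_mul, map_mul, mul_right_comm, ← map_mul, mul_inv_cancel, map_one, one_mul]
  · exact h.eq (Finset.map_union ..) (by group)

theorem commute_conj_eq {A B : Finset α} (hd : Disjoint A B) {τ g : Perm α} (hτ : τ ∈ permsOn A)
    (hg : g ∈ permsOn B) : g * τ * g⁻¹ = τ := by
  rw [← permsOn_commute hd hτ hg]; simp

theorem signAvg_indep {φ : Finset α → Perm α → ℝ} (h : Equivariant φ) {A C C' : Finset α}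
    {τ : Perm α} (hτ : τ ∈ permsOn A) (hC : Disjoint A C) (hC' : Disjoint A C')
    (hc : C.card = C'.card) : signAvg φ A C τ = signAvg φ A C' τ := by
  obtain ⟨g, hg, rfl⟩ := exists_perm_map_eq (M := Aᶜ) (Finset.subset_compl_iff_disjoint_left.2 hC)
    (Finset.subset_compl_iff_disjoint_left.2 hC') hc
  have := signAvg_map h g A C τ
  rwa [map_eq_self_of_disjoint disjoint_compl_left hg,
    commute_conj_eq disjoint_compl_right hτ hg, eq_comm] at this

open Classical in
/-- The coefficient attached to a stable set `A` on which the permutation induces `τ`. -/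
noncomputable def coef (φ : Finset α → Perm α → ℝ) (k : ℕ) (A : Finset α) (τ : Perm α) : ℝ :=
  if h : ∃ C, Disjoint A C ∧ A.card + C.card = k then signAvg φ A h.choose τ else 0

theorem coef_eq {φ : Finset α → Perm α → ℝ} (h : Equivariant φ) {k : ℕ} {A C : Finset α}
    {τ : Perm α} (hτ : τ ∈ permsOn A) (hC : Disjoint A C) (hc : A.card + C.card = k) :
    coef φ k A τ = signAvg φ A C τ := by
  have h0 : ∃ C, Disjoint A C ∧ A.card + C.card = k := ⟨C, hC, hc⟩
  rw [coef, dif_pos h0]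
  have h1 := h0.choose_spec
  exact signAvg_indep h hτ h1.1 hC (by omega)

theorem coef_eq_zero (φ : Finset α → Perm α → ℝ) {k : ℕ} {A : Finset α} (hA : k < A.card)
    (τ : Perm α) : coef φ k A τ = 0 := by
  rw [coef, dif_neg]
  rintro ⟨C, _, h⟩
  omega

theorem coef_of_card {φ : Finset α → Perm α → ℝ} (h : Equivariant φ) {A : Finset α} {τ : Perm α}
    (hτ : τ ∈ permsOn A) : coef φ A.card A τ = φ A τ := by
  rw [coef_eq h hτ (Finset.disjoint_empty_right A) (by simp), signAvg, permsOn_empty]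
  simp

theorem exists_disjoint_card {k : ℕ} (hk : k ≤ Fintype.card α) {A : Finset α} (hA : A.card ≤ k) :
    ∃ C, Disjoint A C ∧ A.card + C.card = k := by
  have : k - A.card ≤ Aᶜ.card := by rw [Finset.card_compl]; omega
  obtain ⟨C, hC, hc⟩ := Finset.exists_subset_card_eq this
  exact ⟨C, Finset.subset_compl_iff_disjoint_left.1 hC, by omega⟩

theorem coef_map {φ : Finset α → Perm α → ℝ} (h : Equivariant φ) {k : ℕ} {A : Finset α}
    {τ : Perm α} (hτ : τ ∈ permsOn A) (hk : k ≤ Fintype.card α) (g : Perm α) :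
    coef φ k (A.map g.toEmbedding) (g * τ * g⁻¹) = coef φ k A τ := by
  rcases lt_or_ge k A.card with hA | hA
  · rw [coef_eq_zero _ hA, coef_eq_zero _ (by simpa using hA)]
  · obtain ⟨C, h1, h2⟩ := exists_disjoint_card hk hA
    rw [coef_eq h hτ h1 h2, coef_eq h ((conj_mem_permsOn g).2 hτ)
      ((Finset.disjoint_map g.toEmbedding).2 h1) (by simpa using h2), signAvg_map h]

/-- The class function with coefficients `coef φ k`. -/
noncomputable def stableSum (φ : Finset α → Perm α → ℝ) (k : ℕ) (σ : Perm α) : ℝ :=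
  ∑ A : Finset α with IsInv σ A, coef φ k A (restr σ A)

theorem sum_mul_stableSum (φ : Finset α → Perm α → ℝ) (k : ℕ) (f : Perm α → ℝ) :
    ∑ σ, f σ * stableSum φ k σ =
      ∑ A : Finset α, ∑ τ ∈ permsOn A, coef φ k A τ * ∑ θ ∈ permsOn Aᶜ, f (τ * θ) := by
  simp only [stableSum, Finset.mul_sum, Finset.sum_filter]
  rw [Finset.sum_comm]
  refine Finset.sum_congr rfl fun A _ => ?_
  have := sum_inv_restr (Finset.subset_univ A) fun τ θ => coef φ k A τ * f (τ * θ)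
  rw [← Finset.compl_eq_univ_sdiff] at this
  rw [← this, permsOn_univ, Finset.sum_filter]
  refine Finset.sum_congr rfl fun σ _ => ?_
  split_ifs with h
  · conv_lhs => rw [h.eq_mul]
    rw [← h.eq_mul, mul_comm]
  · rw [mul_zero]

theorem sum_split_powerset {M : Type} [AddCommMonoid M] (A₀ : Finset α)
    (F : Finset α → Finset α → M) :
    ∑ A : Finset α, F (A ∩ A₀) (A ∩ A₀ᶜ) = ∑ A ∈ A₀.powerset, ∑ B ∈ A₀ᶜ.powerset, F A B := by
  rw [← Finset.sum_product']
  refine Finset.sum_nbij' (fun A => (A ∩ A₀, A ∩ A₀ᶜ)) (fun p => p.1 ∪ p.2) ?_ ?_ ?_ ?_ ?_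
  · intro A _
    simp
  · simp
  · intro A _
    simp only
    rw [← Finset.inter_union_distrib_left]
    simp
  · rintro ⟨A, B⟩ h
    simp only [Finset.mem_product, Finset.mem_powerset] at h
    have h1 : B ∩ A₀ = ∅ := by
      rw [← Finset.disjoint_iff_inter_eq_empty]
      exact Finset.subset_compl_iff_disjoint_right.1 h.2
    have h2 : A ∩ A₀ᶜ = ∅ := by
      rw [← Finset.disjoint_iff_inter_eq_empty]
      exact Finset.disjoint_of_subset_left h.1 disjoint_compl_right
    simp only [Finset.union_inter_distrib_right, Prod.mk.injEq, h1, h2,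
      Finset.inter_eq_left.2 h.1, Finset.inter_eq_left.2 h.2]
    simp
  · simp

theorem stableSum_mul (φ : Finset α → Perm α → ℝ) (k : ℕ) {A₀ : Finset α} {τ θ : Perm α}
    (hτ : τ ∈ permsOn A₀) (hθ : θ ∈ permsOn A₀ᶜ) :
    stableSum φ k (τ * θ) = ∑ A ∈ A₀.powerset with IsInv τ A, ∑ B ∈ A₀ᶜ.powerset with IsInv θ B,
      coef φ k (A ∪ B) (restr τ A * restr θ B) := by
  simp only [stableSum, Finset.sum_filter]
  have := sum_split_powerset A₀ fun A B => if IsInv τ A then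
    (if IsInv θ B then coef φ k (A ∪ B) (restr τ A * restr θ B) else 0) else 0
  trans
  swap
  · trans
    · exact this
    · refine Finset.sum_congr rfl fun A _ => ?_
      split_ifs <;> simp
  · refine Finset.sum_congr rfl fun A _ => ?_
    rw [← Finset.inter_union_distrib_left, Finset.union_compl, Finset.inter_univ]
    by_cases h : IsInv (τ * θ) A
    · obtain ⟨h1, h2⟩ := (inv_mul_iff hτ hθ A).1 h
      rw [if_pos h, if_pos h1, if_pos h2, restr_mul hτ hθ h]
    · rw [if_neg h]
      split_ifs with h1 h2
      · exact absurd ((inv_mul_iff hτ hθ A).2 ⟨h1, h2⟩) h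
      · rfl
      · rfl

theorem sum_stable_compl {E : Finset α} {ξ : Perm α} (hξ : ξ ∈ permsOn E) (hE : E.Nonempty) :
    ∑ C ∈ E.powerset with IsInv ξ C,
      (-1 : ℝ) ^ (E \ C).card * ((Perm.sign (restr ξ (E \ C)) : ℤ) : ℝ) = 0 := by
  rw [← sum_sign_stable_eq_zero hξ hE]
  refine Finset.sum_nbij' (fun C => E \ C) (fun C => E \ C) ?_ ?_ ?_ ?_ ?_
  · intro C hC
    obtain ⟨_, h2⟩ := Finset.mem_filter.1 hC
    exact Finset.mem_filter.2 ⟨by simp, (inv_of_permsOn hξ).sdiff h2⟩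
  · intro C hC
    obtain ⟨_, h2⟩ := Finset.mem_filter.1 hC
    exact Finset.mem_filter.2 ⟨by simp, (inv_of_permsOn hξ).sdiff h2⟩
  · intro C hC
    obtain ⟨h1, _⟩ := Finset.mem_filter.1 hC
    exact Finset.sdiff_sdiff_eq_self (Finset.mem_powerset.1 h1)
  · intro C hC
    obtain ⟨h1, _⟩ := Finset.mem_filter.1 hC
    exact Finset.sdiff_sdiff_eq_self (Finset.mem_powerset.1 h1)
  · simp

theorem sum_coef_subset {φ : Finset α → Perm α → ℝ} (h : Equivariant φ) {k : ℕ}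
    (hk : k ≤ Fintype.card α) {A M : Finset α} (hAM : Disjoint A M) {τ : Perm α}
    (hτ : τ ∈ permsOn A) {c : ℕ} (hc : A.card + c = k) (hcM : c ≤ M.card) :
    ∑ B ∈ M.powerset, ((M.card - B.card).factorial : ℝ) *
      ∑ ρ ∈ permsOn B, coef φ k (A ∪ B) (τ * ρ) =
      if c = 0 then (M.card.factorial : ℝ) * φ A τ else 0 := by
  classical
  obtain ⟨E, hEM, hE⟩ := Finset.exists_subset_card_eq hcM
  set G : Finset α → ℝ := fun B => ∑ ρ ∈ permsOn B, coef φ k (A ∪ B) (τ * ρ) with hG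
  have hG1 : ∀ B ⊆ M, ∀ B' ⊆ M, B.card = B'.card → G B = G B' := by
    intro B hB B' hB' hcard
    obtain ⟨g, hg, rfl⟩ := exists_perm_map_eq hB hB' hcard
    simp only [hG]
    rw [sum_permsOn_map]
    refine Finset.sum_congr rfl fun ρ hρ => ?_
    have h1 : τ * ρ ∈ permsOn (A ∪ B) :=
      mul_mem_permsOn (permsOn_mono Finset.subset_union_left hτ)
        (permsOn_mono Finset.subset_union_right hρ)
    rw [← coef_map h h1 hk g, Finset.map_union, map_eq_self_of_disjoint hAM.symm hg]
    congr 1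
    rw [show g * (τ * ρ) * g⁻¹ = (g * τ * g⁻¹) * (g * ρ * g⁻¹) by group,
      commute_conj_eq hAM hτ hg]
  have hG0 : ∀ B ⊆ M, c < B.card → G B = 0 := by
    intro B hB hcB
    refine Finset.sum_eq_zero fun ρ _ => coef_eq_zero _ ?_ _
    rw [Finset.card_union_of_disjoint (Finset.disjoint_of_subset_right hB hAM)]
    omega
  let γ : ℕ → ℝ := fun a => if h : ∃ B ⊆ M, B.card = a then G h.choose else 0
  have hγ : ∀ B ⊆ M, G B = γ B.card := by
    intro B hB
    have h0 : ∃ B' ⊆ M, B'.card = B.card := ⟨B, hB, rfl⟩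
    simp only [γ]
    rw [dif_pos h0]
    exact hG1 B hB _ h0.choose_spec.1 h0.choose_spec.2.symm
  have hγ0 : ∀ a, c < a → a ≤ M.card → γ a = 0 := by
    intro a ha haM
    obtain ⟨B, hB, rfl⟩ := Finset.exists_subset_card_eq haM
    rw [← hγ B hB, hG0 B hB ha]
  have key : ∀ D ⊆ M, ∑ B ∈ D.powerset, ((D.card - B.card).factorial : ℝ) * G B =
      D.card.factorial * ∑ a ∈ Finset.range (D.card + 1), γ a / a.factorial := by
    intro D hD
    rw [Finset.sum_congr rfl (g := fun B => ((D.card - B.card).factorial : ℝ) * γ B.card)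
      fun B hB => by rw [hγ B ((Finset.mem_powerset.1 hB).trans hD)]]
    rw [Finset.sum_powerset_apply_card (fun a => ((D.card - a).factorial : ℝ) * γ a),
      Finset.mul_sum]
    refine Finset.sum_congr rfl fun a ha => ?_
    have ha' : a ≤ D.card := Nat.lt_succ_iff.1 (Finset.mem_range.1 ha)
    have := Nat.choose_mul_factorial_mul_factorial ha'
    have h2 : ((D.card.choose a : ℕ) : ℝ) * a.factorial * (D.card - a).factorial =
      D.card.factorial := by exact_mod_cast this
    rw [← h2, nsmul_eq_mul]
    field_simp
  have h1 := key M subset_rfl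
  have h2 := key E hEM
  have h3 : ∑ a ∈ Finset.range (M.card + 1), γ a / a.factorial =
      ∑ a ∈ Finset.range (E.card + 1), γ a / a.factorial := by
    symm
    refine Finset.sum_subset (fun a ha => ?_) fun a ha ha' => ?_
    · simp only [Finset.mem_range] at *; omega
    · simp only [Finset.mem_range] at *
      rw [hγ0 a (by omega) (by omega), zero_div]
  have hAE : Disjoint A E := Finset.disjoint_of_subset_right hEM hAM
  have h4 : ∑ B ∈ E.powerset, ((E.card - B.card).factorial : ℝ) * G B =
      ∑ ξ ∈ permsOn E, φ (A ∪ E) (τ * ξ) * ∑ B ∈ E.powerset with IsInv ξ B,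
        (-1 : ℝ) ^ (E \ B).card * ((Perm.sign (restr ξ (E \ B)) : ℤ) : ℝ) := by
    simp only [Finset.mul_sum, Finset.sum_filter]
    rw [Finset.sum_comm]
    refine Finset.sum_congr rfl fun B hB => ?_
    have hBE := Finset.mem_powerset.1 hB
    have h5 := sum_inv_restr hBE fun ρ ρ' => φ (A ∪ E) (τ * (ρ * ρ')) *
      ((-1 : ℝ) ^ (E \ B).card * ((Perm.sign ρ' : ℤ) : ℝ))
    have h6 : ∀ ξ ∈ permsOn E, IsInv ξ B → restr ξ B * restr ξ (E \ B) = ξ := by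
      intro ξ hξ hi
      rw [← hi.restr_union ((inv_of_permsOn hξ).sdiff hi) Finset.disjoint_sdiff,
        Finset.union_sdiff_of_subset hBE, restr_eq_self hξ]
    trans ∑ ξ ∈ permsOn E with IsInv ξ B, φ (A ∪ E) (τ * (restr ξ B * restr ξ (E \ B))) *
      ((-1 : ℝ) ^ (E \ B).card * ((Perm.sign (restr ξ (E \ B)) : ℤ) : ℝ))
    · rw [h5, Finset.mul_sum]
      refine Finset.sum_congr rfl fun ρ hρ => ?_
      have hAB : Disjoint A B := Finset.disjoint_of_subset_right hBE hAE
      rw [coef_eq h (C := E \ B) (mul_mem_permsOn (permsOn_mono Finset.subset_union_left hτ)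
        (permsOn_mono Finset.subset_union_right hρ)), signAvg, Finset.union_assoc,
        Finset.union_sdiff_of_subset hBE, Finset.card_sdiff_of_subset hBE,
        ← mul_assoc, Finset.mul_sum]
      · refine Finset.sum_congr rfl fun ρ' _ => ?_
        have : ((E.card - B.card).factorial : ℝ) ≠ 0 := by positivity
        rw [mul_assoc τ]
        field_simp
      · rw [Finset.disjoint_union_left]
        exact ⟨Finset.disjoint_of_subset_right Finset.sdiff_subset hAE, Finset.disjoint_sdiff⟩
      · rw [Finset.card_union_of_disjoint hAB, Finset.card_sdiff_of_subset hBE]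
        have := Finset.card_le_card hBE
        omega
    · rw [Finset.sum_filter]
      refine Finset.sum_congr rfl fun ξ hξ => ?_
      split_ifs with hi
      · rw [h6 ξ hξ hi]
      · simp
  rw [h1, h3]
  have h5 : ∑ a ∈ Finset.range (E.card + 1), γ a / a.factorial =
      (∑ B ∈ E.powerset, ((E.card - B.card).factorial : ℝ) * G B) / E.card.factorial := by
    rw [h2]; field_simp
  rw [h5, h4]
  split_ifs with hc0
  · have : E = ∅ := by rw [← Finset.card_eq_zero, hE, hc0]
    subst this
    rw [permsOn_empty]
    have h7 : IsInv (1 : Perm α) ∅ := fun x hx => by simp at hx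
    have h8 : restr (1 : Perm α) ∅ = 1 := restr_eq_self (one_mem_permsOn _)
    simp [Finset.filter_singleton, h7, h8]
  · have : E.Nonempty := by rw [← Finset.card_pos]; omega
    rw [Finset.sum_eq_zero (s := permsOn E)]
    · simp
    · intro ξ hξ
      rw [sum_stable_compl hξ this, mul_zero]

theorem partial_sum_stableSum {φ : Finset α → Perm α → ℝ} (h : Equivariant φ) {k : ℕ}
    (hk : 2 * k ≤ Fintype.card α) {A₀ : Finset α} (hA₀ : A₀.card ≤ k) {τ : Perm α}
    (hτ : τ ∈ permsOn A₀) :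
    ∑ θ ∈ permsOn A₀ᶜ, stableSum φ k (τ * θ) =
      if A₀.card = k then ((Fintype.card α - k).factorial : ℝ) * φ A₀ τ else 0 := by
  have hM : A₀ᶜ.card = Fintype.card α - A₀.card := Finset.card_compl _
  rw [Finset.sum_congr rfl fun θ hθ => stableSum_mul φ k hτ hθ, Finset.sum_comm]
  have key : ∀ A ∈ A₀.powerset.filter (IsInv τ), ∑ θ ∈ permsOn A₀ᶜ, ∑ B ∈ A₀ᶜ.powerset with IsInv θ B,
      coef φ k (A ∪ B) (restr τ A * restr θ B) =
      if k - A.card = 0 then (A₀ᶜ.card.factorial : ℝ) * φ A (restr τ A) else 0 := by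
    intro A hA
    have hA' := Finset.mem_powerset.1 (Finset.mem_filter.1 hA).1
    have hcard := Finset.card_le_card hA'
    rw [← sum_coef_subset h (by omega) (Finset.disjoint_of_subset_left hA' disjoint_compl_right)
      (restr_mem τ A) (show A.card + (k - A.card) = k by omega) (by rw [hM]; omega)]
    simp only [Finset.sum_filter]
    rw [Finset.sum_comm]
    refine Finset.sum_congr rfl fun B hB => ?_
    rw [← sum_inv_restr_card (Finset.mem_powerset.1 hB), Finset.sum_filter]
  rw [Finset.sum_congr rfl key]
  split_ifs with hc
  · rw [Finset.sum_eq_single A₀]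
    · rw [if_pos (by omega), restr_eq_self hτ, hM, hc]
    · intro A hA hne
      have hA' := Finset.mem_powerset.1 (Finset.mem_filter.1 hA).1
      rw [if_neg]
      have := Finset.card_lt_card (lt_of_le_of_ne hA' hne)
      omega
    · intro hn
      exact absurd (Finset.mem_filter.2 ⟨by simp, inv_of_permsOn hτ⟩) hn
  · refine Finset.sum_eq_zero fun A hA => ?_
    have hA' := Finset.card_le_card (Finset.mem_powerset.1 (Finset.mem_filter.1 hA).1)
    rw [if_neg (by omega)]

end Stable

section Level

open Equiv

set_option linter.unusedSectionVars false

variable {α : Type} [Fintype α] [DecidableEq α]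

/-- The sums of `χ` over the permutations of more than `card α - k` points vanish. -/
def LevGe (k : ℕ) (χ : Perm α → ℝ) : Prop :=
  ∀ D : Finset α, Fintype.card α < D.card + k → ∑ ρ ∈ permsOn D, χ ρ = 0

/-- The character of `Perm E` on the invariants of the permutations of the complement of `E`. -/
noncomputable def core (χ : Perm α → ℝ) (E : Finset α) (τ : Perm α) : ℝ :=
  (∑ η ∈ permsOn Eᶜ, χ (τ * η)) / (Eᶜ.card.factorial : ℝ)

theorem core_equivariant {χ : Perm α → ℝ} (h : IsChar χ) : Equivariant (core χ) := by
  intro g E τ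
  have h1 : (E.map g.toEmbedding)ᶜ = Eᶜ.map g.toEmbedding := by
    ext x
    simp only [Finset.mem_compl, Finset.mem_map_equiv]
  rw [core, core, h1, sum_permsOn_map, Finset.card_map]
  congr 1
  refine Finset.sum_congr rfl fun η _ => ?_
  rw [← h.conj_eq (τ * η) g]
  congr 1
  group

theorem core_isChar {χ : Perm α → ℝ} (h : IsChar χ) (E : Finset α) :
    IsChar fun ρ : Perm {x // x ∈ E} => core χ E (Perm.ofSubtype ρ) := by
  obtain ⟨ψ, h1, h2⟩ := h.partial_sum (disjoint_compl_right (a := E))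
  convert h1 using 1
  ext τ
  rw [core, h2]
  field_simp

theorem sum_core_sq_map {χ : Perm α → ℝ} (h : IsChar χ) {E E' : Finset α} (hE : E.card = E'.card) :
    ∑ τ ∈ permsOn E, core χ E τ ^ 2 = ∑ τ ∈ permsOn E', core χ E' τ ^ 2 := by
  obtain ⟨g, -, rfl⟩ := exists_perm_map_eq (Finset.subset_univ E) (Finset.subset_univ E') hE
  rw [sum_permsOn_map]
  exact Finset.sum_congr rfl fun τ _ => by rw [core_equivariant h]

theorem core_map {χ : Perm α → ℝ} (h : IsChar χ) {E E' : Finset α} (hE : E.card = E'.card) :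
    core χ E 1 = core χ E' 1 := by
  obtain ⟨g, -, rfl⟩ := exists_perm_map_eq (Finset.subset_univ E) (Finset.subset_univ E') hE
  have := core_equivariant h g E 1
  simpa using this.symm

theorem levGe_zero (χ : Perm α → ℝ) : LevGe 0 χ := fun D hD => by
  have := Finset.card_le_univ D
  omega

theorem LevGe.mono {χ : Perm α → ℝ} {j k : ℕ} (h : LevGe k χ) (hj : j ≤ k) : LevGe j χ :=
  fun D hD => h D (by omega)

theorem exists_core_ne_zero {χ : Perm α → ℝ} {k : ℕ} (h : LevGe k χ) (h' : ¬ LevGe (k + 1) χ) :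
    ∃ E : Finset α, E.card = k ∧ core χ E 1 ≠ 0 := by
  unfold LevGe at h'
  push Not at h'
  obtain ⟨D, hD, hne⟩ := h'
  have h1 : ¬ Fintype.card α < D.card + k := fun h1 => hne (h D h1)
  have := Finset.card_le_univ D
  refine ⟨Dᶜ, by rw [Finset.card_compl]; omega, ?_⟩
  rw [core, compl_compl]
  simp only [one_mul]
  positivity

theorem sum_coef_core_mul {χ f : Perm α → ℝ} (hχ : IsChar χ) {k d : ℕ} (hk : k ≤ Fintype.card α)
    (hd : ∀ E : Finset α, E.card = k → ∑ τ ∈ permsOn E, core χ E τ ^ 2 = k.factorial * d)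
    (hf : ∀ A : Finset α, A.card ≤ k → ∀ τ ∈ permsOn A, ∑ θ ∈ permsOn Aᶜ, f (τ * θ) =
      if A.card = k then ((Fintype.card α - k).factorial : ℝ) * core χ A τ else 0) :
    ∑ σ, f σ * stableSum (core χ) k σ = (Fintype.card α).factorial * d := by
  rw [sum_mul_stableSum]
  have h1 : ∀ A : Finset α, ∑ τ ∈ permsOn A, coef (core χ) k A τ * ∑ θ ∈ permsOn Aᶜ, f (τ * θ) =
      if A.card = k then ((Fintype.card α - k).factorial : ℝ) * (k.factorial * d) else 0 := by
    intro A
    rcases lt_trichotomy A.card k with h | h | h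
    · rw [if_neg h.ne]
      refine Finset.sum_eq_zero fun τ hτ => ?_
      rw [hf A h.le τ hτ, if_neg h.ne, mul_zero]
    · rw [if_pos h, ← hd A h, Finset.mul_sum]
      refine Finset.sum_congr rfl fun τ hτ => ?_
      rw [hf A h.le τ hτ, if_pos h, ← h, coef_of_card (core_equivariant hχ) hτ]
      ring
    · rw [if_neg h.ne']
      refine Finset.sum_eq_zero fun τ hτ => ?_
      rw [coef_eq_zero _ h, zero_mul]
  rw [Finset.sum_congr rfl fun A _ => h1 A, ← Finset.sum_filter, Finset.sum_const]
  have h2 : (Finset.univ.filter fun A : Finset α => A.card = k).card = (Fintype.card α).choose k := by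
    rw [← Finset.card_univ, ← Finset.card_powersetCard]
    congr 1
    ext A
    simp
  have h3 : (((Fintype.card α).choose k : ℕ) : ℝ) * k.factorial * (Fintype.card α - k).factorial =
      (Fintype.card α).factorial := by exact_mod_cast Nat.choose_mul_factorial_mul_factorial hk
  rw [h2, ← h3, nsmul_eq_mul]
  ring

/-- An irreducible character of level exactly `k ≤ n / 2` is an explicit sum over the stable sets
of size at most `k`, and its core is irreducible. -/
theorem IsIrr.eq_stableSum {χ : Perm α → ℝ} (hχ : IsIrr χ) {k : ℕ} (hk : 2 * k ≤ Fintype.card α)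
    (h : LevGe k χ) (h' : ¬ LevGe (k + 1) χ) :
    (∀ σ, χ σ = stableSum (core χ) k σ) ∧
      ∀ E : Finset α, E.card = k → ∑ τ ∈ permsOn E, core χ E τ ^ 2 = k.factorial := by
  obtain ⟨E₀, hE₀, hne⟩ := exists_core_ne_zero h h'
  have hc := hχ.isChar
  obtain ⟨d, hd⟩ := ((core_isChar hc E₀).mul (core_isChar hc E₀)).sum_eq
  have hd1 : ∑ τ ∈ permsOn E₀, core χ E₀ τ ^ 2 = k.factorial * d := by
    rw [sum_permsOn, ← hE₀]
    rw [Fintype.card_perm, Fintype.card_coe] at hd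
    rw [← hd]
    exact Finset.sum_congr rfl fun _ _ => sq _
  have hd2 : ∀ E : Finset α, E.card = k → ∑ τ ∈ permsOn E, core χ E τ ^ 2 = k.factorial * d :=
    fun E hE => by rw [sum_core_sq_map hc (hE.trans hE₀.symm), hd1]
  have hdpos : 1 ≤ d := by
    rcases Nat.eq_zero_or_pos d with h0 | h0
    · rw [h0, Nat.cast_zero, mul_zero] at hd1
      have := (Finset.sum_eq_zero_iff_of_nonneg fun τ _ => sq_nonneg (core χ E₀ τ)).1 hd1 1
        (one_mem_permsOn _)
      exact absurd (pow_eq_zero_iff two_ne_zero |>.1 this) hne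
    · exact h0
  have h1 : ∑ σ, χ σ * stableSum (core χ) k σ = (Fintype.card α).factorial * d := by
    refine sum_coef_core_mul hc (by omega) hd2 fun A hA τ hτ => ?_
    split_ifs with hAk
    · rw [core, Finset.card_compl, hAk]
      field_simp
    · refine hc.partial_sum_eq_zero disjoint_compl_right (h _ ?_) hτ
      rw [Finset.card_compl]
      omega
  have h2 : ∑ σ, stableSum (core χ) k σ * stableSum (core χ) k σ =
      (Fintype.card α).factorial * d :=
    sum_coef_core_mul hc (by omega) hd2 fun A hA τ hτ =>
      partial_sum_stableSum (core_equivariant hc) hk hA hτ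
  have h3 := hχ.norm_eq
  rw [Fintype.card_perm] at h3
  have h4 : ∑ σ, (χ σ - stableSum (core χ) k σ) ^ 2 = (Fintype.card α).factorial * (1 - d) := by
    have : ∀ σ, (χ σ - stableSum (core χ) k σ) ^ 2 = χ σ * χ σ - 2 * (χ σ * stableSum (core χ) k σ) +
        stableSum (core χ) k σ * stableSum (core χ) k σ := fun σ => by ring
    rw [Finset.sum_congr rfl fun σ _ => this σ, Finset.sum_add_distrib, Finset.sum_sub_distrib,
      ← Finset.mul_sum, h1, h2]
    simp only [← sq] at h3 ⊢
    rw [h3]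
    ring
  have h5 : (0 : ℝ) ≤ ∑ σ, (χ σ - stableSum (core χ) k σ) ^ 2 :=
    Finset.sum_nonneg fun _ _ => sq_nonneg _
  have hfac : (0 : ℝ) < (Fintype.card α).factorial := by positivity
  have h6 : d = 1 := by
    rw [h4] at h5
    have : (d : ℝ) ≤ 1 := by
      by_contra hcon
      push Not at hcon
      nlinarith
    have : d ≤ 1 := by exact_mod_cast this
    omega
  subst h6
  refine ⟨fun σ => ?_, fun E hE => by rw [hd2 E hE]; simp⟩
  rw [Nat.cast_one, sub_self, mul_zero] at h4
  have := (Finset.sum_eq_zero_iff_of_nonneg fun σ _ => sq_nonneg _).1 h4 σ (Finset.mem_univ _)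
  exact sub_eq_zero.1 (pow_eq_zero_iff two_ne_zero |>.1 this)

end Level

section Bounds

open Equiv

set_option linter.unusedSectionVars false

variable {α : Type} [Fintype α] [DecidableEq α]

/-- The number of stable sets of size at most `k`. -/
def stableCount (σ : Perm α) (k : ℕ) : ℕ :=
  (Finset.univ.filter fun A : Finset α => IsInv σ A ∧ A.card ≤ k).card

theorem abs_sign_eq_one (ρ : Perm α) : |((Perm.sign ρ : ℤ) : ℝ)| = 1 := by
  rcases Int.units_eq_one_or (Perm.sign ρ) with h | h <;> simp [h]

theorem abs_coef_le {φ : Finset α → Perm α → ℝ} (h : Equivariant φ) {k : ℕ}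
    (hk : k ≤ Fintype.card α) {u : ℝ}
    (hu : ∀ E : Finset α, E.card = k → ∀ τ ∈ permsOn E, |φ E τ| ≤ u)
    {A : Finset α} (hA : A.card ≤ k) {τ : Perm α} (hτ : τ ∈ permsOn A) :
    |coef φ k A τ| ≤ u := by
  obtain ⟨C, h1, h2⟩ := exists_disjoint_card hk hA
  rw [coef_eq h hτ h1 h2, signAvg, abs_mul, abs_div, abs_pow, abs_neg, abs_one, one_pow,
    Nat.abs_cast]
  have h3 : |∑ ρ ∈ permsOn C, ((Perm.sign ρ : ℤ) : ℝ) * φ (A ∪ C) (τ * ρ)| ≤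
      C.card.factorial * u := by
    refine (Finset.abs_sum_le_sum_abs _ _).trans ?_
    rw [← card_permsOn, ← nsmul_eq_mul]
    refine Finset.sum_le_card_nsmul _ _ _ fun ρ hρ => ?_
    rw [abs_mul, abs_sign_eq_one, one_mul]
    refine hu _ (by rw [Finset.card_union_of_disjoint h1, h2]) _ ?_
    exact mul_mem_permsOn (permsOn_mono Finset.subset_union_left hτ)
      (permsOn_mono Finset.subset_union_right hρ)
  calc _ ≤ 1 / (C.card.factorial : ℝ) * (C.card.factorial * u) := by gcongr
    _ = u := by field_simp

theorem abs_core_le {χ : Perm α → ℝ} (h : IsChar χ) {E : Finset α} {τ : Perm α}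
    (hτ : τ ∈ permsOn E) : |core χ E τ| ≤ core χ E 1 := by
  obtain ⟨ρ, rfl⟩ := exists_ofSubtype_eq hτ
  have := (core_isChar h E).abs_le ρ
  simpa using this

theorem exists_coreDim {χ : Perm α → ℝ} (hχ : IsChar χ) {k : ℕ}
    (h : LevGe k χ) (h' : ¬ LevGe (k + 1) χ) :
    ∃ u : ℕ, 1 ≤ u ∧ ∀ E : Finset α, E.card = k → core χ E 1 = u := by
  obtain ⟨E₀, hE₀, hne⟩ := exists_core_ne_zero h h'
  obtain ⟨u, hu⟩ := (core_isChar hχ E₀).one_eq_nat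
  rw [map_one] at hu
  refine ⟨u, ?_, fun E hE => by rw [core_map hχ (hE.trans hE₀.symm), hu]⟩
  rw [hu] at hne
  exact Nat.one_le_iff_ne_zero.2 (by exact_mod_cast hne)

theorem abs_stableSum_le {φ : Finset α → Perm α → ℝ} (h : Equivariant φ) {k : ℕ}
    (hk : k ≤ Fintype.card α) {u : ℝ}
    (hu : ∀ E : Finset α, E.card = k → ∀ τ ∈ permsOn E, |φ E τ| ≤ u) (σ : Perm α) :
    |stableSum φ k σ| ≤ u * stableCount σ k := by
  rw [stableSum, stableCount, ← Finset.filter_filter, mul_comm, ← nsmul_eq_mul, Finset.card_filter,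
    Finset.sum_smul]
  refine (Finset.abs_sum_le_sum_abs _ _).trans (Finset.sum_le_sum fun A hA => ?_)
  split_ifs with hc
  · rw [one_nsmul]
    exact abs_coef_le h hk hu hc (restr_mem _ _)
  · rw [coef_eq_zero _ (by omega)]
    simp

theorem choose_succ_ge {m j : ℕ} (h : 3 * (j + 1) ≤ m + 1) :
    2 * m.choose j ≤ m.choose (j + 1) := by
  have h1 := Nat.choose_succ_right_eq m j
  have h2 : 2 * (j + 1) ≤ m - j := by omega
  have h3 : m.choose j * (2 * (j + 1)) ≤ m.choose j * (m - j) := Nat.mul_le_mul_left _ h2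
  rw [← h1] at h3
  have h4 : (2 * m.choose j) * (j + 1) ≤ m.choose (j + 1) * (j + 1) := by linarith
  exact Nat.le_of_mul_le_mul_right h4 (Nat.succ_pos j)

theorem sum_choose_le {m j : ℕ} (h : 3 * j ≤ m + 1) :
    ∑ i ∈ Finset.range (j + 1), m.choose i ≤ 2 * m.choose j := by
  induction j with
  | zero => simp
  | succ j ih =>
    rw [Finset.sum_range_succ]
    have := ih (by omega)
    have := choose_succ_ge h
    omega

theorem card_filter_card_eq (k : ℕ) :
    (Finset.univ.filter fun A : Finset α => A.card = k).card = (Fintype.card α).choose k := by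
  rw [← Finset.card_univ, ← Finset.card_powersetCard]
  congr 1
  ext A
  simp

theorem card_filter_card_lt (k : ℕ) :
    (Finset.univ.filter fun A : Finset α => A.card < k).card =
      ∑ i ∈ Finset.range k, (Fintype.card α).choose i := by
  have : (Finset.univ.filter fun A : Finset α => A.card < k) =
      (Finset.range k).biUnion fun i => Finset.univ.filter fun A : Finset α => A.card = i := by
    ext A; simp
  rw [this, Finset.card_biUnion]
  · simp only [card_filter_card_eq]
  · intro i _ j _ hij
    rw [Function.onFun, Finset.disjoint_left]
    intro A hA hA'
    simp only [Finset.mem_filter] at hA hA'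
    exact hij (hA.2.symm.trans hA'.2)

theorem stableSum_one_ge {φ : Finset α → Perm α → ℝ} (h : Equivariant φ) {k : ℕ}
    (hk : k ≤ Fintype.card α) {u : ℝ}
    (hu : ∀ E : Finset α, E.card = k → ∀ τ ∈ permsOn E, |φ E τ| ≤ u)
    (hu1 : ∀ E : Finset α, E.card = k → φ E 1 = u) :
    u * (Fintype.card α).choose k - u * ∑ i ∈ Finset.range k, (Fintype.card α).choose i ≤
      stableSum φ k 1 := by
  have h1 : stableSum φ k 1 = ∑ A : Finset α, coef φ k A 1 := by
    rw [stableSum, Finset.filter_true_of_mem]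
    · exact Finset.sum_congr rfl fun A _ => by rw [restr_eq_self (one_mem_permsOn A)]
    · exact fun A _ => inv_of_permsOn (one_mem_permsOn A)
  have h2 : ∀ A : Finset α, (if A.card = k then u else 0) - (if A.card < k then u else 0) ≤
      coef φ k A 1 := by
    intro A
    rcases lt_trichotomy A.card k with hc | hc | hc
    · rw [if_neg hc.ne, if_pos hc]
      have := neg_le_of_abs_le (abs_coef_le h hk hu hc.le (one_mem_permsOn A))
      linarith
    · subst hc
      rw [if_pos rfl, if_neg (lt_irrefl _), coef_of_card h (one_mem_permsOn A), hu1 A rfl, sub_zero]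
    · rw [if_neg hc.ne', if_neg hc.not_gt, coef_eq_zero _ hc, sub_zero]
  rw [h1]
  refine le_trans (le_of_eq ?_) (Finset.sum_le_sum fun A _ => h2 A)
  rw [Finset.sum_sub_distrib, ← Finset.sum_filter, ← Finset.sum_filter, Finset.sum_const,
    Finset.sum_const, card_filter_card_eq, card_filter_card_lt, nsmul_eq_mul, nsmul_eq_mul]
  push_cast
  ring

theorem choose_ge_of_le {n k : ℕ} (hk : 8 * k ≤ n) :
    n.choose k ≤ 2 * (n.choose k - ∑ i ∈ Finset.range k, n.choose i : ℤ) := by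
  rcases k with _ | k
  · simp
  · have h1 : ∑ i ∈ Finset.range (k + 1), n.choose i ≤ 2 * n.choose k := sum_choose_le (by omega)
    have h2 := Nat.choose_succ_right_eq n k
    have h3 : 7 * (k + 1) ≤ n - k := by omega
    have h4 : n.choose k * (7 * (k + 1)) ≤ n.choose k * (n - k) := Nat.mul_le_mul_left _ h3
    rw [← h2] at h4
    have h5 : (7 * n.choose k) * (k + 1) ≤ n.choose (k + 1) * (k + 1) := by linarith
    have h6 := Nat.le_of_mul_le_mul_right h5 (Nat.succ_pos k)
    have h1' : (∑ i ∈ Finset.range (k + 1), n.choose i : ℤ) ≤ 2 * n.choose k := by exact_mod_cast h1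
    have h6' : 7 * (n.choose k : ℤ) ≤ n.choose (k + 1) := by exact_mod_cast h6
    push_cast
    linarith

/-- Size and degree bounds for an irreducible character of level exactly `k ≤ n / 8`. -/
theorem IsIrr.exists_bound {χ : Perm α → ℝ} (hχ : IsIrr χ) {k : ℕ} (hk : 8 * k ≤ Fintype.card α)
    (h : LevGe k χ) (h' : ¬ LevGe (k + 1) χ) :
    ∃ u : ℝ, 1 ≤ u ∧ (∀ σ, |χ σ| ≤ u * stableCount σ k) ∧
      u * (Fintype.card α).choose k ≤ 2 * χ 1 := by
  obtain ⟨u, hu, hE⟩ := exists_coreDim hχ.isChar h h'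
  have hT := (hχ.eq_stableSum (by omega) h h').1
  have hu' : ∀ E : Finset α, E.card = k → ∀ τ ∈ permsOn E, |core χ E τ| ≤ u := by
    intro E hc τ hτ
    rw [← hE E hc]
    exact abs_core_le hχ.isChar hτ
  refine ⟨u, by exact_mod_cast hu, fun σ => ?_, ?_⟩
  · rw [hT σ]
    exact abs_stableSum_le (core_equivariant hχ.isChar) (by omega) hu' σ
  · have h1 := stableSum_one_ge (core_equivariant hχ.isChar) (by omega) hu' hE
    rw [← hT] at h1
    have h2 : (((Fintype.card α).choose k : ℤ) : ℝ) ≤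
      ((2 * ((Fintype.card α).choose k - ∑ i ∈ Finset.range k, (Fintype.card α).choose i : ℤ) : ℤ) : ℝ) := by
      exact_mod_cast choose_ge_of_le hk
    push_cast at h2 h1
    have h3 : (u : ℝ) * (Fintype.card α).choose k ≤ u * (2 * ((Fintype.card α).choose k -
      ∑ i ∈ Finset.range k, ((Fintype.card α).choose i : ℝ))) :=
      mul_le_mul_of_nonneg_left h2 (by positivity)
    linarith

theorem exists_exact_level {χ : Perm α → ℝ} (h1 : χ 1 ≠ 0) {j : ℕ} (h : LevGe j χ) :
    ∃ k, j ≤ k ∧ k ≤ Fintype.card α ∧ LevGe k χ ∧ ¬ LevGe (k + 1) χ := by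
  classical
  have hn : ¬ LevGe (Fintype.card α + 1) χ := by
    intro h'
    have := h' ∅ (by simp)
    rw [permsOn_empty, Finset.sum_singleton] at this
    exact h1 this
  have hex : ∃ k, ¬ LevGe (k + 1) χ := ⟨_, hn⟩
  refine ⟨Nat.find hex, ?_, Nat.find_le hn, ?_, Nat.find_spec hex⟩
  · by_contra hlt
    push Not at hlt
    exact Nat.find_spec hex (h.mono hlt)
  · rcases hk : Nat.find hex with _ | k
    · exact levGe_zero χ
    · have := Nat.find_min hex (m := k) (by omega)
      exact not_not.1 this

end Bounds

section Restriction

open Equiv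

set_option linter.unusedSectionVars false

variable {α : Type} [Fintype α] [DecidableEq α]

/-- The sign of a permutation as a real number. -/
def sgn (σ : Perm α) : ℝ := ((Perm.sign σ : ℤ) : ℝ)

theorem sgn_mul (σ τ : Perm α) : sgn (σ * τ) = sgn σ * sgn τ := by simp [sgn]

theorem sgn_one : sgn (1 : Perm α) = 1 := by simp [sgn]

theorem sgn_mul_self (σ : Perm α) : sgn σ * sgn σ = 1 := by
  unfold sgn
  rcases Int.units_eq_one_or (Perm.sign σ) with h | h <;> simp [h]

theorem sgn_eq_one_or (σ : Perm α) : sgn σ = 1 ∨ sgn σ = -1 := by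
  unfold sgn
  rcases Int.units_eq_one_or (Perm.sign σ) with h | h <;> simp [h]

theorem abs_sgn (σ : Perm α) : |sgn σ| = 1 := abs_sign_eq_one σ

/-- The twist of a class function by the sign character. -/
def tw (χ : Perm α → ℝ) : Perm α → ℝ := fun σ => sgn σ * χ σ

theorem tw_tw (χ : Perm α → ℝ) : tw (tw χ) = χ := by
  funext σ
  simp only [tw, ← mul_assoc, sgn_mul_self, one_mul]

theorem tw_one (χ : Perm α → ℝ) : tw χ 1 = χ 1 := by simp [tw, sgn_one]

theorem abs_tw (χ : Perm α → ℝ) (σ : Perm α) : |tw χ σ| = |χ σ| := by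
  rw [tw, abs_mul, abs_sgn, one_mul]

theorem IsChar.tw {χ : Perm α → ℝ} (h : IsChar χ) : IsChar (tw χ) :=
  (isChar_unitHom Perm.sign).mul h

theorem IsIrr.tw {χ : Perm α → ℝ} (h : IsIrr χ) : IsIrr (tw χ) := h.unitHom_mul Perm.sign

/-- The restriction of a class function to the symmetric group of a subset. -/
def res (B : Finset α) (χ : Perm α → ℝ) : Perm {x // x ∈ B} → ℝ := fun ρ => χ (Perm.ofSubtype ρ)

theorem IsChar.res {χ : Perm α → ℝ} (h : IsChar χ) (B : Finset α) : IsChar (res B χ) := h.comp _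

theorem res_one (B : Finset α) (χ : Perm α → ℝ) : res B χ 1 = χ 1 := by
  rw [res, map_one]

theorem res_tw (B : Finset α) (χ : Perm α → ℝ) : res B (tw χ) = tw (res B χ) := by
  funext ρ
  simp [res, tw, sgn, Perm.sign_ofSubtype]

theorem sum_permsOn_res (B : Finset α) (χ : Perm α → ℝ) (D : Finset {x // x ∈ B}) :
    ∑ ρ ∈ permsOn D, res B χ ρ = ∑ ρ ∈ permsOn (D.map (Function.Embedding.subtype _)), χ ρ := by
  refine Finset.sum_bij (fun ρ _ => Perm.ofSubtype ρ) ?_ ?_ ?_ ?_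
  · intro ρ hρ
    rw [mem_permsOn] at *
    intro x hx
    by_cases hB : x ∈ B
    · rw [Perm.ofSubtype_apply_of_mem ρ hB, hρ ⟨x, hB⟩]
      intro h
      exact hx (Finset.mem_map.2 ⟨_, h, rfl⟩)
    · exact Perm.ofSubtype_apply_of_not_mem ρ hB
  · exact fun _ _ _ _ h => Perm.ofSubtype_injective h
  · intro σ hσ
    have hs : D.map (Function.Embedding.subtype _) ⊆ B := by
      intro x hx
      obtain ⟨y, _, rfl⟩ := Finset.mem_map.1 hx
      exact y.2
    obtain ⟨ρ, rfl⟩ := exists_ofSubtype_eq (permsOn_mono hs hσ)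
    refine ⟨ρ, ?_, rfl⟩
    rw [mem_permsOn] at *
    intro x hx
    have := hσ x.1 (by simpa using hx)
    rw [Perm.ofSubtype_apply_coe] at this
    exact Subtype.ext this
  · exact fun _ _ => rfl

theorem LevGe.res {χ : Perm α → ℝ} {B : Finset α} {k : ℕ} (h : LevGe (k + Bᶜ.card) χ) :
    LevGe k (res B χ) := by
  intro D hD
  rw [sum_permsOn_res]
  apply h
  rw [Finset.card_map]
  have := Finset.card_add_card_compl B
  rw [Fintype.card_coe] at hD
  omega

theorem IsChar.sum_permsOn_nonneg {χ : Perm α → ℝ} (h : IsChar χ) (D : Finset α) :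
    0 ≤ ∑ ρ ∈ permsOn D, χ ρ := by
  obtain ⟨d, hd⟩ := h.sum_permsOn_eq D
  rw [hd]
  positivity

theorem sum_permsOn_multiset_sum (s : Multiset (Perm α → ℝ)) (D : Finset α) :
    ∑ ρ ∈ permsOn D, s.sum ρ = (s.map fun ψ => ∑ ρ ∈ permsOn D, ψ ρ).sum := by
  induction s using Multiset.induction with
  | empty => simp
  | cons a s ih => simp [Finset.sum_add_distrib, ih]

theorem LevGe.of_mem {s : Multiset (Perm α → ℝ)} (hs : ∀ ψ ∈ s, IsChar ψ) {k : ℕ}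
    (h : LevGe k s.sum) {ψ : Perm α → ℝ} (hψ : ψ ∈ s) : LevGe k ψ := by
  intro D hD
  have h1 := h D hD
  rw [sum_permsOn_multiset_sum] at h1
  refine le_antisymm ?_ ((hs ψ hψ).sum_permsOn_nonneg D)
  rw [← h1]
  refine Multiset.single_le_sum ?_ _ (Multiset.mem_map_of_mem _ hψ)
  intro x hx
  obtain ⟨φ, hφ, rfl⟩ := Multiset.mem_map.1 hx
  exact (hs φ hφ).sum_permsOn_nonneg D

theorem tw_multiset_sum (s : Multiset (Perm α → ℝ)) : tw s.sum = (s.map tw).sum := by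
  funext σ
  simp only [tw, multiset_sum_apply, Multiset.map_map, Function.comp_def, Multiset.sum_map_mul_left]

/-- `χ` and its sign twist both have level at least `k`. -/
def LL (k : ℕ) (χ : Perm α → ℝ) : Prop := LevGe k χ ∧ LevGe k (tw χ)

theorem LL.mono {χ : Perm α → ℝ} {j k : ℕ} (h : LL k χ) (hjk : j ≤ k) : LL j χ :=
  ⟨h.1.mono hjk, h.2.mono hjk⟩

theorem LL.tw {χ : Perm α → ℝ} {k : ℕ} (h : LL k χ) : LL k (tw χ) :=
  ⟨h.2, by rw [tw_tw]; exact h.1⟩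

theorem LL.res {χ : Perm α → ℝ} {B : Finset α} {k : ℕ} (h : LL (k + Bᶜ.card) χ) :
    LL k (res B χ) :=
  ⟨h.1.res, by rw [← res_tw]; exact h.2.res⟩

theorem LL.of_mem {s : Multiset (Perm α → ℝ)} (hs : ∀ ψ ∈ s, IsChar ψ) {k : ℕ}
    (h : LL k s.sum) {ψ : Perm α → ℝ} (hψ : ψ ∈ s) : LL k ψ := by
  refine ⟨h.1.of_mem hs hψ, LevGe.of_mem (s := s.map _root_.tw) ?_ ?_ (Multiset.mem_map_of_mem _ hψ)⟩
  · intro φ hφ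
    obtain ⟨φ, h', rfl⟩ := Multiset.mem_map.1 hφ
    exact (hs _ h').tw
  · rw [← tw_multiset_sum]
    exact h.2

theorem IsChar.exists_LL {χ : Perm α → ℝ} (h : IsChar χ) {k : ℕ} (hk : LL k χ) :
    ∃ s : Multiset (Perm α → ℝ), (∀ ψ ∈ s, IsIrr ψ ∧ LL k ψ) ∧ s.sum = χ := by
  obtain ⟨s, hs, rfl⟩ := h.exists_multiset
  exact ⟨s, fun ψ hψ => ⟨hs ψ hψ, hk.of_mem (fun φ hφ => (hs φ hφ).isChar) hψ⟩, rfl⟩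

theorem abs_multiset_sum_le {s : Multiset (Perm α → ℝ)} {c : ℝ} {σ : Perm α}
    (h : ∀ ψ ∈ s, |ψ σ| ≤ c * ψ 1) : |s.sum σ| ≤ c * s.sum 1 := by
  induction s using Multiset.induction with
  | empty => simp
  | cons a s ih =>
    rw [Multiset.sum_cons, Pi.add_apply, Pi.add_apply, mul_add]
    exact (abs_add_le _ _).trans (add_le_add (h a (Multiset.mem_cons_self a s))
      (ih fun ψ hψ => h ψ (Multiset.mem_cons_of_mem hψ)))

/-- A bound on irreducible characters of a Young-type subgroup passes to the whole group. -/
theorem IsChar.abs_le_of_res {χ : Perm α → ℝ} (h : IsChar χ) {B : Finset α} {k : ℕ}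
    (hk : LL (k + Bᶜ.card) χ) {c : ℝ} {ρ : Perm {x // x ∈ B}}
    (hc : ∀ ψ : Perm {x // x ∈ B} → ℝ, IsIrr ψ → LL k ψ → |ψ ρ| ≤ c * ψ 1) :
    |χ (Perm.ofSubtype ρ)| ≤ c * χ 1 := by
  obtain ⟨s, hs, he⟩ := (h.res B).exists_LL hk.res
  have := abs_multiset_sum_le (c := c) (σ := ρ) fun ψ hψ => hc ψ (hs ψ hψ).1 (hs ψ hψ).2
  rwa [he, res_one] at this

theorem levGe_one_iff {χ : Perm α → ℝ} (hχ : IsIrr χ) : LevGe 1 χ ↔ χ ≠ fun _ => 1 := by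
  have h1 : IsIrr fun _ : Perm α => (1 : ℝ) :=
    isIrr_of_norm isChar_one (by simp)
  have h2 := hχ.orth h1
  simp only [mul_one] at h2
  constructor
  · intro h he
    have := h Finset.univ (by simp)
    rw [permsOn_univ, h2, if_pos he] at this
    have h3 : (Fintype.card (Perm α) : ℝ) ≠ 0 := by simp
    exact h3 this
  · intro h D hD
    rw [(Finset.card_eq_iff_eq_univ D).1 (le_antisymm (Finset.card_le_univ D) (by omega)),
      permsOn_univ, h2, if_neg h]

theorem LL_one_iff {χ : Perm α → ℝ} (hχ : IsIrr χ) : LL 1 χ ↔ (χ ≠ fun _ => 1) ∧ χ ≠ sgn := by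
  rw [LL, levGe_one_iff hχ, levGe_one_iff hχ.tw]
  have : tw χ = (fun _ => 1) ↔ χ = sgn := by
    constructor
    · intro h
      rw [← tw_tw χ, h]
      funext σ
      simp [tw]
    · rintro rfl
      funext σ
      exact sgn_mul_self σ
  rw [ne_eq (tw χ), this]

end Restriction

section Uniform

open Equiv

set_option linter.unusedSectionVars false

variable {α : Type} [Fintype α] [DecidableEq α]

theorem IsIrr.eq_one_or_sgn {χ : Perm α → ℝ} (h : IsIrr χ) (h1 : χ 1 = 1) :
    χ = (fun _ => 1) ∨ χ = sgn := by
  have hle : ∀ g, χ g * χ g ≤ 1 := fun g => by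
    have := h.isChar.abs_le g
    rw [h1] at this
    have h2 := abs_le.1 this
    nlinarith
  have hsq : ∀ g, χ g * χ g = 1 := by
    have h2 := h.norm_eq
    have h3 : ∑ g : Perm α, (1 : ℝ) = Fintype.card (Perm α) := by simp
    rw [← h3] at h2
    exact fun g => (Finset.sum_eq_sum_iff_of_le fun g _ => hle g).1 h2 g (Finset.mem_univ g)
  have hmul : ∀ x y, χ (x * y) = χ x * χ y := by
    intro x y
    have h2 := h.schur x y
    rw [h1, div_one] at h2
    have hxy : (χ x * χ y) * (χ x * χ y) = 1 := by
      have := hsq x; have := hsq y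
      calc _ = (χ x * χ x) * (χ y * χ y) := by ring
        _ = 1 := by rw [hsq, hsq, one_mul]
    have h4 : ∑ k : Perm α, (χ x * χ y) * χ (k * x * k⁻¹ * y) = ∑ _k : Perm α, (1 : ℝ) := by
      rw [← Finset.mul_sum, h2]
      simp only [Finset.sum_const, nsmul_eq_mul, mul_one, Finset.card_univ]
      linear_combination (Fintype.card (Perm α) : ℝ) * hxy
    have h5 : ∀ k : Perm α, (χ x * χ y) * χ (k * x * k⁻¹ * y) ≤ 1 := by
      intro k
      have := hsq (k * x * k⁻¹ * y)
      nlinarith [sq_nonneg (χ x * χ y - χ (k * x * k⁻¹ * y))]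
    have h6 := (Finset.sum_eq_sum_iff_of_le fun k _ => h5 k).1 h4 1 (Finset.mem_univ _)
    simp only [one_mul, inv_one, mul_one] at h6
    calc χ (x * y) = (χ x * χ y) * (χ x * χ y) * χ (x * y) := by rw [hxy, one_mul]
      _ = χ x * χ y * (χ x * χ y * χ (x * y)) := by ring
      _ = _ := by rw [h6, mul_one]
  have hpm : ∀ g, χ g = 1 ∨ χ g = -1 := fun g => mul_self_eq_one_iff.1 (hsq g)
  by_cases ht : ∀ g, χ g = 1
  · exact Or.inl (funext ht)
  · right
    push Not at ht
    obtain ⟨g₀, hg₀⟩ := ht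
    let f : Perm α →* ℤˣ :=
      { toFun := fun g => if χ g = 1 then 1 else -1
        map_one' := by simp [h1]
        map_mul' := fun x y => by
          have := hmul x y
          rcases hpm x with hx | hx <;> rcases hpm y with hy | hy <;>
            rw [hx, hy] at this <;> norm_num [hx, hy, this] }
    have hf : Function.Surjective f := by
      intro u
      rcases Int.units_eq_one_or u with rfl | rfl
      · exact ⟨1, map_one f⟩
      · exact ⟨g₀, by simp [f, hg₀]⟩
    have hs := Perm.eq_sign_of_surjective_hom hf
    funext g
    rw [sgn, ← hs]
    rcases hpm g with hg | hg <;> norm_num [f, hg]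

theorem IsIrr.two_le {χ : Perm α → ℝ} (h : IsIrr χ) (hk : LL 1 χ) : 2 ≤ χ 1 := by
  obtain ⟨d, hd⟩ := h.isChar.one_eq_nat
  have h1 := h.one_pos
  rw [hd] at h1 ⊢
  have h2 : 1 ≤ d := by exact_mod_cast h1
  have h3 : d ≠ 1 := by
    rintro rfl
    have h4 := (LL_one_iff h).1 hk
    rcases h.eq_one_or_sgn (by simpa using hd) with h5 | h5
    · exact h4.1 h5
    · exact h4.2 h5
  exact_mod_cast (by omega : 2 ≤ d)

/-- The square root of the defect of a normalized character. -/
noncomputable def defect (χ : Perm α → ℝ) (σ : Perm α) : ℝ := √(1 - |χ σ| / χ 1)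

theorem IsIrr.defect_mul {χ : Perm α → ℝ} (h : IsIrr χ) (x y : Perm α) :
    defect χ (x * y) ≤ defect χ x + defect χ y := h.sqrt_defect_mul x y

theorem IsIrr.defect_conj {χ : Perm α → ℝ} (h : IsIrr χ) {x y : Perm α} (hc : IsConj x y) :
    defect χ x = defect χ y := by
  rw [defect, defect, h.isChar.eq_of_isConj hc]

theorem defect_nonneg (χ : Perm α → ℝ) (σ : Perm α) : 0 ≤ defect χ σ := Real.sqrt_nonneg _

theorem IsIrr.defect_commutator {χ : Perm α → ℝ} (h : IsIrr χ) (σ s : Perm α) :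
    defect χ (σ * s * σ⁻¹ * s⁻¹) ≤ 2 * defect χ σ := by
  have h1 : σ * s * σ⁻¹ * s⁻¹ = σ * (s * σ⁻¹ * s⁻¹) := by group
  rw [h1]
  refine (h.defect_mul _ _).trans ?_
  have : defect χ (s * σ⁻¹ * s⁻¹) = defect χ σ := by
    rw [defect, defect, h.isChar.conj_eq, h.isChar.inv]
  linarith

theorem commutator_swap (σ : Perm α) (x y : α) :
    σ * swap x y * σ⁻¹ * (swap x y)⁻¹ = swap (σ x) (σ y) * swap x y := by
  rw [swap_inv, Equiv.mul_swap_eq_swap_mul σ x y, mul_inv_cancel_right]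

theorem IsIrr.defect_three_of_fixed {χ : Perm α → ℝ} (h : IsIrr χ) {σ : Perm α} {x y : α}
    (hx : σ x ≠ x) (hy : σ y = y) :
    ∃ t : Perm α, t.IsThreeCycle ∧ defect χ t ≤ 2 * defect χ σ := by
  refine ⟨σ * swap x y * σ⁻¹ * (swap x y)⁻¹, ?_, h.defect_commutator _ _⟩
  rw [commutator_swap, hy, swap_comm (σ x) y, swap_comm x y]
  refine Perm.isThreeCycle_swap_mul_swap_same ?_ ?_ hx
  · intro he
    exact hx (σ.injective (by rw [← he, hy]))
  · rintro rfl
    exact hx hy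

theorem IsIrr.defect_three {χ : Perm α → ℝ} (h : IsIrr χ) (hn : 5 ≤ Fintype.card α)
    {σ : Perm α} (hσ : σ ≠ 1) :
    ∃ t : Perm α, t.IsThreeCycle ∧ defect χ t ≤ 4 * defect χ σ := by
  have h0 := defect_nonneg χ σ
  obtain ⟨x, hx⟩ : ∃ x, σ x ≠ x := by
    by_contra hc
    push Not at hc
    exact hσ (Equiv.ext hc)
  by_cases hinv : σ (σ x) = x
  · obtain ⟨y, hy⟩ : ∃ y, y ∉ ({x, σ x} : Finset α) := by
      by_contra hc
      push Not at hc
      have := Finset.card_le_card (fun y _ => hc y : Finset.univ ⊆ ({x, σ x} : Finset α))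
      have := Finset.card_le_two (a := x) (b := σ x)
      rw [← Finset.card_univ] at hn
      omega
    simp only [Finset.mem_insert, Finset.mem_singleton, not_or] at hy
    by_cases hfix : σ y = y
    · obtain ⟨t, h1, h2⟩ := h.defect_three_of_fixed hx hfix
      exact ⟨t, h1, by linarith⟩
    · obtain ⟨e, he⟩ : ∃ e, e ∉ ({x, σ x, y, σ y} : Finset α) := by
        by_contra hc
        push Not at hc
        have := Finset.card_le_card (fun y _ => hc y : Finset.univ ⊆ ({x, σ x, y, σ y} : Finset α))
        have := Finset.card_le_four (a := x) (b := σ x) (c := y) (d := σ y)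
        rw [← Finset.card_univ] at hn
        omega
      simp only [Finset.mem_insert, Finset.mem_singleton, not_or] at he
      have h1 := h.defect_commutator σ (swap x y)
      rw [commutator_swap] at h1
      obtain ⟨t, h2, h3⟩ := h.defect_three_of_fixed (σ := swap (σ x) (σ y) * swap x y) (x := x)
        (y := e) (by
          rw [Perm.mul_apply, swap_apply_left, swap_apply_of_ne_of_ne hy.2 (Ne.symm hfix)]
          exact hy.1) (by
          rw [Perm.mul_apply, swap_apply_of_ne_of_ne he.1 he.2.2.1,
            swap_apply_of_ne_of_ne he.2.1 he.2.2.2])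
      exact ⟨t, h2, by linarith⟩
  · refine ⟨σ * swap x (σ x) * σ⁻¹ * (swap x (σ x))⁻¹, ?_,
      (h.defect_commutator _ _).trans (by linarith)⟩
    rw [commutator_swap, swap_comm x (σ x)]
    refine Perm.isThreeCycle_swap_mul_swap_same ?_ hx hinv
    intro he
    exact hx (σ.injective he.symm)

theorem IsIrr.defect_even {χ : Perm α → ℝ} (h : IsIrr χ) {t : Perm α} (ht : t.IsThreeCycle) :
    ∀ (m : ℕ) (τ : Perm α), τ.support.card ≤ m → Perm.sign τ = 1 →
      defect χ τ ≤ m * defect χ t := by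
  have h0 := defect_nonneg χ t
  have h1 := h.one_pos
  have hone : defect χ 1 = 0 := by
    rw [defect, abs_of_pos (by linarith), div_self (by linarith), sub_self, Real.sqrt_zero]
  intro m
  induction m with
  | zero =>
    intro τ hm _
    have : τ = 1 := by
      rw [← Perm.card_support_eq_zero]
      omega
    rw [this, hone]
    simp
  | succ m ih =>
    intro τ hm hs
    by_cases hτ : τ = 1
    · rw [hτ, hone]
      positivity
    obtain ⟨x, hx⟩ : ∃ x, τ x ≠ x := by
      by_contra hc
      push Not at hc
      exact hτ (Equiv.ext hc)
    have hcard : 2 < τ.support.card := by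
      have h2 := Perm.one_lt_card_support_of_ne_one hτ
      have h3 : τ.support.card ≠ 2 := fun h3 => by
        have := (Perm.card_support_eq_two.1 h3).sign_eq
        rw [hs] at this
        exact absurd this (by decide)
      omega
    obtain ⟨z, hz, hz'⟩ := Finset.exists_mem_notMem_of_card_lt_card
      (lt_of_le_of_lt (Finset.card_le_two (a := x) (b := τ x)) hcard)
    simp only [Finset.mem_insert, Finset.mem_singleton, not_or] at hz'
    have hc3 : (swap x (τ x) * swap x z).IsThreeCycle :=
      Perm.isThreeCycle_swap_mul_swap_same (Ne.symm hx) (Ne.symm hz'.1) (Ne.symm hz'.2)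
    have hsub : ((swap x (τ x) * swap x z) * τ).support ⊆ τ.support.erase x := by
      intro w hw
      rw [Finset.mem_erase, Perm.mem_support]
      rw [Perm.mem_support] at hw
      constructor
      · rintro rfl
        apply hw
        rw [Perm.mul_apply, Perm.mul_apply, swap_apply_of_ne_of_ne hx (Ne.symm hz'.2),
          swap_apply_right]
      · intro hw'
        apply hw
        have h1 : w ≠ x := by rintro rfl; exact hx hw'
        have h2 : w ≠ z := by rintro rfl; exact (Perm.mem_support.1 hz) hw'
        have h3 : w ≠ τ x := by
          rintro rfl
          exact hx (τ.injective hw')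
        rw [Perm.mul_apply, Perm.mul_apply, hw', swap_apply_of_ne_of_ne h1 h2,
          swap_apply_of_ne_of_ne h1 h3]
    have hcs := Finset.card_le_card hsub
    rw [Finset.card_erase_of_mem (Perm.mem_support.2 hx)] at hcs
    have h2 := ih ((swap x (τ x) * swap x z) * τ) (by omega) (by
      rw [Perm.sign_mul, hs, hc3.sign, one_mul])
    have h3 := h.defect_mul (swap x (τ x) * swap x z)⁻¹ ((swap x (τ x) * swap x z) * τ)
    rw [inv_mul_cancel_left] at h3
    have h4 : defect χ (swap x (τ x) * swap x z)⁻¹ = defect χ t := by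
      apply h.defect_conj
      rw [Perm.isConj_iff_cycleType_eq, hc3.inv.cycleType, ht.cycleType]
    push_cast
    linarith

/-- A uniform spectral gap for nontrivial elements. -/
theorem IsIrr.abs_le_gap {χ : Perm α → ℝ} (h : IsIrr χ) (hk : LL 1 χ)
    (hn : 5 ≤ Fintype.card α) {σ : Perm α} (hσ : σ ≠ 1) :
    |χ σ| ≤ (1 - 1 / (64 * (Fintype.card α : ℝ) ^ 2)) * χ 1 := by
  have h1 := h.two_le hk
  set n := Fintype.card α with hn'
  have hn0 : (5 : ℝ) ≤ n := by exact_mod_cast hn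
  by_contra hc
  push Not at hc
  obtain ⟨t, ht, ht'⟩ := h.defect_three hn hσ
  have hd : defect χ σ ≤ 1 / (8 * n) := by
    rw [defect]
    apply Real.sqrt_le_iff.2
    refine ⟨by positivity, ?_⟩
    rw [div_pow, mul_pow, one_pow]
    have : 1 - 1 / (64 * (n : ℝ) ^ 2) < |χ σ| / χ 1 := by
      rw [lt_div_iff₀ (by linarith)]
      exact hc
    norm_num at this ⊢
    linarith
  have heven : ∀ τ : Perm α, Perm.sign τ = 1 → 9 / 16 * (χ 1 * χ 1) ≤ χ τ * χ τ := by
    intro τ hs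
    have h2 := h.defect_even ht n τ (Finset.card_le_univ _) hs
    have h3 : defect χ τ ≤ 1 / 2 := by
      calc defect χ τ ≤ n * (4 * (1 / (8 * n))) := by
            refine h2.trans ?_
            gcongr
            linarith
        _ = 1 / 2 := by field_simp; norm_num
    rw [defect] at h3
    have h4 := (Real.sqrt_le_iff.1 h3).2
    have h5 : 3 / 4 ≤ |χ τ| / χ 1 := by linarith
    rw [le_div_iff₀ (by linarith)] at h5
    rw [← abs_mul_abs_self (χ τ)]
    nlinarith
  have : Nontrivial α := Fintype.one_lt_card_iff_nontrivial.1 (by omega)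
  obtain ⟨a, b, hab⟩ := exists_pair_ne α
  have hsum : ∑ g : Perm α, (χ g * χ g + χ (g * swap a b) * χ (g * swap a b)) =
      2 * Fintype.card (Perm α) := by
    have h2 := Equiv.sum_comp (Equiv.mulRight (swap a b)) (fun g => χ g * χ g)
    simp only [Equiv.coe_mulRight] at h2
    rw [Finset.sum_add_distrib, h2, h.norm_eq]
    ring
  have hlow : ∑ _g : Perm α, 9 / 16 * (χ 1 * χ 1) ≤
      ∑ g : Perm α, (χ g * χ g + χ (g * swap a b) * χ (g * swap a b)) := by
    refine Finset.sum_le_sum fun g _ => ?_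
    rcases Int.units_eq_one_or (Perm.sign g) with hg | hg
    · have := heven g hg
      nlinarith [mul_self_nonneg (χ (g * swap a b))]
    · have := heven (g * swap a b) (by rw [Perm.sign_mul, hg, Perm.sign_swap hab]; decide)
      nlinarith [mul_self_nonneg (χ g)]
  rw [hsum, Finset.sum_const, nsmul_eq_mul, Finset.card_univ] at hlow
  have hG : (0 : ℝ) < Fintype.card (Perm α) := by exact_mod_cast Fintype.card_pos
  have h4 : (4 : ℝ) ≤ χ 1 * χ 1 := by nlinarith
  have h6 := mul_le_mul_of_nonneg_left h4 hG.le
  linarith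

end Uniform

section Dimension

open Equiv

set_option linter.unusedSectionVars false

variable {α : Type} [Fintype α] [DecidableEq α]

theorem LL.dichotomy {χ : Perm α → ℝ} {j : ℕ} (h : LL j χ) (m : ℕ) :
    LL m χ ∨ ∃ k, j ≤ k ∧ k < m ∧ LL k χ ∧ ∃ ψ, (ψ = χ ∨ ψ = _root_.tw χ) ∧
      LevGe k ψ ∧ ¬ LevGe (k + 1) ψ := by
  classical
  by_cases hm : LL m χ
  · exact Or.inl hm
  right
  have hjm : j < m := by
    by_contra hc
    exact hm (h.mono (not_lt.1 hc))
  have hex : ∃ k, ¬ LL (k + 1) χ := ⟨m - 1, by rwa [Nat.sub_add_cancel (by omega)]⟩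
  have h1 : LL (Nat.find hex) χ := by
    rcases hk : Nat.find hex with _ | k
    · exact ⟨levGe_zero χ, levGe_zero _⟩
    · exact not_not.1 (Nat.find_min hex (m := k) (by omega))
  refine ⟨Nat.find hex, ?_, ?_, h1, ?_⟩
  · by_contra hc
    exact Nat.find_spec hex (h.mono (by omega))
  · by_contra hc
    exact hm (h1.mono (by omega))
  · have := Nat.find_spec hex
    rw [LL, not_and_or] at this
    rcases this with h2 | h2
    · exact ⟨χ, Or.inl rfl, h1.1, h2⟩
    · exact ⟨_, Or.inr rfl, h1.2, h2⟩

/-- Averaging over a disjoint block lowers the level by at most the size of the complement. -/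
theorem LL.partial_sum {χ : Perm α → ℝ} (hχ : IsChar χ) {B E : Finset α} (hd : Disjoint B E)
    {k : ℕ} (h : LL (k + Bᶜ.card) χ) {ψ : Perm {x // x ∈ B} → ℝ} {c : ℝ} (hc : c ≠ 0)
    (hψ : ∀ τ, ∑ η ∈ permsOn E, χ (Perm.ofSubtype τ * η) = c * ψ τ) : LL k ψ := by
  have key : ∀ (φ : Perm α → ℝ), IsChar φ → LevGe (k + Bᶜ.card) φ → ∀ (D : Finset {x // x ∈ B}),
      Fintype.card {x // x ∈ B} < D.card + k → ∀ η ∈ permsOn E,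
      ∑ ρ ∈ permsOn D, φ (Perm.ofSubtype ρ * η) = 0 := by
    intro φ hφ hl D hD η hη
    have h1 := hl.res D hD
    rw [sum_permsOn_res] at h1
    have hd' : Disjoint E (D.map (Function.Embedding.subtype _)) := by
      refine hd.symm.mono_right fun x hx => ?_
      obtain ⟨y, _, rfl⟩ := Finset.mem_map.1 hx
      exact y.2
    have h2 := hφ.partial_sum_eq_zero hd' h1 hη
    rw [← h2]
    have h3 := sum_permsOn_res B (fun ρ => φ (ρ * η)) D
    simp only [_root_.res] at h3
    rw [h3]
    exact Finset.sum_congr rfl fun ρ hρ => by rw [permsOn_commute hd' hη hρ]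
  constructor
  · intro D hD
    apply (mul_eq_zero.1 (?_ : c * _ = 0)).resolve_left hc
    rw [Finset.mul_sum]
    simp only [← hψ]
    rw [Finset.sum_comm]
    exact Finset.sum_eq_zero fun η hη => key χ hχ h.1 D hD η hη
  · intro D hD
    apply (mul_eq_zero.1 (?_ : c * _ = 0)).resolve_left hc
    rw [Finset.mul_sum]
    have : ∀ ρ, c * _root_.tw ψ ρ =
        ∑ η ∈ permsOn E, sgn η * _root_.tw χ (Perm.ofSubtype ρ * η) := by
      intro ρ
      rw [_root_.tw, mul_left_comm, ← hψ, Finset.mul_sum]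
      refine Finset.sum_congr rfl fun η _ => ?_
      rw [_root_.tw, sgn_mul, ← mul_assoc, mul_left_comm (sgn η), sgn_mul_self, mul_one]
      simp [sgn, Perm.sign_ofSubtype]
    simp only [this]
    rw [Finset.sum_comm]
    refine Finset.sum_eq_zero fun η hη => ?_
    rw [← Finset.mul_sum, key _ hχ.tw h.2 D hD η hη, mul_zero]

theorem permsOn_pair {x y : α} (h : x ≠ y) : permsOn {x, y} = {1, swap x y} := by
  symm
  apply Finset.eq_of_subset_of_card_le
  · intro σ hσ
    rw [Finset.mem_insert, Finset.mem_singleton] at hσ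
    rcases hσ with rfl | rfl
    · exact one_mem_permsOn _
    · rw [mem_permsOn]
      intro z hz
      rw [Finset.mem_insert, Finset.mem_singleton, not_or] at hz
      exact swap_apply_of_ne_of_ne hz.1 hz.2
  · rw [card_permsOn, Finset.card_pair h, Finset.card_pair]
    · rfl
    · intro he
      have := congrArg (fun σ : Perm α => σ x) he
      simp at this
      exact h this

theorem sum_permsOn_pair {x y : α} (h : x ≠ y) (f : Perm α → ℝ) :
    ∑ η ∈ permsOn {x, y}, f η = f 1 + f (swap x y) := by
  rw [permsOn_pair h, Finset.sum_pair]
  intro he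
  have := congrArg (fun σ : Perm α => σ x) he
  simp at this
  exact h this

theorem two_pow_le_of_LL (j : ℕ) : ∀ (α : Type) [Fintype α] [DecidableEq α] (χ : Perm α → ℝ),
    IsChar χ → χ 1 ≠ 0 → 5 + 2 * j ≤ Fintype.card α → LL (1 + 2 * j) χ → 2 ^ j ≤ χ 1 := by
  induction j with
  | zero =>
    intro α _ _ χ h h0 _ _
    obtain ⟨d, hd⟩ := h.one_eq_nat
    rw [hd] at h0 ⊢
    have : d ≠ 0 := by exact_mod_cast h0
    rw [pow_zero]
    exact_mod_cast Nat.one_le_iff_ne_zero.2 this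
  | succ j ih =>
    intro α _ _ χ h h0 hn hk
    obtain ⟨s, hs, rfl⟩ := h.exists_LL hk
    obtain ⟨θ, hθ⟩ : ∃ θ, θ ∈ s := by
      by_contra hc
      push Not at hc
      rw [Multiset.eq_zero_of_forall_notMem hc] at h0
      exact h0 rfl
    have hle : θ 1 ≤ s.sum 1 := by
      rw [multiset_sum_apply]
      refine Multiset.single_le_sum ?_ _ (Multiset.mem_map_of_mem (fun ψ => ψ 1) hθ)
      intro x hx
      obtain ⟨φ, hφ, rfl⟩ := Multiset.mem_map.1 hx
      exact (hs φ hφ).1.isChar.one_nonneg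
    refine le_trans ?_ hle
    obtain ⟨hirr, hL⟩ := hs θ hθ
    have : Nontrivial α := Fintype.one_lt_card_iff_nontrivial.1 (by omega)
    obtain ⟨x, y, hxy⟩ := exists_pair_ne α
    have hcE : ({x, y} : Finset α).card = 2 := Finset.card_pair hxy
    have hd : Disjoint ({x, y} : Finset α)ᶜ {x, y} := disjoint_compl_left
    have hcB : (({x, y} : Finset α)ᶜ)ᶜ.card = 2 := by rw [compl_compl, hcE]
    have hcB' : Fintype.card {z // z ∈ ({x, y} : Finset α)ᶜ} + 2 = Fintype.card α := by
      rw [Fintype.card_coe, ← hcE, add_comm]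
      exact Finset.card_add_card_compl _
    have hL' : LL (1 + 2 * j + (({x, y} : Finset α)ᶜ)ᶜ.card) θ := by
      rw [hcB]
      exact hL.mono (by omega)
    have hgap := hirr.abs_le_gap (hL.mono (by omega)) (by omega) (fun he => hxy (Equiv.swap_eq_one_iff.1 he))
    have hlt : |θ (swap x y)| < θ 1 := by
      refine lt_of_le_of_lt hgap ?_
      have h1 := hirr.one_pos
      have : 0 < 1 / (64 * (Fintype.card α : ℝ) ^ 2) := by
        have : (0 : ℝ) < Fintype.card α := by exact_mod_cast (by omega)
        positivity
      nlinarith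
    have hlt' := abs_lt.1 hlt
    obtain ⟨ψ, hψ, hψ'⟩ := hirr.isChar.partial_sum hd
    obtain ⟨ψ₂, hψ₂, hψ₂'⟩ := hirr.isChar.tw.partial_sum hd
    have e1 := hψ' 1
    have e2 := hψ₂' 1
    rw [sum_permsOn_pair hxy] at e1 e2
    simp only [map_one, one_mul, hcE, Nat.factorial, Nat.succ_eq_add_one, zero_add, Nat.reduceAdd,
      mul_one, Nat.cast_ofNat] at e1 e2
    rw [tw_one, tw, sgn, Perm.sign_swap hxy] at e2
    push_cast at e2
    have f1 := ih _ ψ hψ (by intro h0; rw [h0] at e1; linarith) (by omega)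
      (hL'.partial_sum hirr.isChar hd (by positivity) hψ')
    have f2 := ih _ ψ₂ hψ₂ (by intro h0; rw [h0] at e2; linarith) (by omega)
      (hL'.tw.partial_sum hirr.isChar.tw hd (by positivity) hψ₂')
    rw [pow_succ]
    linarith

theorem choose_mono_of_le {n i j : ℕ} (hij : i ≤ j) (h : 2 * j ≤ n) : n.choose i ≤ n.choose j := by
  induction j, hij using Nat.le_induction with
  | base => exact le_rfl
  | succ j _ ih =>
    exact (ih (by omega)).trans (Nat.choose_le_succ_of_lt_half_left (by omega))

/-- A lower bound for the degree of characters of large level. -/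
theorem IsIrr.choose_or_two_pow_le {χ : Perm α → ℝ} (h : IsIrr χ) {j : ℕ} (hL : LL j χ)
    (hn : 32 ≤ Fintype.card α) :
    ((Fintype.card α).choose j : ℝ) ≤ 2 * χ 1 ∨ (2 : ℝ) ^ (Fintype.card α / 16) ≤ 2 * χ 1 := by
  set n := Fintype.card α with hn'
  have h1 := h.one_pos
  rcases hL.dichotomy (n / 8 + 1) with h2 | ⟨k, hk, hkn, -, ψ, hψ, h3, h4⟩
  · right
    have := two_pow_le_of_LL (n / 16) α χ h.isChar (by linarith) (by omega) (h2.mono (by omega))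
    linarith
  · left
    have hirr : IsIrr ψ := by rcases hψ with rfl | rfl; exacts [h, h.tw]
    have hone : ψ 1 = χ 1 := by rcases hψ with rfl | rfl; exacts [rfl, tw_one χ]
    obtain ⟨u, hu, -, h5⟩ := hirr.exists_bound (k := k) (by omega) h3 h4
    rw [hone] at h5
    refine le_trans ?_ h5
    have h6 : (n.choose j : ℝ) ≤ n.choose k := by exact_mod_cast choose_mono_of_le hk (by omega)
    have : (0 : ℝ) ≤ n.choose k := by positivity
    nlinarith

end Dimension

section Averages

open Equiv

set_option linter.unusedSectionVars false

variable {α : Type} [Fintype α] [DecidableEq α]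

theorem card_permsOn_inv {D B : Finset α} (h : B ⊆ D) :
    ((permsOn D).filter fun ρ => IsInv ρ B).card = (D.card - B.card).factorial * B.card.factorial := by
  have h1 := sum_inv_restr_card h (fun _ => (1 : ℝ))
  simp only [Finset.sum_const, nsmul_eq_mul, mul_one, card_permsOn] at h1
  exact_mod_cast h1

theorem inv_iff_inter {D A : Finset α} {ρ : Perm α} (h : ρ ∈ permsOn D) :
    IsInv ρ A ↔ IsInv ρ (A ∩ D) := by
  have := inv_mul_iff h (one_mem_permsOn Dᶜ) A
  rw [mul_one] at this
  rw [this, and_iff_left]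
  exact fun x hx => hx

theorem sum_range_ite_le (m k : ℕ) (f : ℕ → ℕ) :
    ∑ i ∈ Finset.range m, (if i ≤ k then f i else 0) ≤ ∑ i ∈ Finset.range (k + 1), f i := by
  rw [← Finset.sum_filter]
  refine Finset.sum_le_sum_of_subset fun i hi => ?_
  simp only [Finset.mem_filter, Finset.mem_range] at hi ⊢
  omega

theorem sum_stableCount_le (D : Finset α) (k : ℕ) :
    ∑ ρ ∈ permsOn D, stableCount ρ k ≤
      (k + 1) * D.card.factorial * ∑ i ∈ Finset.range (k + 1), Dᶜ.card.choose i := by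
  have h1 : ∑ ρ ∈ permsOn D, stableCount ρ k =
      ∑ A : Finset α, if A.card ≤ k then
        (D.card - (A ∩ D).card).factorial * (A ∩ D).card.factorial else 0 := by
    simp only [stableCount, Finset.card_filter]
    rw [Finset.sum_comm]
    refine Finset.sum_congr rfl fun A _ => ?_
    split_ifs with hA
    · rw [← card_permsOn_inv Finset.inter_subset_right, Finset.card_filter]
      refine Finset.sum_congr rfl fun ρ hρ => ?_
      simp only [hA, and_true, inv_iff_inter (A := A) hρ]
    · exact Finset.sum_eq_zero fun ρ _ => if_neg fun h => hA h.2
  let f : ℕ → ℕ := fun i => if i ≤ k then (D.card - i).factorial * i.factorial else 0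
  let g : ℕ → ℕ := fun i => if i ≤ k then 1 else 0
  have h2 : ∀ A : Finset α, (if A.card ≤ k then
        (D.card - (A ∩ D).card).factorial * (A ∩ D).card.factorial else 0) ≤
        f (A ∩ D).card * g (A ∩ Dᶜ).card := by
    intro A
    split_ifs with hA
    · have e1 := Finset.card_le_card (Finset.inter_subset_left (s₁ := A) (s₂ := D))
      have e2 := Finset.card_le_card (Finset.inter_subset_left (s₁ := A) (s₂ := Dᶜ))
      simp only [f, g]
      rw [if_pos (by omega), if_pos (by omega), mul_one]
    · exact Nat.zero_le _
  rw [h1]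
  refine (Finset.sum_le_sum fun A _ => h2 A).trans ?_
  rw [sum_split_powerset D fun A B => f A.card * g B.card]
  simp only [← Finset.mul_sum, ← Finset.sum_mul]
  rw [Finset.sum_powerset_apply_card, Finset.sum_powerset_apply_card]
  refine Nat.mul_le_mul ?_ ?_
  · have h3 : ∀ m ∈ Finset.range (D.card + 1), D.card.choose m • f m =
        if m ≤ k then D.card.factorial else 0 := by
      intro m hm
      simp only [f, smul_eq_mul]
      split_ifs with hmk
      · rw [← Nat.choose_mul_factorial_mul_factorial (Nat.lt_succ_iff.1 (Finset.mem_range.1 hm))]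
        ring
      · simp
    rw [Finset.sum_congr rfl h3]
    refine (sum_range_ite_le _ _ _).trans ?_
    simp
  · have h3 : ∀ m ∈ Finset.range (Dᶜ.card + 1), Dᶜ.card.choose m • g m =
        if m ≤ k then Dᶜ.card.choose m else 0 := by
      intro m _
      simp only [g, smul_eq_mul, mul_ite, mul_one, mul_zero]
    rw [Finset.sum_congr rfl h3]
    exact sum_range_ite_le _ _ _

theorem sum_choose_le_choose_add (b k : ℕ) :
    ∑ i ∈ Finset.range (k + 1), b.choose i ≤ (b + k).choose k := by
  rw [Nat.add_choose_eq, Finset.Nat.sum_antidiagonal_eq_sum_range_succ_mk]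
  refine Finset.sum_le_sum fun i hi => ?_
  rw [Finset.mem_range] at hi
  exact Nat.le_mul_of_pos_right _ (Nat.choose_pos (by omega))

theorem choose_div_le {m n k : ℕ} (hmn : m ≤ n) (hn : 0 < n) (hk : k ≤ n) :
    (m.choose k : ℝ) ≤ ((m : ℝ) / n) ^ k * n.choose k := by
  have key : ∀ j, j ≤ k → (m.descFactorial j : ℝ) ≤ ((m : ℝ) / n) ^ j * n.descFactorial j := by
    intro j
    induction j with
    | zero => simp
    | succ j ih =>
      intro hj
      have h0 := ih (by omega)
      have hnR : (0 : ℝ) < n := by exact_mod_cast hn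
      rw [Nat.descFactorial_succ, Nat.descFactorial_succ, pow_succ]
      push_cast [Nat.cast_sub (by omega : j ≤ n)]
      have h3 : ((m - j : ℕ) : ℝ) ≤ (m : ℝ) / n * (n - j) := by
        rcases le_or_gt j m with hjm | hjm
        · rw [Nat.cast_sub hjm, div_mul_eq_mul_div, le_div_iff₀ hnR]
          have : (m : ℝ) ≤ n := by exact_mod_cast hmn
          have : (0 : ℝ) ≤ j := by positivity
          nlinarith
        · rw [Nat.sub_eq_zero_of_le hjm.le]
          have : (j : ℝ) ≤ n := by exact_mod_cast (by omega)
          have : (0 : ℝ) ≤ (n : ℝ) - j := by linarith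
          push_cast
          positivity
      calc _ ≤ ((m : ℝ) / n * (n - j)) * (((m : ℝ) / n) ^ j * n.descFactorial j) :=
            mul_le_mul h3 h0 (by positivity) (le_trans (by positivity) h3)
        _ = _ := by ring
  have h1 := key k le_rfl
  rw [Nat.descFactorial_eq_factorial_mul_choose, Nat.descFactorial_eq_factorial_mul_choose] at h1
  push_cast at h1
  have hf : (0 : ℝ) < k.factorial := by exact_mod_cast Nat.factorial_pos k
  refine le_of_mul_le_mul_left ?_ hf
  linarith

theorem IsIrr.sum_permsOn_le {χ : Perm α → ℝ} (h : IsIrr χ) {k : ℕ} (h1 : LevGe k χ)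
    (h2 : ¬ LevGe (k + 1) χ) (D : Finset α) (hD : 8 * k ≤ D.card) (hD0 : 0 < D.card) :
    ∑ ρ ∈ permsOn D, χ ρ ≤ D.card.factorial *
      (2 * (k + 1) * ((Dᶜ.card + k : ℝ) / Fintype.card α) ^ k * χ 1) := by
  have hc : D.card + Dᶜ.card = Fintype.card α := Finset.card_add_card_compl D
  obtain ⟨u, hu, hb, hd⟩ := h.exists_bound (k := k) (by omega) h1 h2
  calc ∑ ρ ∈ permsOn D, χ ρ ≤ ∑ ρ ∈ permsOn D, u * stableCount ρ k :=
        Finset.sum_le_sum fun ρ _ => (le_abs_self _).trans (hb ρ)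
    _ = u * ((∑ ρ ∈ permsOn D, stableCount ρ k : ℕ) : ℝ) := by push_cast; rw [Finset.mul_sum]
    _ ≤ u * (((k + 1) * D.card.factorial * (Dᶜ.card + k).choose k : ℕ) : ℝ) := by
        gcongr
        refine (sum_stableCount_le D k).trans ?_
        gcongr
        exact sum_choose_le_choose_add _ _
    _ ≤ u * ((k + 1) * D.card.factorial * ((((Dᶜ.card + k : ℕ) : ℝ) / Fintype.card α) ^ k *
          (Fintype.card α).choose k)) := by
        push_cast
        gcongr
        have := choose_div_le (m := Dᶜ.card + k) (n := Fintype.card α) (k := k) (by omega) (by omega)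
          (by omega)
        push_cast at this
        exact this
    _ = D.card.factorial * ((k + 1) * ((Dᶜ.card + k : ℝ) / Fintype.card α) ^ k) *
          (u * (Fintype.card α).choose k) := by push_cast; ring
    _ ≤ D.card.factorial * ((k + 1) * ((Dᶜ.card + k : ℝ) / Fintype.card α) ^ k) * (2 * χ 1) := by
        gcongr
    _ = _ := by ring

theorem LevGe.sum_permsOn_le {a k : ℕ} (hk : 1 ≤ k) (ha : 8 * k ≤ a) (b : ℕ) :
    ∀ (α : Type) [Fintype α] [DecidableEq α] (χ : Perm α → ℝ) (D : Finset α), IsChar χ →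
      LevGe k χ → D.card = a → Dᶜ.card = b →
      ∑ ρ ∈ permsOn D, χ ρ ≤ a.factorial *
        (2 * (k + 1) * ((b + k : ℝ) / (a + b)) ^ k * χ 1) := by
  induction b with
  | zero =>
    intro α _ _ χ D h hl hD hD'
    have hc : D.card + Dᶜ.card = Fintype.card α := Finset.card_add_card_compl D
    rw [hl D (by omega)]
    have := h.one_nonneg
    positivity
  | succ b ih =>
    intro α _ _ χ D h hl hD hD'
    have hc : D.card + Dᶜ.card = Fintype.card α := Finset.card_add_card_compl D
    obtain ⟨s, hs, rfl⟩ := h.exists_multiset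
    have hb : ∀ ψ ∈ s, ∑ ρ ∈ permsOn D, ψ ρ ≤ a.factorial *
        (2 * (k + 1) * (((b + 1 : ℕ) + k : ℝ) / (a + (b + 1 : ℕ))) ^ k * ψ 1) := by
      intro ψ hψ
      have hψi := hs ψ hψ
      have hψl := hl.of_mem (fun φ hφ => (hs φ hφ).isChar) hψ
      by_cases hψ2 : LevGe (k + 1) ψ
      · obtain ⟨x, hx⟩ : Dᶜ.Nonempty := Finset.card_pos.1 (by omega)
        let B : Finset α := {x}ᶜ
        have hDB : D ⊆ B := fun y hy => by
          simp only [B, Finset.mem_compl, Finset.mem_singleton]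
          rintro rfl
          exact Finset.mem_compl.1 hx hy
        have hmap : (D.subtype (· ∈ B)).map (Function.Embedding.subtype _) = D :=
          Finset.subtype_map_of_mem hDB
        have hBc : Bᶜ.card = 1 := by simp [B]
        have hB : B.card + 1 = Fintype.card α := by
          rw [← hBc]; exact Finset.card_add_card_compl B
        have hc' := Finset.card_add_card_compl (D.subtype (· ∈ B))
        have hDc : (D.subtype (· ∈ B)).card = a := by rw [← hD, ← hmap, Finset.card_map, hmap]
        rw [Fintype.card_coe] at hc'
        have h3 := ih {y // y ∈ B} (_root_.res B ψ) (D.subtype (· ∈ B)) (hψi.isChar.res B)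
          (LevGe.res (by rw [hBc]; exact hψ2)) hDc (by omega)
        rw [sum_permsOn_res, hmap, res_one] at h3
        refine h3.trans ?_
        have := hψi.isChar.one_nonneg
        gcongr ?_ * (_ * ?_ ^ k * _)
        have ha0 : (0 : ℝ) < a := by exact_mod_cast (by omega)
        have hka : (k : ℝ) ≤ a := by exact_mod_cast (by omega)
        push_cast
        rw [div_le_div_iff₀ (by positivity) (by positivity)]
        nlinarith
      · have h3 := hψi.sum_permsOn_le hψl hψ2 D (by omega) (by omega)
        rw [hD, hD', ← hc, hD, hD'] at h3
        push_cast at h3 ⊢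
        exact h3
    rw [sum_permsOn_multiset_sum, multiset_sum_apply]
    rw [← mul_assoc, ← Multiset.sum_map_mul_left]
    refine Multiset.sum_map_le_sum_map _ _ fun ψ hψ => ?_
    rw [mul_assoc]
    exact hb ψ hψ

end Averages

section Orbits

open Equiv

set_option linter.unusedSectionVars false

variable {α : Type} [Fintype α] [DecidableEq α]

/-- The set of orbits of `σ`. -/
def orbs (σ : Perm α) : Finset (Finset α) := Finset.univ.image (orb σ)

theorem orb_mem_orbs (σ : Perm α) (x : α) : orb σ x ∈ orbs σ :=
  Finset.mem_image_of_mem _ (Finset.mem_univ x)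

theorem inv_of_mem_orbs {σ : Perm α} {O : Finset α} (h : O ∈ orbs σ) : IsInv σ O := by
  obtain ⟨x, _, rfl⟩ := Finset.mem_image.1 h
  exact inv_orb σ x

theorem eq_orb_of_mem {σ : Perm α} {O : Finset α} (h : O ∈ orbs σ) {x : α} (hx : x ∈ O) :
    O = orb σ x := by
  obtain ⟨y, _, rfl⟩ := Finset.mem_image.1 h
  rw [mem_orb] at hx
  ext z
  rw [mem_orb, mem_orb]
  exact ⟨fun h => hx.symm.trans h, fun h => hx.trans h⟩

theorem orbs_nonempty {σ : Perm α} {O : Finset α} (h : O ∈ orbs σ) : O.Nonempty := by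
  obtain ⟨y, _, rfl⟩ := Finset.mem_image.1 h
  exact ⟨y, self_mem_orb σ y⟩

theorem orbs_disjoint {σ : Perm α} {O O' : Finset α} (h : O ∈ orbs σ) (h' : O' ∈ orbs σ)
    (hne : O ≠ O') : Disjoint O O' := by
  rw [Finset.disjoint_left]
  intro x hx hx'
  exact hne ((eq_orb_of_mem h hx).trans (eq_orb_of_mem h' hx').symm)

theorem card_biUnion_orbs {σ : Perm α} {S : Finset (Finset α)} (h : S ⊆ orbs σ) :
    (S.biUnion id).card = ∑ O ∈ S, O.card :=
  Finset.card_biUnion fun _ hO _ hO' hne => orbs_disjoint (h hO) (h hO') hne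

theorem inv_biUnion {σ : Perm α} {S : Finset (Finset α)} (h : S ⊆ orbs σ) :
    IsInv σ (S.biUnion id) := by
  intro x hx
  rw [Finset.mem_biUnion] at *
  obtain ⟨O, hO, hx⟩ := hx
  exact ⟨O, hO, inv_of_mem_orbs (h hO) x hx⟩

theorem biUnion_filter_orbs {σ : Perm α} {A : Finset α} (h : IsInv σ A) :
    ((orbs σ).filter (· ⊆ A)).biUnion id = A := by
  ext x
  simp only [Finset.mem_biUnion, Finset.mem_filter, id]
  constructor
  · rintro ⟨O, ⟨_, hO⟩, hx⟩
    exact hO hx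
  · exact fun hx => ⟨orb σ x, ⟨orb_mem_orbs σ x, orb_subset h hx⟩, self_mem_orb σ x⟩

theorem filter_orbs_biUnion {σ : Perm α} {S : Finset (Finset α)} (h : S ⊆ orbs σ) :
    (orbs σ).filter (· ⊆ S.biUnion id) = S := by
  ext O
  simp only [Finset.mem_filter]
  constructor
  · rintro ⟨hO, hs⟩
    obtain ⟨x, hx⟩ := orbs_nonempty hO
    obtain ⟨O', hO', hx'⟩ := Finset.mem_biUnion.1 (hs hx)
    rwa [eq_orb_of_mem hO hx, ← eq_orb_of_mem (h hO') hx']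
  · exact fun hO => ⟨h hO, Finset.subset_biUnion_of_mem id hO⟩

theorem sum_inv_eq_sum_orbs {M : Type} [AddCommMonoid M] (σ : Perm α) (F : Finset α → M) :
    ∑ A : Finset α with IsInv σ A, F A = ∑ S ∈ (orbs σ).powerset, F (S.biUnion id) := by
  refine Finset.sum_nbij' (fun A => (orbs σ).filter (· ⊆ A)) (fun S => S.biUnion id) ?_ ?_ ?_ ?_ ?_
  · intro A _
    exact Finset.mem_powerset.2 (Finset.filter_subset _ _)
  · intro S hS
    exact Finset.mem_filter.2 ⟨Finset.mem_univ _, inv_biUnion (Finset.mem_powerset.1 hS)⟩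
  · intro A hA
    exact biUnion_filter_orbs (Finset.mem_filter.1 hA).2
  · intro S hS
    exact filter_orbs_biUnion (Finset.mem_powerset.1 hS)
  · intro A hA
    rw [biUnion_filter_orbs (Finset.mem_filter.1 hA).2]

theorem sum_card_orbs (σ : Perm α) : ∑ O ∈ orbs σ, O.card = Fintype.card α := by
  rw [← card_biUnion_orbs (Finset.Subset.refl _), ← Finset.card_univ]
  congr 1
  ext x
  simp only [Finset.mem_biUnion, Finset.mem_univ, iff_true]
  exact ⟨_, orb_mem_orbs σ x, self_mem_orb σ x⟩

/-- The orbits of size `l`. -/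
def orbN (σ : Perm α) (l : ℕ) : Finset (Finset α) := (orbs σ).filter fun O => O.card = l

/-- The number of orbits of size `l`. -/
def cn (σ : Perm α) (l : ℕ) : ℕ := (orbN σ l).card

theorem cn_one (σ : Perm α) : cn σ 1 = (Finset.univ.filter fun x => σ x = x).card := by
  rw [cn]
  symm
  refine Finset.card_bij (fun x _ => orb σ x) ?_ ?_ ?_
  · intro x hx
    rw [orbN, Finset.mem_filter]
    refine ⟨orb_mem_orbs σ x, ?_⟩
    rw [orb_eq_singleton (Finset.mem_filter.1 hx).2, Finset.card_singleton]
  · intro x hx y hy h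
    rw [orb_eq_singleton (Finset.mem_filter.1 hx).2, orb_eq_singleton (Finset.mem_filter.1 hy).2]
      at h
    exact Finset.singleton_injective h
  · intro O hO
    rw [orbN, Finset.mem_filter, Finset.card_eq_one] at hO
    obtain ⟨hO, x, rfl⟩ := hO
    have h1 := inv_of_mem_orbs hO x (Finset.mem_singleton_self x)
    exact ⟨x, Finset.mem_filter.2 ⟨Finset.mem_univ _, Finset.mem_singleton.1 h1⟩,
      (eq_orb_of_mem hO (Finset.mem_singleton_self x)).symm⟩

theorem cn_of_two_le (σ : Perm α) {l : ℕ} (hl : 2 ≤ l) : cn σ l = σ.cycleType.count l := by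
  rw [Perm.cycleType, Multiset.count_map, ← Finset.filter_val, Finset.card_val, cn]
  symm
  refine Finset.card_bij (fun c _ => c.support) ?_ ?_ ?_
  · intro c hc
    rw [Finset.mem_filter, Perm.mem_cycleFactorsFinset_iff] at hc
    obtain ⟨⟨h1, h2⟩, h3⟩ := hc
    obtain ⟨x, hx⟩ := h1.nonempty_support
    have h4 : orb σ x = c.support := by
      rw [orb_eq_support, ← Perm.cycle_is_cycleOf hx (Perm.mem_cycleFactorsFinset_iff.2 ⟨h1, h2⟩)]
      rw [← h2 x hx]
      exact Perm.mem_support.1 hx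
    rw [orbN, Finset.mem_filter, ← h4]
    exact ⟨orb_mem_orbs σ x, by rw [h4, h3]; rfl⟩
  · intro c hc d hd h
    rw [Finset.mem_filter, Perm.mem_cycleFactorsFinset_iff] at hc hd
    ext x
    by_cases hx : x ∈ c.support
    · rw [hc.1.2 x hx, hd.1.2 x (h ▸ hx)]
    · have hx' : x ∉ d.support := h ▸ hx
      rw [Perm.notMem_support.1 hx, Perm.notMem_support.1 hx']
  · intro O hO
    rw [orbN, Finset.mem_filter] at hO
    obtain ⟨x, hx⟩ := orbs_nonempty hO.1
    have h1 := eq_orb_of_mem hO.1 hx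
    have h2 : σ x ≠ x := by
      intro h2
      rw [orb_eq_singleton h2] at h1
      rw [h1, Finset.card_singleton] at hO
      omega
    refine ⟨σ.cycleOf x, ?_, ?_⟩
    · rw [Finset.mem_filter, Perm.cycleOf_mem_cycleFactorsFinset_iff, Function.comp_apply,
        ← orb_eq_support h2, ← h1]
      exact ⟨Perm.mem_support.2 h2, hO.2.symm⟩
    · rw [← orb_eq_support h2, h1]

theorem stableCount_eq (σ : Perm α) (k : ℕ) : stableCount σ k =
    ((orbs σ).powerset.filter fun S => ∑ O ∈ S, O.card ≤ k).card := by
  rw [stableCount, ← Finset.filter_filter, Finset.card_filter, Finset.card_filter,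
    sum_inv_eq_sum_orbs σ fun A => if A.card ≤ k then 1 else 0]
  refine Finset.sum_congr rfl fun S hS => ?_
  rw [card_biUnion_orbs (Finset.mem_powerset.1 hS)]

theorem stableCount_le (σ : Perm α) (k r : ℕ) (hr : 0 < r) :
    stableCount σ k ≤ 2 ^ ((orbs σ).filter fun O => O.card < r).card *
      ∑ i ∈ Finset.range (k / r + 1), (Fintype.card α / r).choose i := by
  set small := (orbs σ).filter fun O => O.card < r
  set big := (orbs σ).filter fun O => ¬ O.card < r with hbig
  have h1 : stableCount σ k ≤
      (small.powerset ×ˢ (big.powerset.filter fun T => T.card ≤ k / r)).card := by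
    rw [stableCount_eq]
    refine Finset.card_le_card_of_injOn (fun S => (S.filter (fun O => O.card < r),
      S.filter (fun O => ¬ O.card < r))) ?_ ?_
    · intro S hS
      simp only [Finset.coe_filter, Finset.mem_powerset, Set.mem_ofPred_eq] at hS
      simp only [Finset.coe_product, Set.mem_prod, Finset.mem_coe, Finset.mem_powerset,
        Finset.mem_filter]
      refine ⟨Finset.filter_subset_filter _ hS.1, Finset.filter_subset_filter _ hS.1, ?_⟩
      rw [Nat.le_div_iff_mul_le hr]
      refine le_trans ?_ hS.2
      refine le_trans ?_ (Finset.sum_le_sum_of_subset (Finset.filter_subset (fun O => ¬ O.card < r) S))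
      rw [← smul_eq_mul]
      exact Finset.card_nsmul_le_sum _ _ _ fun O hO => not_lt.1 (Finset.mem_filter.1 hO).2
    · intro S _ T _ h
      rw [← Finset.filter_union_filter_not_eq (fun O : Finset α => O.card < r) S,
        ← Finset.filter_union_filter_not_eq (fun O : Finset α => O.card < r) T]
      simp only [Prod.mk.injEq] at h
      rw [h.1, h.2]
  have h2 : big.card ≤ Fintype.card α / r := by
    rw [Nat.le_div_iff_mul_le hr, ← sum_card_orbs σ]
    refine le_trans ?_ (Finset.sum_le_sum_of_subset (Finset.filter_subset (fun O => ¬ O.card < r) _))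
    rw [← smul_eq_mul]
    exact Finset.card_nsmul_le_sum _ _ _ fun O hO => not_lt.1 (Finset.mem_filter.1 hO).2
  refine h1.trans ?_
  rw [Finset.card_product, Finset.card_powerset]
  refine Nat.mul_le_mul_left _ ?_
  rw [Finset.card_filter, Finset.sum_powerset_apply_card (fun i => if i ≤ k / r then 1 else 0)]
  calc _ = ∑ i ∈ Finset.range (big.card + 1), if i ≤ k / r then big.card.choose i else 0 :=
        Finset.sum_congr rfl fun i _ => by simp
    _ ≤ ∑ i ∈ Finset.range (k / r + 1), big.card.choose i := sum_range_ite_le _ _ _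
    _ ≤ _ := Finset.sum_le_sum fun i _ => Nat.choose_le_choose i h2

/-- Comparison of the number of small stable sets with a binomial coefficient. -/
theorem stableCount_mul_le (σ : Perm α) {k r : ℕ} (hr : 2 ≤ r) (hk : 8 * k ≤ Fintype.card α) :
    stableCount σ k * (Fintype.card α - Fintype.card α / r).choose (k - k / r) ≤
      2 ^ (((orbs σ).filter fun O => O.card < r).card + 1) * (Fintype.card α).choose k := by
  set n := Fintype.card α
  have h1 : 3 * (k / r) ≤ n / r + 1 := by
    have : 3 * (k / r) ≤ n / r := by
      rw [Nat.le_div_iff_mul_le (by omega)]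
      have := Nat.div_mul_le_self k r
      calc 3 * (k / r) * r = 3 * (k / r * r) := by ring
        _ ≤ 3 * k := by omega
        _ ≤ n := by omega
    omega
  have h2 := stableCount_le σ k r (by omega)
  have h3 := sum_choose_le h1
  have hle : n / r ≤ n := Nat.div_le_self _ _
  have hle' : k / r ≤ k := Nat.div_le_self _ _
  have h4 : (n / r).choose (k / r) * (n - n / r).choose (k - k / r) ≤ n.choose k := by
    conv_rhs => rw [← Nat.add_sub_cancel' hle, Nat.add_choose_eq]
    exact Finset.single_le_sum (f := fun ij : ℕ × ℕ => (n / r).choose ij.1 * (n - n / r).choose ij.2)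
      (a := (k / r, k - k / r)) (fun _ _ => Nat.zero_le _) (by simp [Nat.add_sub_cancel' hle'])
  calc _ ≤ (2 ^ ((orbs σ).filter fun O => O.card < r).card * (2 * (n / r).choose (k / r))) *
        (n - n / r).choose (k - k / r) := by
        refine Nat.mul_le_mul_right _ (h2.trans (Nat.mul_le_mul_left _ h3))
    _ = 2 ^ (((orbs σ).filter fun O => O.card < r).card + 1) *
        ((n / r).choose (k / r) * (n - n / r).choose (k - k / r)) := by ring
    _ ≤ _ := Nat.mul_le_mul_left _ h4

/-- A bound for characters of small level at permutations with few small orbits. -/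
theorem IsIrr.abs_mul_choose_le {χ : Perm α → ℝ} (h : IsIrr χ) {k r : ℕ} (hr : 2 ≤ r)
    (hk : 8 * k ≤ Fintype.card α) (h1 : LevGe k χ) (h2 : ¬ LevGe (k + 1) χ) (σ : Perm α) :
    |χ σ| * (Fintype.card α - Fintype.card α / r).choose (k - k / r) ≤
      2 ^ (((orbs σ).filter fun O => O.card < r).card + 2) * χ 1 := by
  obtain ⟨u, hu, hb, hd⟩ := h.exists_bound hk h1 h2
  have h3 : ((stableCount σ k * (Fintype.card α - Fintype.card α / r).choose (k - k / r) : ℕ) : ℝ) ≤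
      ((2 ^ (((orbs σ).filter fun O => O.card < r).card + 1) * (Fintype.card α).choose k : ℕ) : ℝ) := by
    exact_mod_cast stableCount_mul_le σ hr hk
  push_cast at h3
  set c := (((orbs σ).filter fun O => O.card < r).card)
  calc |χ σ| * ((Fintype.card α - Fintype.card α / r).choose (k - k / r) : ℝ)
      ≤ (u * stableCount σ k) * ((Fintype.card α - Fintype.card α / r).choose (k - k / r) : ℝ) := by
        gcongr; exact hb σ
    _ = u * (stableCount σ k * (Fintype.card α - Fintype.card α / r).choose (k - k / r) : ℝ) := by ring
    _ ≤ u * (2 ^ (c + 1) * (Fintype.card α).choose k) := by gcongr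
    _ = 2 ^ (c + 1) * (u * (Fintype.card α).choose k) := by ring
    _ ≤ 2 ^ (c + 1) * (2 * χ 1) := by gcongr
    _ = _ := by ring

end Orbits

section Young

open Equiv

set_option linter.unusedSectionVars false

variable {α : Type} [Fintype α] [DecidableEq α]

/-- The dimension of the invariants of the permutations supported in `D`, in a character and in its
twist by the sign. -/
noncomputable def invDim (D : Finset α) (χ : Perm α → ℝ) : ℝ :=
  (∑ ρ ∈ permsOn D, χ ρ + ∑ ρ ∈ permsOn D, tw χ ρ) / D.card.factorial

theorem IsChar.invDim_nonneg {χ : Perm α → ℝ} (h : IsChar χ) (D : Finset α) : 0 ≤ invDim D χ :=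
  div_nonneg (add_nonneg (h.sum_permsOn_nonneg D) (h.tw.sum_permsOn_nonneg D)) (by positivity)

theorem IsChar.sum_permsOn_ge {χ : Perm α → ℝ} (h : IsChar χ) {D D' : Finset α}
    (hD : D.card ≤ D'.card) (h0 : ∑ ρ ∈ permsOn D', χ ρ ≠ 0) :
    (D.card.factorial : ℝ) ≤ ∑ ρ ∈ permsOn D, χ ρ := by
  obtain ⟨s, hs, he⟩ := (h.res D').exists_multiset
  obtain ⟨D₁, hD₁, hc⟩ := Finset.exists_subset_card_eq (s := (Finset.univ : Finset {x // x ∈ D'}))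
    (n := D.card) (by simpa using hD)
  have h1 : ∑ ρ ∈ permsOn D, χ ρ = ∑ ρ ∈ permsOn D₁, _root_.res D' χ ρ := by
    rw [sum_permsOn_res]
    obtain ⟨g, -, hg⟩ := exists_perm_map_eq (Finset.subset_univ D)
      (Finset.subset_univ (D₁.map (Function.Embedding.subtype _))) (by rw [Finset.card_map, hc])
    rw [← hg, sum_permsOn_map]
    exact Finset.sum_congr rfl fun ρ _ => (h.conj_eq _ _).symm
  obtain ⟨ψ, hψ, hψ0⟩ : ∃ ψ ∈ s, ∑ ρ ∈ permsOn Finset.univ, ψ ρ ≠ 0 := by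
    by_contra hcon
    push Not at hcon
    apply h0
    rw [sum_permsOn, ← permsOn_univ]
    have : ∑ ρ ∈ permsOn Finset.univ, _root_.res D' χ ρ = 0 := by
      rw [← he, sum_permsOn_multiset_sum]
      exact Multiset.sum_eq_zero fun x hx => by
        obtain ⟨ψ, hψ, rfl⟩ := Multiset.mem_map.1 hx
        exact hcon ψ hψ
    exact this
  have h2 : ψ = fun _ => 1 := by
    by_contra hne
    exact hψ0 ((levGe_one_iff (hs ψ hψ)).2 hne _ (by simp))
  rw [h1, ← he, sum_permsOn_multiset_sum]
  calc (D.card.factorial : ℝ) = ∑ ρ ∈ permsOn D₁, ψ ρ := by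
        rw [h2, Finset.sum_const, card_permsOn, hc, nsmul_one]
    _ ≤ _ := by
        refine Multiset.single_le_sum ?_ _ (Multiset.mem_map_of_mem _ hψ)
        intro x hx
        obtain ⟨φ, hφ, rfl⟩ := Multiset.mem_map.1 hx
        exact (hs φ hφ).isChar.sum_permsOn_nonneg _

/-- An irreducible character of small level has small degree. -/
theorem IsIrr.one_le_pow_of_not_LL {χ : Perm α → ℝ} (h : IsIrr χ) {j : ℕ} (hL : ¬ LL (j + 1) χ)
    {D : Finset α} (hD : D.card + j = Fintype.card α) :
    χ 1 ≤ (Fintype.card α) ^ j * invDim D χ := by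
  have key : ∀ ψ : Perm α → ℝ, IsIrr ψ → ¬ LevGe (j + 1) ψ →
      ψ 1 ≤ (Fintype.card α) ^ j ∧ (D.card.factorial : ℝ) ≤ ∑ ρ ∈ permsOn D, ψ ρ := by
    intro ψ hψ hl
    simp only [LevGe, not_forall] at hl
    obtain ⟨D', hc, h0⟩ := hl
    have h1 := hψ.isChar.sum_permsOn_ge (D := D) (by omega) h0
    refine ⟨?_, h1⟩
    have hp : (0 : ℝ) < D.card.factorial := by positivity
    have h2 := hψ.one_le_index (Perm.ofSubtype (p := (· ∈ D))) Perm.ofSubtype_injective (by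
      rw [← sum_permsOn D ψ]
      linarith)
    rw [Fintype.card_perm, Fintype.card_perm, Fintype.card_coe] at h2
    have h3 : (Fintype.card α).factorial ≤ D.card.factorial * (Fintype.card α) ^ j := by
      have h4 := Nat.factorial_mul_descFactorial (n := Fintype.card α) (k := j) (by omega)
      rw [show Fintype.card α - j = D.card by omega] at h4
      rw [← h4]
      exact Nat.mul_le_mul_left _ (Nat.descFactorial_le_pow _ _)
    have h3' : ((Fintype.card α).factorial : ℝ) ≤ D.card.factorial * (Fintype.card α) ^ j := by
      exact_mod_cast h3
    nlinarith
  have hp : (0 : ℝ) < D.card.factorial := by positivity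
  have hinv : ∀ ψ : Perm α → ℝ, IsIrr ψ → ¬ LevGe (j + 1) ψ → 1 ≤ invDim D ψ ∧
      1 ≤ invDim D (_root_.tw ψ) := by
    intro ψ hψ hl
    have h1 := (key ψ hψ hl).2
    have h2 := hψ.isChar.tw.sum_permsOn_nonneg D
    rw [invDim, invDim, tw_tw, le_div_iff₀ hp, le_div_iff₀ hp]
    constructor <;> linarith
  have hpow : (0 : ℝ) ≤ (Fintype.card α : ℝ) ^ j := by positivity
  rw [LL, not_and_or] at hL
  rcases hL with hl | hl
  · have h1 := (key χ h hl).1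
    have h2 := (hinv χ h hl).1
    nlinarith
  · have h1 := (key (_root_.tw χ) h.tw hl).1
    have h2 := (hinv (_root_.tw χ) h.tw hl).2
    rw [tw_tw] at h2
    rw [tw_one] at h1
    nlinarith

theorem invDim_add (D : Finset α) (χ ψ : Perm α → ℝ) :
    invDim D (χ + ψ) = invDim D χ + invDim D ψ := by
  simp only [invDim, tw, Pi.add_apply, mul_add, Finset.sum_add_distrib]
  ring

theorem invDim_mul (D : Finset α) (c : ℝ) (χ : Perm α → ℝ) :
    invDim D (fun σ => c * χ σ) = c * invDim D χ := by
  simp only [invDim, tw, mul_left_comm _ c, ← Finset.mul_sum]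
  ring

theorem invDim_res (B : Finset α) (D : Finset {x // x ∈ B}) (χ : Perm α → ℝ) :
    invDim D (res B χ) = invDim (D.map (Function.Embedding.subtype _)) χ := by
  rw [invDim, invDim, ← res_tw, sum_permsOn_res, sum_permsOn_res, Finset.card_map]

/-- The bound for an irreducible character of a product of two symmetric groups. -/
theorem IsIrr.abs_le_prod {A B : Type} [Fintype A] [DecidableEq A] [Fintype B] [DecidableEq B]
    {p q E E' : ℝ} (hp : 0 ≤ p) (hp1 : p ≤ 1) (hE : 0 ≤ E) (hE' : 0 ≤ E')
    {D : Finset A} {D' : Finset B} {x : Perm A} {y : Perm B}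
    (h1 : ∀ α : Perm A → ℝ, IsIrr α → |α x| ≤ p * α 1 + E * invDim D α)
    (h2 : ∀ β : Perm B → ℝ, IsIrr β → |β y| ≤ q * β 1 + E' * invDim D' β)
    {Z : Perm A × Perm B → ℝ} (hZ : IsIrr Z) :
    |Z (x, y)| ≤ p * q * Z 1 + E * invDim D (fun ρ => Z (ρ, 1)) +
      E' * invDim D' (fun ρ => Z (1, ρ)) := by
  have hz := hZ.one_pos
  obtain ⟨α, hα, hα'⟩ := hZ.exists_fst
  obtain ⟨β, hβ, hβ'⟩ := hZ.exists_snd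
  have ha := hα.one_pos
  have hb := hβ.one_pos
  have e1 : (fun ρ => Z (ρ, 1)) = fun ρ => (Z 1 / α 1) * α ρ := by
    funext ρ
    rw [hα' ρ]
    field_simp
  have e2 : (fun ρ => Z (1, ρ)) = fun ρ => (Z 1 / β 1) * β ρ := by
    funext ρ
    rw [hβ' ρ]
    field_simp
  have hX : |Z (x, 1)| ≤ p * Z 1 + E * invDim D (fun ρ => Z (ρ, 1)) := by
    have := congrFun e1 x
    rw [e1, invDim_mul, this, abs_mul, abs_of_pos (by positivity : 0 < Z 1 / α 1)]
    calc _ ≤ Z 1 / α 1 * (p * α 1 + E * invDim D α) :=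
          mul_le_mul_of_nonneg_left (h1 α hα) (by positivity)
      _ = _ := by field_simp
  have hY : |Z (1, y)| ≤ q * Z 1 + E' * invDim D' (fun ρ => Z (1, ρ)) := by
    have := congrFun e2 y
    rw [e2, invDim_mul, this, abs_mul, abs_of_pos (by positivity : 0 < Z 1 / β 1)]
    calc _ ≤ Z 1 / β 1 * (q * β 1 + E' * invDim D' β) :=
          mul_le_mul_of_nonneg_left (h2 β hβ) (by positivity)
      _ = _ := by field_simp
  have hI : 0 ≤ invDim D (fun ρ => Z (ρ, 1)) := by
    rw [e1, invDim_mul]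
    exact mul_nonneg (by positivity) (hα.isChar.invDim_nonneg D)
  have hI' : 0 ≤ invDim D' (fun ρ => Z (1, ρ)) := by
    rw [e2, invDim_mul]
    exact mul_nonneg (by positivity) (hβ.isChar.invDim_nonneg D')
  have hY1 : |Z (1, y)| ≤ Z 1 := hZ.isChar.abs_le _
  rw [hZ.prod_eq, abs_div, abs_mul, abs_of_pos (by linarith : 0 < Z 1), div_le_iff₀ (by linarith)]
  set X := |Z (x, 1)|
  set Y := |Z (1, y)| with hYd
  set I := invDim D (fun ρ => Z (ρ, 1))
  set I' := invDim D' (fun ρ => Z (1, ρ))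
  have hY0 : 0 ≤ Y := abs_nonneg _
  have hEI : 0 ≤ E * I := mul_nonneg hE hI
  have hEI' : 0 ≤ E' * I' := mul_nonneg hE' hI'
  calc X * Y ≤ (p * Z 1 + E * I) * Y := mul_le_mul_of_nonneg_right hX hY0
    _ = p * Z 1 * Y + E * I * Y := by ring
    _ ≤ p * Z 1 * (q * Z 1 + E' * I') + E * I * Z 1 :=
        add_le_add (mul_le_mul_of_nonneg_left hY (by positivity))
          (mul_le_mul_of_nonneg_left hY1 hEI)
    _ = (p * q * Z 1 + E * I + p * (E' * I')) * Z 1 := by ring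
    _ ≤ _ := by
        refine mul_le_mul_of_nonneg_right ?_ (by linarith)
        have := mul_le_mul_of_nonneg_right hp1 hEI'
        linarith

/-- Splitting a character estimate along a stable set. -/
theorem IsChar.abs_le_of_split {χ : Perm α → ℝ} (h : IsChar χ) {A : Finset α}
    {p q E E' : ℝ} (hp : 0 ≤ p) (hp1 : p ≤ 1) (hE : 0 ≤ E) (hE' : 0 ≤ E')
    {D : Finset {x // x ∈ A}} {D' : Finset {x // x ∈ Aᶜ}} {x : Perm {x // x ∈ A}}
    {y : Perm {x // x ∈ Aᶜ}}
    (h1 : ∀ φ : Perm {x // x ∈ A} → ℝ, IsIrr φ → |φ x| ≤ p * φ 1 + E * invDim D φ)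
    (h2 : ∀ φ : Perm {x // x ∈ Aᶜ} → ℝ, IsIrr φ → |φ y| ≤ q * φ 1 + E' * invDim D' φ) :
    |χ (Perm.ofSubtype x * Perm.ofSubtype y)| ≤ p * q * χ 1 +
      E * invDim (D.map (Function.Embedding.subtype _)) χ +
      E' * invDim (D'.map (Function.Embedding.subtype _)) χ := by
  have hd : Disjoint A Aᶜ := disjoint_compl_right
  obtain ⟨s, hs, he⟩ := (h.comp (blockHom hd)).exists_multiset
  have key : |s.sum (x, y)| ≤ p * q * s.sum 1 + E * invDim D (fun ρ => s.sum (ρ, 1)) +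
      E' * invDim D' (fun ρ => s.sum (1, ρ)) := by
    clear he
    induction s using Multiset.induction with
    | empty => simp [invDim, _root_.tw]
    | cons Z s ih =>
      have i1 := ih fun ψ hψ => hs ψ (Multiset.mem_cons_of_mem hψ)
      have i2 := (hs Z (Multiset.mem_cons_self Z s)).abs_le_prod hp hp1 hE hE' h1 h2
      have e1 := invDim_add D (fun ρ => Z (ρ, 1)) fun ρ => s.sum (ρ, 1)
      have e2 := invDim_add D' (fun ρ => Z (1, ρ)) fun ρ => s.sum (1, ρ)
      simp only [Multiset.sum_cons, Pi.add_apply]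
      have e3 := abs_add_le (Z (x, y)) (s.sum (x, y))
      change invDim D (fun ρ => Z (ρ, 1) + s.sum (ρ, 1)) = _ at e1
      change invDim D' (fun ρ => Z (1, ρ) + s.sum (1, ρ)) = _ at e2
      rw [e1, e2]
      linarith
  rw [he] at key
  simp only [blockHom_apply, map_one, mul_one, one_mul] at key
  rw [← invDim_res, ← invDim_res]
  exact key

theorem IsIrr.sq_le_centralizer {G : Type} [Group G] [Fintype G] [DecidableEq G] [Ambivalent G]
    {χ : G → ℝ} (h : IsIrr χ) (x : G) {z : ℕ}
    (hz : (Finset.univ.filter fun k : G => k * x = x * k).card ≤ z) : χ x ^ 2 ≤ z := by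
  have h1 : ∑ k : G, χ (k * x * k⁻¹) ^ 2 = Fintype.card G * χ x ^ 2 := by
    simp only [h.isChar.conj_eq, Finset.sum_const, Finset.card_univ, nsmul_eq_mul]
  have h2 : ∑ k : G, χ (k * x * k⁻¹) ^ 2 ≤ ∑ g : G, (z : ℝ) * χ g ^ 2 := by
    rw [← Finset.sum_fiberwise Finset.univ (fun k : G => k * x * k⁻¹)]
    refine Finset.sum_le_sum fun g _ => ?_
    rw [Finset.sum_congr rfl fun k hk => by rw [(Finset.mem_filter.1 hk).2], Finset.sum_const,
      nsmul_eq_mul]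
    refine mul_le_mul_of_nonneg_right ?_ (sq_nonneg _)
    refine Nat.cast_le.2 (le_trans ?_ hz)
    rcases Finset.eq_empty_or_nonempty (Finset.univ.filter fun k : G => k * x * k⁻¹ = g) with
      he | ⟨k₀, hk₀⟩
    · rw [he]; simp
    · refine Finset.card_le_card_of_injOn (fun k => k₀⁻¹ * k) ?_ fun _ _ _ _ e => mul_left_cancel e
      intro k hk
      simp only [Finset.coe_filter, Finset.mem_filter, Finset.mem_univ, true_and,
        Set.mem_ofPred_eq] at *
      have : k * x * k⁻¹ = k₀ * x * k₀⁻¹ := hk.trans hk₀.symm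
      rw [mul_inv_eq_iff_eq_mul] at this
      rw [mul_assoc, this]
      group
  rw [h1, ← Finset.mul_sum] at h2
  have h3 := h.norm_eq
  simp only [← pow_two] at h3
  rw [h3] at h2
  have h4 : (0 : ℝ) < Fintype.card G := by exact_mod_cast Fintype.card_pos
  nlinarith

/-- A transitive cyclic permutation has a small centralizer. -/
theorem card_centralizer_le {σ : Perm α} {x : α} (hx : ∀ y, σ.SameCycle x y) :
    (Finset.univ.filter fun k : Perm α => k * σ = σ * k).card ≤ Fintype.card α := by
  rw [← Finset.card_univ]
  refine Finset.card_le_card_of_injOn (fun k => k x) (fun _ _ => Finset.mem_coe.2 (Finset.mem_univ _)) ?_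
  intro k hk l hl e
  simp only [Finset.coe_filter, Finset.mem_univ, true_and, Set.mem_ofPred_eq] at hk hl e
  ext y
  obtain ⟨i, rfl⟩ := hx y
  have e1 : k * σ ^ i = σ ^ i * k := (Commute.zpow_right (show Commute k σ from hk) i).eq
  have e2 : l * σ ^ i = σ ^ i * l := (Commute.zpow_right (show Commute l σ from hl) i).eq
  have := congrFun (congrArg DFunLike.coe e1) x
  have h2 := congrFun (congrArg DFunLike.coe e2) x
  simp only [Perm.mul_apply] at this h2
  rw [this, h2, e]

theorem exists_inv_mid {σ : Perm α} (hn : 0 < Fintype.card α)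
    (h : ∀ x, 2 * (orb σ x).card ≤ Fintype.card α) :
    ∃ A : Finset α, IsInv σ A ∧ Fintype.card α ≤ 4 * A.card ∧ 4 * A.card ≤ 3 * Fintype.card α := by
  obtain ⟨A, hA, hmax⟩ := Finset.exists_max_image
    (Finset.univ.filter fun A : Finset α => IsInv σ A ∧ 2 * A.card ≤ Fintype.card α) Finset.card
    ⟨∅, Finset.mem_filter.2 ⟨Finset.mem_univ _, fun x hx => absurd hx (Finset.notMem_empty x), by simp⟩⟩
  simp only [Finset.mem_filter, Finset.mem_univ, true_and] at hA hmax
  by_cases h4 : Fintype.card α ≤ 4 * A.card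
  · exact ⟨A, hA.1, h4, by omega⟩
  obtain ⟨x, hx⟩ : ∃ x, x ∉ A := by
    by_contra hc
    push Not at hc
    rw [Finset.eq_univ_of_forall hc, Finset.card_univ] at h4
    omega
  have hd : Disjoint A (orb σ x) := by
    rw [Finset.disjoint_right]
    intro y hy hyA
    rw [mem_orb] at hy
    exact hx (orb_subset hA.1 hyA (mem_orb.2 hy.symm))
  have hc : (A ∪ orb σ x).card = A.card + (orb σ x).card := Finset.card_union_of_disjoint hd
  have hI := hA.1.union (inv_orb σ x)
  have hpos : 0 < (orb σ x).card := Finset.card_pos.2 ⟨x, self_mem_orb σ x⟩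
  have hx2 := h x
  by_cases h2 : 2 * (A ∪ orb σ x).card ≤ Fintype.card α
  · have := hmax _ ⟨hI, h2⟩
    omega
  · exact ⟨_, hI, by omega, by omega⟩

end Young

section Decay

open Equiv

set_option linter.unusedSectionVars false

/-- Geometric decay beats polynomial growth. -/
theorem exists_pow_mul_pow_div_le {r : ℝ} (h0 : 0 ≤ r) (h1 : r < 1) (d : ℕ) {m : ℕ} (hm : 0 < m)
    {ε : ℝ} (hε : 0 < ε) : ∃ N : ℕ, ∀ n : ℕ, N ≤ n → (n : ℝ) ^ d * r ^ (n / m) ≤ ε := by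
  have h2 := tendsto_pow_const_mul_const_pow_of_abs_lt_one d (r := r) (by rwa [abs_of_nonneg h0])
  have h3 : 0 < ε / (2 * m : ℝ) ^ d := by positivity
  obtain ⟨N, hN⟩ := Filter.eventually_atTop.1 (h2.eventually_le_const h3)
  refine ⟨m * (N + 1), fun n hn => ?_⟩
  have h4 : N + 1 ≤ n / m := (Nat.le_div_iff_mul_le hm).2 (by rwa [mul_comm])
  have h5 := hN (n / m) (by omega)
  rw [le_div_iff₀ (by positivity)] at h5
  have h6 : n ≤ 2 * m * (n / m) := by
    have := Nat.div_add_mod n m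
    have := Nat.mod_lt n hm
    nlinarith
  have h6' : (n : ℝ) ≤ 2 * m * ((n / m : ℕ) : ℝ) := by exact_mod_cast h6
  calc (n : ℝ) ^ d * r ^ (n / m) ≤ (2 * m * ((n / m : ℕ) : ℝ)) ^ d * r ^ (n / m) := by gcongr
    _ = ((n / m : ℕ) : ℝ) ^ d * r ^ (n / m) * (2 * m : ℝ) ^ d := by rw [mul_pow]; ring
    _ ≤ ε := h5

variable {α : Type} [Fintype α] [DecidableEq α]

theorem IsChar.invDim_le {χ : Perm α → ℝ} (h : IsChar χ) {k : ℕ} (hL : LL k χ) (hk : 1 ≤ k)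
    {D : Finset α} (hD : 8 * k ≤ D.card) (hD' : 5 * (Dᶜ.card + k) ≤ 4 * Fintype.card α) :
    invDim D χ ≤ 4 * (k + 1) * (4 / 5) ^ k * χ 1 := by
  have key : ∀ ψ : Perm α → ℝ, IsChar ψ → LevGe k ψ →
      ∑ ρ ∈ permsOn D, ψ ρ ≤ D.card.factorial * (2 * (k + 1) * (4 / 5) ^ k * ψ 1) := by
    intro ψ hψ hl
    refine (LevGe.sum_permsOn_le hk hD _ α ψ D hψ hl rfl rfl).trans ?_
    have h1 : (D.card + Dᶜ.card : ℝ) = Fintype.card α := by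
      exact_mod_cast Finset.card_add_card_compl D
    have h2 : (5 * (Dᶜ.card + k) : ℝ) ≤ 4 * Fintype.card α := by exact_mod_cast hD'
    have h3 : (0 : ℝ) < Fintype.card α := by
      have : 1 ≤ Fintype.card α := by
        have := Finset.card_le_univ D
        omega
      exact_mod_cast this
    have h4 := hψ.one_nonneg
    rw [h1]
    have h5 : (Dᶜ.card + k : ℝ) / Fintype.card α ≤ 4 / 5 := by
      rw [div_le_div_iff₀ h3 (by norm_num)]
      linarith
    gcongr
  have h1 := key χ h hL.1
  have h2 := key _ h.tw hL.2
  rw [_root_.tw_one] at h2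
  rw [invDim, div_le_iff₀ (by positivity)]
  linarith

/-- The bound of the degree of a character in terms of the dimension of invariants, on a large
stable set. -/
theorem exists_card_add_six {A : Finset α} {k : ℕ} (hA : Fintype.card α ≤ 4 * A.card)
    (hn : 240 ≤ Fintype.card α) (hk : 40 * k ≤ Fintype.card α) :
    ∃ D : Finset {x // x ∈ A}, D.card + 6 = Fintype.card {x // x ∈ A} ∧
      8 * k ≤ (D.map (Function.Embedding.subtype _)).card ∧
      5 * ((D.map (Function.Embedding.subtype _))ᶜ.card + k) ≤ 4 * Fintype.card α := by
  obtain ⟨D, -, hD⟩ := Finset.exists_subset_card_eq (s := (Finset.univ : Finset {x // x ∈ A}))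
    (n := A.card - 6) (by simp)
  refine ⟨D, ?_, ?_, ?_⟩
  · rw [hD, Fintype.card_coe]; omega
  · rw [Finset.card_map]; omega
  · have := Finset.card_add_card_compl (D.map (Function.Embedding.subtype _))
    rw [Finset.card_map] at this
    omega

theorem IsInv.exists_eq_mul {σ : Perm α} {A : Finset α} (hA : IsInv σ A) :
    ∃ (x : Perm {x // x ∈ A}) (y : Perm {x // x ∈ Aᶜ}), σ = Perm.ofSubtype x * Perm.ofSubtype y ∧
      (∀ i, (x i : α) = σ i) ∧ (∀ i, (y i : α) = σ i) := by
  obtain ⟨x, hx⟩ := exists_ofSubtype_eq (restr_mem σ A)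
  obtain ⟨y, hy⟩ := exists_ofSubtype_eq (restr_mem σ Aᶜ)
  refine ⟨x, y, by rw [hx, hy]; exact hA.eq_mul, fun i => ?_, fun i => ?_⟩
  · rw [← Perm.ofSubtype_apply_coe, hx, restr_apply hA, if_pos i.2]
  · rw [← Perm.ofSubtype_apply_coe, hy, restr_apply hA.compl, if_pos i.2]

theorem IsIrr.abs_le_add_invDim {χ : Perm α → ℝ} (h : IsIrr χ) {p : ℝ} (hp : 0 ≤ p) {n : ℕ}
    (hn : Fintype.card α ≤ n) {D : Finset α} (hD : D.card + 6 = Fintype.card α) {σ : Perm α}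
    (hX : LL 7 χ → |χ σ| ≤ p * χ 1) : |χ σ| ≤ p * χ 1 + (n : ℝ) ^ 6 * invDim D χ := by
  have h1 := h.one_pos
  have h2 := h.isChar.invDim_nonneg D
  have h3 : (Fintype.card α : ℝ) ≤ n := by exact_mod_cast hn
  by_cases hL : LL 7 χ
  · have := hX hL
    have : 0 ≤ (n : ℝ) ^ 6 * invDim D χ := by positivity
    linarith
  · have h4 := h.one_le_pow_of_not_LL hL hD
    have h5 := h.isChar.abs_le σ
    have h6 : (Fintype.card α : ℝ) ^ 6 * invDim D χ ≤ (n : ℝ) ^ 6 * invDim D χ := by gcongr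
    nlinarith

theorem exists_pow_five_le : ∃ N : ℕ, ∀ (α : Type) [Fintype α] [DecidableEq α] (χ : Perm α → ℝ),
    N ≤ Fintype.card α → IsIrr χ → LL 7 χ → (Fintype.card α : ℝ) ^ 5 ≤ χ 1 := by
  obtain ⟨N, hN⟩ := exists_pow_mul_pow_div_le (r := 1 / 2) (by norm_num) (by norm_num) 5
    (m := 16) (by norm_num) (ε := 1 / 2) (by norm_num)
  refine ⟨max N 1200, fun α _ _ χ hn h hL => ?_⟩
  have hn1 := le_trans (le_max_left _ _) hn
  have hn2 := le_trans (le_max_right _ _) hn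
  have hn2' : (1200 : ℝ) ≤ Fintype.card α := by exact_mod_cast hn2
  rcases h.choose_or_two_pow_le hL (by omega) with h1 | h1
  · have h2 := Nat.pow_le_choose 7 (Fintype.card α) (α := ℝ)
    have h3 : ((Fintype.card α + 1 - 7 : ℕ) : ℝ) = Fintype.card α - 6 := by
      rw [Nat.cast_sub (by omega)]; push_cast; ring
    rw [h3] at h2
    generalize (Fintype.card α : ℝ) = x at *
    have h4 : (x / 2) ^ 7 ≤ (x - 6) ^ 7 := by gcongr; linarith
    have h5 : ((Nat.factorial 7 : ℕ) : ℝ) = 5040 := by norm_num [Nat.factorial]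
    rw [h5, div_le_iff₀ (by norm_num)] at h2
    have h6 : 2 * 645120 * x ^ 5 ≤ x ^ 7 := by
      have : (0 : ℝ) ≤ x ^ 5 := by positivity
      have h7 : (2 * 645120 : ℝ) ≤ x ^ 2 := by nlinarith
      calc _ ≤ x ^ 2 * x ^ 5 := by gcongr
        _ = _ := by ring
    have h7 : (x / 2) ^ 7 = x ^ 7 / 128 := by ring
    rw [h7] at h4
    linarith
  · have h2 := hN _ hn1
    rw [one_div, inv_pow, ← div_eq_mul_inv, div_le_iff₀ (by positivity)] at h2
    linarith

theorem add_pow_gap {x y : ℝ} (hx : 0 < x) (hy : 0 ≤ y) :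
    ((x + y) ^ 4)⁻¹ + (x ^ 4)⁻¹ * (y / (x + y)) ≤ (x ^ 4)⁻¹ := by
  have h1 : ((x + y) ^ 4)⁻¹ ≤ (x ^ 4)⁻¹ * (x / (x + y)) := by
    rw [← div_eq_inv_mul, div_div, inv_eq_one_div, div_le_div_iff₀ (by positivity) (by positivity)]
    have : x ^ 3 ≤ (x + y) ^ 3 := by gcongr; linarith
    nlinarith [mul_le_mul_of_nonneg_left this (by positivity : 0 ≤ x * (x + y))]
  have h2 : x / (x + y) + y / (x + y) = 1 := by rw [← add_div, div_self (by positivity)]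
  calc _ ≤ (x ^ 4)⁻¹ * (x / (x + y)) + (x ^ 4)⁻¹ * (y / (x + y)) := by linarith
    _ = _ := by rw [← mul_add, h2, mul_one]

end Decay

section DecayMain

open Equiv

set_option linter.unusedSectionVars false

variable {α : Type} [Fintype α] [DecidableEq α]

theorem IsIrr.abs_mul_pow_le {χ : Perm α → ℝ} (h : IsIrr χ) {k r j s : ℕ} (hr : 2 ≤ r)
    (hk : 8 * k ≤ Fintype.card α) (h1 : LevGe k χ) (h2 : ¬ LevGe (k + 1) χ) (hj : j ≤ k - k / r)
    (hjn : 4 * j ≤ Fintype.card α) {σ : Perm α}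
    (hs : ((orbs σ).filter fun O => O.card < r).card ≤ s) :
    |χ σ| * (Fintype.card α) ^ j ≤ 4 ^ j * j.factorial * 2 ^ (s + 2) * χ 1 := by
  have h3 := h.abs_mul_choose_le hr hk h1 h2 σ
  have h0 := h.one_pos
  set n := Fintype.card α
  have hdiv : n / r ≤ n / 2 := Nat.div_le_div_left hr (by norm_num)
  have hdk : k - k / r ≤ k := Nat.sub_le _ _
  have h4 : (n - n / r).choose j ≤ (n - n / r).choose (k - k / r) :=
    choose_mono_of_le hj (by omega)
  have h5 : (n : ℝ) ^ j ≤ 4 ^ j * j.factorial * (n - n / r).choose j := by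
    have h6 := Nat.pow_le_choose j (n - n / r) (α := ℝ)
    rw [div_le_iff₀ (by positivity)] at h6
    have h7 : (n : ℝ) ≤ 4 * ((n - n / r + 1 - j : ℕ) : ℝ) := by
      have : n ≤ 4 * (n - n / r + 1 - j) := by omega
      exact_mod_cast this
    calc (n : ℝ) ^ j ≤ (4 * ((n - n / r + 1 - j : ℕ) : ℝ)) ^ j := by gcongr
      _ = 4 ^ j * ((n - n / r + 1 - j : ℕ) : ℝ) ^ j := mul_pow _ _ _
      _ ≤ 4 ^ j * (((n - n / r).choose j : ℝ) * j.factorial) := by gcongr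
      _ = _ := by ring
  have h4' : ((n - n / r).choose j : ℝ) ≤ (n - n / r).choose (k - k / r) := by exact_mod_cast h4
  calc |χ σ| * (n : ℝ) ^ j ≤ |χ σ| * (4 ^ j * j.factorial * (n - n / r).choose (k - k / r)) := by
        refine mul_le_mul_of_nonneg_left (h5.trans ?_) (abs_nonneg _)
        gcongr
    _ = 4 ^ j * j.factorial * (|χ σ| * (n - n / r).choose (k - k / r)) := by ring
    _ ≤ 4 ^ j * j.factorial * (2 ^ (((orbs σ).filter fun O => O.card < r).card + 2) * χ 1) := by
        gcongr
    _ ≤ 4 ^ j * j.factorial * (2 ^ (s + 2) * χ 1) := by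
        gcongr
        norm_num
    _ = _ := by ring

theorem IsIrr.abs_le_of_large_orbit {χ : Perm α → ℝ} (h : IsIrr χ) {σ : Perm α} {x : α}
    (hx : ∀ y, σ.SameCycle x y) (hd : (Fintype.card α : ℝ) ^ 5 ≤ χ 1) :
    |χ σ| ≤ ((Fintype.card α : ℝ) ^ 4)⁻¹ * χ 1 := by
  have h1 := h.sq_le_centralizer σ (card_centralizer_le hx)
  have h2 : 1 ≤ Fintype.card α := Fintype.card_pos_iff.2 ⟨x⟩
  have h2' : (1 : ℝ) ≤ Fintype.card α := by exact_mod_cast h2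
  set n : ℝ := (Fintype.card α : ℝ)
  have h3 : |χ σ| ≤ n := by
    rw [← sq_abs] at h1
    have := abs_nonneg (χ σ)
    nlinarith
  rw [inv_mul_eq_div, le_div_iff₀ (by positivity)]
  calc |χ σ| * n ^ 4 ≤ n * n ^ 4 := by gcongr
    _ = n ^ 5 := by ring
    _ ≤ _ := hd

theorem decay_gap {γ a b n : ℝ} (hγ0 : 0 < γ) (hγ1 : γ ≤ 1 / 256) (hγn : 1 / (256 * n ^ 3) ≤ γ)
    (hn : 240 ≤ n) (hab : a + b = n) (ha : n ≤ 4 * a) (hb : n ≤ 4 * b)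
    (hG : 28561 / n ^ 4 ≤ ((1 + γ * n) ^ 4)⁻¹) :
    ((1 + γ * a) ^ 4)⁻¹ * ((1 + γ * b) ^ 4)⁻¹ + 1 / (2097152 * n ^ 10) ≤
      ((1 + γ * n) ^ 4)⁻¹ := by
  have hn0 : 0 < n := by linarith
  have ha0 : 0 < a := by linarith
  have hb0 : 0 < b := by linarith
  have hprod : (1 + γ * a) * (1 + γ * b) = 1 + γ * n + γ ^ 2 * (a * b) := by
    rw [← hab]; ring
  have hx : 0 < 1 + γ * n := by positivity
  have hab1 : n ^ 2 / 16 ≤ a * b := by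
    have : (n / 4) * (n / 4) ≤ a * b := by gcongr <;> linarith
    linarith
  have hab2 : a * b ≤ n ^ 2 := by rw [← hab]; nlinarith
  have hy : 0 ≤ γ ^ 2 * (a * b) := by positivity
  have h6 := add_pow_gap hx hy
  rw [← mul_inv, ← mul_pow, hprod]
  have hγ2 : γ ^ 2 ≤ 1 := pow_le_one₀ hγ0.le (by linarith)
  have h7 : γ ^ 2 / 32 ≤ γ ^ 2 * (a * b) / (1 + γ * n + γ ^ 2 * (a * b)) := by
    have h8 : 1 + γ * n + γ ^ 2 * (a * b) ≤ 2 * n ^ 2 := by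
      have : γ ^ 2 * (a * b) ≤ 1 * n ^ 2 := by gcongr
      nlinarith
    rw [div_le_div_iff₀ (by norm_num) (by positivity)]
    have : 0 ≤ γ ^ 2 := by positivity
    nlinarith
  have h9 : 1 / (2097152 * n ^ 10) ≤ ((1 + γ * n) ^ 4)⁻¹ *
      (γ ^ 2 * (a * b) / (1 + γ * n + γ ^ 2 * (a * b))) := by
    calc 1 / (2097152 * n ^ 10) =
          (1 / n ^ 4) * ((1 / (256 * n ^ 3)) ^ 2 / 32) := by field_simp; norm_num
      _ ≤ (28561 / n ^ 4) * (γ ^ 2 / 32) := by gcongr; norm_num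
      _ ≤ _ := by gcongr
  linarith

set_option maxHeartbeats 1000000 in
/-- Irreducible characters of large level decay polynomially at derangements. -/
theorem exists_decay : ∃ γ : ℝ, 0 < γ ∧ ∀ (n : ℕ) (α : Type) [Fintype α] [DecidableEq α]
    (σ : Perm α) (χ : Perm α → ℝ), Fintype.card α = n → 5 ≤ n → (∀ x, σ x ≠ x) → IsIrr χ →
      LL 7 χ → |χ σ| ≤ ((1 + γ * n) ^ 4)⁻¹ * χ 1 := by
  obtain ⟨N₁, hN₁⟩ := exists_pow_five_le
  obtain ⟨N₂, hN₂⟩ := exists_pow_mul_pow_div_le (r := 4 / 5) (by norm_num) (by norm_num) 17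
    (m := 40) (by norm_num) (ε := 1 / 16777216) (by norm_num)
  obtain ⟨N, hNd⟩ : ∃ N, N = max (2 * N₁) (max N₂ 240) := ⟨_, rfl⟩
  have hN240 : 240 ≤ N := by omega
  have hNR : (240 : ℝ) ≤ N := by exact_mod_cast hN240
  refine ⟨1 / (256 * N ^ 3), by positivity, ?_⟩
  set γ : ℝ := 1 / (256 * N ^ 3) with hγ
  have hγ0 : 0 < γ := by positivity
  have hγ1 : γ ≤ 1 / 256 := by
    rw [hγ]
    have : (1 : ℝ) ≤ N ^ 3 := one_le_pow₀ (by linarith)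
    gcongr
    linarith
  intro n
  induction n using Nat.strong_induction_on with
  | _ n ih =>
  intro α _ _ σ χ hc hn hσ h hL
  have h1 := h.one_pos
  have hnR : (5 : ℝ) ≤ n := by exact_mod_cast hn
  have hne : σ ≠ 1 := by
    rintro rfl
    have : Nonempty α := Fintype.card_pos_iff.1 (by omega)
    exact hσ (Classical.arbitrary α) rfl
  by_cases hnN : n ≤ N
  · have h2 := h.abs_le_gap (hL.mono (by norm_num)) (by omega) hne
    rw [hc] at h2
    refine h2.trans (mul_le_mul_of_nonneg_right ?_ (by linarith))
    have h3 : (n : ℝ) ≤ N := by exact_mod_cast hnN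
    have h4 : 4 * (γ * n) ≤ 1 / (64 * n ^ 2) := by
      rw [hγ, le_div_iff₀ (by positivity)]
      have : (n : ℝ) ^ 3 ≤ N ^ 3 := by gcongr
      calc 4 * (1 / (256 * (N : ℝ) ^ 3) * n) * (64 * n ^ 2) = n ^ 3 / N ^ 3 := by
            field_simp; ring
        _ ≤ 1 := (div_le_one (by positivity)).2 this
    have h5 : 1 - 4 * (γ * n) ≤ ((1 + γ * n) ^ 4)⁻¹ := by
      rw [← one_div, le_div_iff₀ (by positivity)]
      have : 0 ≤ γ * n := by positivity
      generalize γ * n = z at *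
      nlinarith [pow_nonneg this 2, pow_nonneg this 3, pow_nonneg this 4, pow_nonneg this 5]
    linarith
  push Not at hnN
  have hn240 : (240 : ℝ) ≤ n := hNR.trans (by exact_mod_cast hnN.le)
  have hγn : 1 + γ * n ≤ n / 13 := by
    have : γ * n ≤ 1 / 256 * n := by gcongr
    linarith
  have hG : 28561 / (n : ℝ) ^ 4 ≤ ((1 + γ * n) ^ 4)⁻¹ := by
    have : (1 + γ * n) ^ 4 ≤ (n / 13) ^ 4 := by gcongr
    calc 28561 / (n : ℝ) ^ 4 = (((n : ℝ) / 13) ^ 4)⁻¹ := by field_simp; norm_num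
      _ ≤ _ := by gcongr
  rcases hL.dichotomy (n / 8 + 1) with h2 | ⟨k, hk, hkn, -, ψ, hψ, h3, h4⟩
  swap
  · have hirr : IsIrr ψ := by
      rcases hψ with rfl | rfl
      · exact h
      · exact h.tw
    have habs : |ψ σ| = |χ σ| := by
      rcases hψ with rfl | rfl
      · rfl
      · exact abs_tw _ _
    have hone : ψ 1 = χ 1 := by
      rcases hψ with rfl | rfl
      · rfl
      · exact _root_.tw_one _
    have hs : ((orbs σ).filter fun O => O.card < 2).card ≤ 0 := by
      rw [Nat.le_zero, Finset.card_eq_zero, Finset.filter_eq_empty_iff]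
      intro O hO hlt
      obtain ⟨x, -, rfl⟩ := Finset.mem_image.1 hO
      rw [orb_eq_support (hσ x)] at hlt
      have := (Perm.isCycle_cycleOf σ (hσ x)).two_le_card_support
      omega
    have h5 := hirr.abs_mul_pow_le (le_refl 2) (by omega) h3 h4 (j := 4) (by omega) (by omega) hs
    rw [habs, hone, hc] at h5
    refine le_trans ?_ (mul_le_mul_of_nonneg_right hG (by linarith))
    rw [div_mul_eq_mul_div, le_div_iff₀ (by positivity)]
    refine h5.trans ?_
    norm_num [Nat.factorial]
    linarith
  set k := n / 40 with hkd
  have hLk : LL k χ := h2.mono (by omega)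
  have hN₂n := hN₂ n (by omega)
  set e : ℝ := 4 * (k + 1) * (4 / 5) ^ k with he
  have he0 : 0 ≤ e := by positivity
  have herr : 2 * ((n : ℝ) ^ 6 * e) ≤ 1 / (2097152 * (n : ℝ) ^ 10) := by
    have hk1 : (k + 1 : ℝ) ≤ n := by
      have : k + 1 ≤ n := by omega
      exact_mod_cast this
    rw [le_div_iff₀ (by positivity)]
    calc 2 * ((n : ℝ) ^ 6 * e) * (2097152 * n ^ 10)
        = 16777216 * ((k + 1) * ((n : ℝ) ^ 16 * (4 / 5) ^ k)) := by rw [he]; ring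
      _ ≤ 16777216 * (n * ((n : ℝ) ^ 16 * (4 / 5) ^ k)) := by gcongr
      _ = 16777216 * ((n : ℝ) ^ 17 * (4 / 5) ^ k) := by ring
      _ ≤ 1 := by linarith
  have hinv : ∀ A : Finset α, n ≤ 4 * A.card → ∃ D : Finset {x // x ∈ A},
      D.card + 6 = Fintype.card {x // x ∈ A} ∧
      invDim (D.map (Function.Embedding.subtype _)) χ ≤ e * χ 1 := by
    intro A hA
    obtain ⟨D, hD1, hD2, hD3⟩ := exists_card_add_six (k := k) (A := A) (by omega) (by omega)
      (by omega)
    exact ⟨D, hD1, h.isChar.invDim_le hLk (by omega) hD2 hD3⟩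
  have hcard : ∀ A : Finset α, A.card ≤ n := fun A => hc ▸ Finset.card_le_univ A
  by_cases hbig : ∃ x, n < 2 * (orb σ x).card
  · obtain ⟨x, hx⟩ := hbig
    obtain ⟨D, hD1, hD2⟩ := hinv (orb σ x) (by omega)
    obtain ⟨u, v, huv, hu, hv⟩ := (inv_orb σ x).exists_eq_mul
    have hsame : ∀ y, u.SameCycle ⟨x, self_mem_orb σ x⟩ y := by
      intro y
      obtain ⟨i, -, hi⟩ := (mem_orb.1 y.2).exists_pow_eq'
      have hpow : ∀ j : ℕ, (((u ^ j) ⟨x, self_mem_orb σ x⟩ : {z // z ∈ orb σ x}) : α) =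
          (σ ^ j) x := by
        intro j
        induction j with
        | zero => simp
        | succ j ihj => rw [pow_succ', pow_succ', Perm.mul_apply, Perm.mul_apply, hu, ihj]
      exact ⟨i, Subtype.ext (by rw [zpow_natCast, hpow, hi])⟩
    set a := (orb σ x).card
    have ha : (n : ℝ) ≤ 2 * a := by exact_mod_cast hx.le
    have h5 := h.isChar.abs_le_of_split (A := orb σ x) (x := u) (y := v) (D := D) (D' := ∅)
      (p := ((a : ℝ) ^ 4)⁻¹) (q := 1) (E := (n : ℝ) ^ 6) (E' := 0) (by positivity)
      (inv_le_one_of_one_le₀ (one_le_pow₀ (by linarith))) (by positivity) le_rfl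
      (fun φ hφ => hφ.abs_le_add_invDim (by positivity) (by
          rw [Fintype.card_coe]; exact hcard _) hD1 fun hl => by
        have := hφ.abs_le_of_large_orbit hsame
          (hN₁ _ φ (by rw [Fintype.card_coe]; omega) hφ hl)
        rwa [Fintype.card_coe] at this)
      (fun φ hφ => by
        have := hφ.isChar.abs_le v
        linarith)
    rw [zero_mul, add_zero, mul_one, ← huv] at h5
    have h6 : ((a : ℝ) ^ 4)⁻¹ ≤ 16 / (n : ℝ) ^ 4 := by
      calc ((a : ℝ) ^ 4)⁻¹ ≤ (((n : ℝ) / 2) ^ 4)⁻¹ := by gcongr; linarith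
        _ = 16 / (n : ℝ) ^ 4 := by field_simp; norm_num
    have h7 : 1 / (2097152 * (n : ℝ) ^ 10) ≤ 1 / (n : ℝ) ^ 4 := by
      have h8 : (n : ℝ) ^ 4 ≤ n ^ 10 := pow_le_pow_right₀ (by linarith) (by norm_num)
      have h9 : (0 : ℝ) ≤ (n : ℝ) ^ 10 := by positivity
      gcongr
      linarith
    have h8 : (n : ℝ) ^ 6 * e ≤ 1 / (n : ℝ) ^ 4 := by
      have : 0 ≤ (n : ℝ) ^ 6 * e := by positivity
      linarith
    have h9 : (16 / (n : ℝ) ^ 4 + 1 / (n : ℝ) ^ 4) ≤ 28561 / (n : ℝ) ^ 4 := by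
      rw [← add_div]; gcongr; norm_num
    calc |χ σ| ≤ ((a : ℝ) ^ 4)⁻¹ * χ 1 + (n : ℝ) ^ 6 * (e * χ 1) :=
          h5.trans (add_le_add le_rfl (mul_le_mul_of_nonneg_left hD2 (by positivity)))
      _ = (((a : ℝ) ^ 4)⁻¹ + (n : ℝ) ^ 6 * e) * χ 1 := by ring
      _ ≤ _ := mul_le_mul_of_nonneg_right (by linarith) (by linarith)
  push Not at hbig
  obtain ⟨A, hA, hA1, hA2⟩ := exists_inv_mid (σ := σ) (by omega) (by rwa [hc])
  rw [hc] at hA1 hA2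
  have hAc : A.card + Aᶜ.card = n := hc ▸ Finset.card_add_card_compl A
  obtain ⟨D, hD1, hD2⟩ := hinv A hA1
  obtain ⟨D', hD1', hD2'⟩ := hinv Aᶜ (by omega)
  obtain ⟨u, v, huv, hu, hv⟩ := hA.exists_eq_mul
  have hub : ∀ i, u i ≠ i := fun i hi => hσ i (by rw [← hu, hi])
  have hvb : ∀ i, v i ≠ i := fun i hi => hσ i (by rw [← hv, hi])
  have hdec : ∀ m : ℕ, ((1 + γ * m) ^ 4)⁻¹ ≤ 1 := fun m =>
    inv_le_one_of_one_le₀ (one_le_pow₀ (by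
      have : 0 ≤ γ * m := by positivity
      linarith))
  have h5 := h.isChar.abs_le_of_split (A := A) (x := u) (y := v) (D := D) (D' := D')
    (p := ((1 + γ * A.card) ^ 4)⁻¹) (q := ((1 + γ * Aᶜ.card) ^ 4)⁻¹) (E := (n : ℝ) ^ 6)
    (E' := (n : ℝ) ^ 6) (by positivity) (hdec _) (by positivity) (by positivity)
    (fun φ hφ => hφ.abs_le_add_invDim (by positivity) (by
      rw [Fintype.card_coe]; exact hcard _) hD1 fun hl =>
        ih A.card (by omega) _ u φ (Fintype.card_coe _) (by omega) hub hφ hl)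
    (fun φ hφ => hφ.abs_le_add_invDim (by positivity) (by
      rw [Fintype.card_coe]; exact hcard _) hD1' fun hl =>
        ih Aᶜ.card (by omega) _ v φ (Fintype.card_coe _) (by omega) hvb hφ hl)
  rw [← huv] at h5
  have hgap : ((1 + γ * A.card) ^ 4)⁻¹ * ((1 + γ * Aᶜ.card) ^ 4)⁻¹ + 2 * ((n : ℝ) ^ 6 * e) ≤
      ((1 + γ * n) ^ 4)⁻¹ := by
    have h6 := decay_gap (a := (A.card : ℝ)) (b := (Aᶜ.card : ℝ)) hγ0 hγ1 (by rw [hγ]; gcongr)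
      hn240 (by exact_mod_cast hAc) (by exact_mod_cast hA1) (by
        have : n ≤ 4 * Aᶜ.card := by omega
        exact_mod_cast this) hG
    linarith
  calc |χ σ| ≤ ((1 + γ * A.card) ^ 4)⁻¹ * ((1 + γ * Aᶜ.card) ^ 4)⁻¹ * χ 1 +
        (n : ℝ) ^ 6 * (e * χ 1) + (n : ℝ) ^ 6 * (e * χ 1) := by
        refine h5.trans (add_le_add (add_le_add le_rfl ?_) ?_)
        · exact mul_le_mul_of_nonneg_left hD2 (by positivity)
        · exact mul_le_mul_of_nonneg_left hD2' (by positivity)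
    _ = (((1 + γ * A.card) ^ 4)⁻¹ * ((1 + γ * Aᶜ.card) ^ 4)⁻¹ + 2 * ((n : ℝ) ^ 6 * e)) * χ 1 := by ring
    _ ≤ _ := mul_le_mul_of_nonneg_right hgap (by linarith)

end DecayMain

section LevelBound

open Equiv

set_option linter.unusedSectionVars false

variable {α : Type} [Fintype α] [DecidableEq α]

theorem exists_ofSubtype_support (σ : Perm α) {F : Finset α} (hF : ∀ x ∈ F, σ x = x) :
    ∃ ρ : Perm {x // x ∈ Fᶜ}, σ = Perm.ofSubtype ρ ∧ ∀ i, (ρ i : α) = σ i := by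
  have h : σ ∈ permsOn Fᶜ := mem_permsOn.2 fun x hx => hF x (by simpa using hx)
  obtain ⟨ρ, rfl⟩ := exists_ofSubtype_eq h
  exact ⟨ρ, rfl, fun i => (Perm.ofSubtype_apply_coe ρ i).symm⟩

theorem exists_decay_of_fixed : ∃ C : ℝ, 0 < C ∧ ∀ (α : Type) [Fintype α] [DecidableEq α]
    (σ : Perm α) (χ : Perm α → ℝ), 7 ≤ Fintype.card α →
      (Finset.univ.filter fun x => σ x = x).card ≤ 2 → IsIrr χ → LL 9 χ →
      |χ σ| * (Fintype.card α) ^ 4 ≤ C * χ 1 := by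
  obtain ⟨γ, hγ, hdec⟩ := exists_decay
  refine ⟨(2 / γ) ^ 4, by positivity, fun α _ _ σ χ hn hc h hL => ?_⟩
  set F := Finset.univ.filter fun x => σ x = x
  obtain ⟨ρ, hσρ, hρ⟩ := exists_ofSubtype_support σ (F := F) (by simp [F])
  have hcF : F.card + Fᶜ.card = Fintype.card α := Finset.card_add_card_compl F
  have h1 := h.one_pos
  have h2 := h.isChar.abs_le_of_res (B := Fᶜ) (k := 7) (ρ := ρ)
    (hL.mono (by rw [compl_compl]; omega)) (c := ((1 + γ * (Fᶜ.card : ℕ)) ^ 4)⁻¹)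
    fun ψ hψ hl => hdec _ _ ρ ψ (Fintype.card_coe _) (by omega) (fun i hi => by
      have := hρ i
      rw [hi] at this
      exact (Finset.mem_compl.1 i.2) (by simp [F, ← this])) hψ hl
  rw [← hσρ] at h2
  have h3 : γ * Fintype.card α / 2 ≤ 1 + γ * (Fᶜ.card : ℕ) := by
    have : (Fintype.card α : ℝ) ≤ 2 * (Fᶜ.card : ℕ) := by
      have : Fintype.card α ≤ 2 * Fᶜ.card := by omega
      exact_mod_cast this
    nlinarith
  have hn' : (0 : ℝ) < Fintype.card α := by
    have : 0 < Fintype.card α := by omega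
    exact_mod_cast this
  refine (mul_le_mul_of_nonneg_right h2 (by positivity)).trans ?_
  rw [mul_right_comm]
  refine mul_le_mul_of_nonneg_right ?_ (by linarith)
  rw [inv_mul_le_iff₀ (by positivity), ← mul_pow]
  gcongr
  calc (Fintype.card α : ℝ) = γ * Fintype.card α / 2 * (2 / γ) := by field_simp
    _ ≤ _ := by gcongr

theorem small_orbits_mono {σ : Perm α} {r s : ℕ} (h : r ≤ s) :
    ((orbs σ).filter fun O => O.card < r).card ≤ ((orbs σ).filter fun O => O.card < s).card :=
  Finset.card_le_card fun O hO => by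
    simp only [Finset.mem_filter] at *
    exact ⟨hO.1, by omega⟩

theorem small_orbits_two (σ : Perm α) :
    ((orbs σ).filter fun O => O.card < 2).card = cn σ 1 := by
  rw [cn]
  congr 1
  ext O
  simp only [Finset.mem_filter, orbN]
  refine and_congr_right fun hO => ?_
  have := Finset.card_pos.2 (orbs_nonempty hO)
  omega

theorem small_orbits_three (σ : Perm α) :
    ((orbs σ).filter fun O => O.card < 3).card = cn σ 1 + cn σ 2 := by
  rw [cn, cn, orbN, orbN, ← Finset.card_union_of_disjoint]
  · congr 1
    ext O
    simp only [Finset.mem_filter, Finset.mem_union, ← and_or_left]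
    refine and_congr_right fun hO => ?_
    have := Finset.card_pos.2 (orbs_nonempty hO)
    omega
  · rw [Finset.disjoint_filter]
    intro O _ h1 h2
    omega

theorem exists_level_bound {r j m : ℕ} (hr : 2 ≤ r) (hj : j ≤ 4)
    (hm : ∀ k, m ≤ k → k < 9 → j ≤ k - k / r) :
    ∃ C : ℝ, 0 < C ∧ ∀ (α : Type) [Fintype α] [DecidableEq α]
    (σ : Perm α) (χ : Perm α → ℝ), 72 ≤ Fintype.card α →
      ((orbs σ).filter fun O => O.card < r).card ≤ 2 → IsIrr χ → LL m χ →
      |χ σ| * (Fintype.card α) ^ j ≤ C * χ 1 := by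
  obtain ⟨C, hC, hdec⟩ := exists_decay_of_fixed
  refine ⟨max C (4 ^ j * j.factorial * 2 ^ (2 + 2)), lt_max_of_lt_left hC,
    fun α _ _ σ χ hn hs h hL => ?_⟩
  have h1 := h.one_pos
  rcases hL.dichotomy 9 with h2 | ⟨k, hk, hkn, -, ψ, hψ, h3, h4⟩
  · have h5 := hdec α σ χ (by omega) (by
      rw [← cn_one, ← small_orbits_two]
      exact (small_orbits_mono hr).trans hs) h h2
    have hn1 : (1 : ℝ) ≤ Fintype.card α := by
      have : 1 ≤ Fintype.card α := by omega
      exact_mod_cast this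
    calc |χ σ| * (Fintype.card α : ℝ) ^ j ≤ |χ σ| * (Fintype.card α : ℝ) ^ 4 := by gcongr
      _ ≤ C * χ 1 := h5
      _ ≤ _ := by gcongr; exact le_max_left _ _
  · have h5 : ∀ ψ : Perm α → ℝ, IsIrr ψ → LevGe k ψ → ¬ LevGe (k + 1) ψ →
        |ψ σ| * (Fintype.card α) ^ j ≤ 4 ^ j * j.factorial * 2 ^ (2 + 2) * ψ 1 := fun ψ hψ a b =>
      hψ.abs_mul_pow_le hr (by omega) a b (hm k hk hkn) (by omega) hs
    have h6 : |χ σ| * (Fintype.card α) ^ j ≤ 4 ^ j * j.factorial * 2 ^ (2 + 2) * χ 1 := by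
      rcases hψ with rfl | rfl
      · exact h5 _ h h3 h4
      · have := h5 _ h.tw h3 h4
        rwa [abs_tw, _root_.tw_one] at this
    refine h6.trans ?_
    gcongr
    exact le_max_right _ _

end LevelBound

section Weighted

open Equiv

set_option linter.unusedSectionVars false

variable {α : Type} [Fintype α] [DecidableEq α]

/-- The sum over subfamilies of total size `m` of the product of the weights of their members. -/
noncomputable def famSum (w : ℕ → ℝ) (P : Finset (Finset α)) (m : ℕ) : ℝ :=
  ∑ S ∈ P.powerset with ∑ O ∈ S, O.card = m, ∏ O ∈ S, w O.card

theorem famSum_empty (w : ℕ → ℝ) (m : ℕ) :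
    famSum w (∅ : Finset (Finset α)) m = if m = 0 then 1 else 0 := by
  rw [famSum, Finset.powerset_empty, Finset.sum_filter, Finset.sum_singleton]
  simp [eq_comm]

theorem famSum_insert (w : ℕ → ℝ) {P : Finset (Finset α)} {O : Finset α} (hO : O ∉ P) (m : ℕ) :
    famSum w (insert O P) m =
      famSum w P m + if O.card ≤ m then w O.card * famSum w P (m - O.card) else 0 := by
  simp only [famSum, Finset.sum_filter]
  rw [Finset.sum_powerset_insert hO]
  congr 1
  have h : ∀ S ∈ P.powerset, O ∉ S := fun S hS h => hO (Finset.mem_powerset.1 hS h)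
  split_ifs with hm
  · rw [Finset.mul_sum]
    refine Finset.sum_congr rfl fun S hS => ?_
    rw [Finset.sum_insert (h S hS), Finset.prod_insert (h S hS), mul_ite, mul_zero]
    exact if_congr (by omega) rfl rfl
  · refine Finset.sum_eq_zero fun S hS => ?_
    rw [Finset.sum_insert (h S hS), if_neg (by omega)]

theorem famSum_zero (w : ℕ → ℝ) {P : Finset (Finset α)} (hP : ∀ O ∈ P, 1 ≤ O.card) :
    famSum w P 0 = 1 := by
  induction P using Finset.induction_on with
  | empty => simp [famSum_empty]
  | insert O P hO ih =>
    have := hP O (Finset.mem_insert_self _ _)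
    rw [famSum_insert w hO, ih fun O' h => hP O' (Finset.mem_insert_of_mem h), if_neg (by omega),
      add_zero]

theorem card_filter_insert {P : Finset (Finset α)} {O : Finset α} (hO : O ∉ P) (l : ℕ) :
    (((insert O P).filter fun O => O.card = l).card : ℝ) =
      (P.filter fun O => O.card = l).card + if O.card = l then 1 else 0 := by
  rw [Finset.filter_insert]
  split_ifs with h
  · rw [Finset.card_insert_of_notMem (by simp [hO])]
    simp
  · simp

theorem famSum_one (w : ℕ → ℝ) {P : Finset (Finset α)} (hP : ∀ O ∈ P, 1 ≤ O.card) :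
    famSum w P 1 = w 1 * (P.filter fun O => O.card = 1).card := by
  induction P using Finset.induction_on with
  | empty => simp [famSum_empty]
  | insert O P hO ih =>
    have h0 := hP O (Finset.mem_insert_self _ _)
    have hP' : ∀ O ∈ P, 1 ≤ O.card := fun O' h => hP O' (Finset.mem_insert_of_mem h)
    rw [famSum_insert w hO, ih hP', card_filter_insert hO]
    obtain h | h : O.card = 1 ∨ 2 ≤ O.card := by omega
    · simp only [h, le_refl, if_true, Nat.sub_self, famSum_zero w hP']
      ring
    · rw [if_neg (by omega), if_neg (by omega)]
      ring

theorem famSum_two (w : ℕ → ℝ) {P : Finset (Finset α)} (hP : ∀ O ∈ P, 1 ≤ O.card) {a b : ℝ}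
    (ha : ((P.filter fun O => O.card = 1).card : ℝ) = a)
    (hb : ((P.filter fun O => O.card = 2).card : ℝ) = b) :
    famSum w P 2 = w 1 ^ 2 * (a * (a - 1) / 2) + w 2 * b := by
  subst ha hb
  induction P using Finset.induction_on with
  | empty => simp [famSum_empty]
  | insert O P hO ih =>
    have h0 := hP O (Finset.mem_insert_self _ _)
    have hP' : ∀ O ∈ P, 1 ≤ O.card := fun O' h => hP O' (Finset.mem_insert_of_mem h)
    rw [famSum_insert w hO, ih hP', card_filter_insert hO, card_filter_insert hO]
    obtain h | h | h : O.card = 1 ∨ O.card = 2 ∨ 3 ≤ O.card := by omega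
    · simp [h, famSum_one w hP']
      ring
    · simp [h, famSum_zero w hP']
      ring
    · rw [if_neg (by omega), if_neg (by omega), if_neg (by omega)]
      ring

theorem famSum_three (w : ℕ → ℝ) {P : Finset (Finset α)} (hP : ∀ O ∈ P, 1 ≤ O.card) {a b c : ℝ}
    (ha : ((P.filter fun O => O.card = 1).card : ℝ) = a)
    (hb : ((P.filter fun O => O.card = 2).card : ℝ) = b)
    (hc : ((P.filter fun O => O.card = 3).card : ℝ) = c) :
    famSum w P 3 = w 1 ^ 3 * (a * (a - 1) * (a - 2) / 6) + w 1 * w 2 * (a * b) + w 3 * c := by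
  subst ha hb hc
  induction P using Finset.induction_on with
  | empty => simp [famSum_empty]
  | insert O P hO ih =>
    have h0 := hP O (Finset.mem_insert_self _ _)
    have hP' : ∀ O ∈ P, 1 ≤ O.card := fun O' h => hP O' (Finset.mem_insert_of_mem h)
    rw [famSum_insert w hO, ih hP', card_filter_insert hO, card_filter_insert hO,
      card_filter_insert hO]
    obtain h | h | h | h : O.card = 1 ∨ O.card = 2 ∨ O.card = 3 ∨ 4 ≤ O.card := by omega
    · simp [h, famSum_two w hP' rfl rfl]
      ring
    · simp [h, famSum_one w hP']
      ring
    · simp [h, famSum_zero w hP']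
      ring
    · rw [if_neg (by omega), if_neg (by omega), if_neg (by omega), if_neg (by omega)]
      ring

theorem famSum_four (w : ℕ → ℝ) {P : Finset (Finset α)} (hP : ∀ O ∈ P, 1 ≤ O.card) {a b c d : ℝ}
    (ha : ((P.filter fun O => O.card = 1).card : ℝ) = a)
    (hb : ((P.filter fun O => O.card = 2).card : ℝ) = b)
    (hc : ((P.filter fun O => O.card = 3).card : ℝ) = c)
    (hd : ((P.filter fun O => O.card = 4).card : ℝ) = d) :
    famSum w P 4 = w 1 ^ 4 * (a * (a - 1) * (a - 2) * (a - 3) / 24) +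
      w 1 ^ 2 * w 2 * (a * (a - 1) / 2 * b) + w 2 ^ 2 * (b * (b - 1) / 2) + w 1 * w 3 * (a * c) +
      w 4 * d := by
  subst ha hb hc hd
  induction P using Finset.induction_on with
  | empty => simp [famSum_empty]
  | insert O P hO ih =>
    have h0 := hP O (Finset.mem_insert_self _ _)
    have hP' : ∀ O ∈ P, 1 ≤ O.card := fun O' h => hP O' (Finset.mem_insert_of_mem h)
    rw [famSum_insert w hO, ih hP', card_filter_insert hO, card_filter_insert hO,
      card_filter_insert hO, card_filter_insert hO]
    obtain h | h | h | h | h : O.card = 1 ∨ O.card = 2 ∨ O.card = 3 ∨ O.card = 4 ∨ 5 ≤ O.card := by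
      omega
    · simp [h, famSum_three w hP' rfl rfl rfl]
      ring
    · simp [h, famSum_two w hP' rfl rfl]
      ring
    · simp [h, famSum_one w hP']
      ring
    · simp [h, famSum_zero w hP']
      ring
    · rw [if_neg (by omega), if_neg (by omega), if_neg (by omega), if_neg (by omega),
        if_neg (by omega)]
      ring

/-- The orbits of `σ` contained in `A`. -/
def orbsIn (σ : Perm α) (A : Finset α) : Finset (Finset α) := (orbs σ).filter (· ⊆ A)

/-- The number of orbits of size `l` contained in `A`. -/
def cnIn (σ : Perm α) (A : Finset α) (l : ℕ) : ℕ :=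
  ((orbsIn σ A).filter fun O => O.card = l).card

/-- The product of the weights of the orbits contained in `A`. -/
noncomputable def wt (w : ℕ → ℝ) (σ : Perm α) (A : Finset α) : ℝ := ∏ O ∈ orbsIn σ A, w O.card

theorem sum_wt_eq (w : ℕ → ℝ) (σ : Perm α) (m : ℕ) :
    ∑ A : Finset α with IsInv σ A, (if A.card = m then wt w σ A else 0) =
      famSum w (orbs σ) m := by
  rw [sum_inv_eq_sum_orbs, famSum, Finset.sum_filter]
  refine Finset.sum_congr rfl fun S hS => ?_
  have hS := Finset.mem_powerset.1 hS
  rw [card_biUnion_orbs hS, wt, orbsIn, filter_orbs_biUnion hS]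

theorem orbs_card_pos (σ : Perm α) : ∀ O ∈ orbs σ, 1 ≤ O.card := fun _ hO =>
  Finset.card_pos.2 (orbs_nonempty hO)

theorem card_eq_sum_orbsIn {σ : Perm α} {A : Finset α} (h : IsInv σ A) :
    A.card = ∑ O ∈ orbsIn σ A, O.card := by
  conv_lhs => rw [← biUnion_filter_orbs h]
  exact card_biUnion_orbs (Finset.filter_subset _ _)

theorem sum_card_eq_of_le_four {P : Finset (Finset α)} (hP : ∀ O ∈ P, 1 ≤ O.card)
    (h4 : ∑ O ∈ P, O.card ≤ 4) (w : ℕ → ℝ) :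
    ∑ O ∈ P, O.card = (P.filter fun O => O.card = 1).card + 2 * (P.filter fun O => O.card = 2).card
      + 3 * (P.filter fun O => O.card = 3).card + 4 * (P.filter fun O => O.card = 4).card ∧
    ∏ O ∈ P, w O.card = w 1 ^ (P.filter fun O => O.card = 1).card *
      w 2 ^ (P.filter fun O => O.card = 2).card * w 3 ^ (P.filter fun O => O.card = 3).card *
      w 4 ^ (P.filter fun O => O.card = 4).card := by
  induction P using Finset.induction_on with
  | empty => simp
  | insert O P hO ih =>
    have h0 := hP O (Finset.mem_insert_self _ _)
    have hP' : ∀ O ∈ P, 1 ≤ O.card := fun O' h => hP O' (Finset.mem_insert_of_mem h)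
    rw [Finset.sum_insert hO] at h4
    obtain ⟨h1, h2⟩ := ih hP' (by omega)
    rw [Finset.sum_insert hO, Finset.prod_insert hO, h1, h2]
    simp only [Finset.filter_insert]
    obtain h | h | h | h : O.card = 1 ∨ O.card = 2 ∨ O.card = 3 ∨ O.card = 4 := by omega
    all_goals
      simp only [h, reduceIte, Nat.reduceEqDiff]
      rw [Finset.card_insert_of_notMem (by simp [hO])]
      constructor
      · omega
      · ring

theorem cnIn_eq_of_le_four {σ : Perm α} {A : Finset α} (h : IsInv σ A) (h4 : A.card ≤ 4)
    (w : ℕ → ℝ) :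
    A.card = cnIn σ A 1 + 2 * cnIn σ A 2 + 3 * cnIn σ A 3 + 4 * cnIn σ A 4 ∧
    wt w σ A = w 1 ^ cnIn σ A 1 * w 2 ^ cnIn σ A 2 * w 3 ^ cnIn σ A 3 * w 4 ^ cnIn σ A 4 := by
  have := sum_card_eq_of_le_four (P := orbsIn σ A)
    (fun O hO => orbs_card_pos σ O (Finset.mem_filter.1 hO).1)
    (by rwa [← card_eq_sum_orbsIn h]) w
  rwa [← card_eq_sum_orbsIn h] at this

end Weighted

section Cores

open Equiv

set_option linter.unusedSectionVars false

variable {α : Type} [Fintype α] [DecidableEq α]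

theorem sum_sgn_permsOn (C : Finset α) :
    ∑ ρ ∈ permsOn C, sgn ρ = if C.card ≤ 1 then 1 else 0 := by
  rw [sum_permsOn]
  simp only [sgn, Perm.sign_ofSubtype]
  split_ifs with h
  · have : Subsingleton {x // x ∈ C} := by
      rw [← Fintype.card_le_one_iff_subsingleton, Fintype.card_coe]
      exact h
    rw [Fintype.sum_eq_single 1 fun ρ hρ => (hρ (Subsingleton.elim _ _)).elim]
    simp
  · have : Nontrivial {x // x ∈ C} := by
      rw [← Fintype.one_lt_card_iff_nontrivial, Fintype.card_coe]
      omega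
    obtain ⟨a, b, hab⟩ := exists_pair_ne {x // x ∈ C}
    have h1 := Equiv.sum_comp (Equiv.mulLeft (swap a b)) fun ρ : Perm {x // x ∈ C} =>
      ((Perm.sign ρ : ℤ) : ℝ)
    simp only [Equiv.coe_mulLeft, Perm.sign_mul, Perm.sign_swap hab, Units.val_neg, Int.cast_neg,
      neg_one_mul, Finset.sum_neg_distrib] at h1
    linarith

theorem signAvg_def (φ : Finset α → Perm α → ℝ) (A C : Finset α) (τ : Perm α) :
    signAvg φ A C τ = (-1) ^ C.card / C.card.factorial *
      ∑ ρ ∈ permsOn C, sgn ρ * φ (A ∪ C) (τ * ρ) := rfl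

theorem mul_mem_permsOn_union {A C : Finset α} {τ ρ : Perm α} (hτ : τ ∈ permsOn A)
    (hρ : ρ ∈ permsOn C) : τ * ρ ∈ permsOn (A ∪ C) :=
  mul_mem_permsOn (permsOn_mono Finset.subset_union_left hτ)
    (permsOn_mono Finset.subset_union_right hρ)

theorem coef_of_trivial {φ : Finset α → Perm α → ℝ} (h : Equivariant φ) {k : ℕ}
    (hk : k + 1 ≤ Fintype.card α) (h1 : ∀ E : Finset α, E.card = k + 1 → ∀ τ ∈ permsOn E, φ E τ = 1)
    {A : Finset α} {τ : Perm α} (hτ : τ ∈ permsOn A) :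
    coef φ (k + 1) A τ = (if A.card = k + 1 then 1 else 0) - if A.card = k then 1 else 0 := by
  rcases lt_or_ge (k + 1) A.card with hA | hA
  · rw [coef_eq_zero _ hA, if_neg (by omega), if_neg (by omega), sub_zero]
  · obtain ⟨C, hC, hc⟩ := exists_disjoint_card hk hA
    rw [coef_eq h hτ hC hc, signAvg_def, Finset.sum_congr rfl fun ρ hρ => by
      rw [h1 (A ∪ C) (by rw [Finset.card_union_of_disjoint hC, hc]) _
        (mul_mem_permsOn_union hτ hρ), mul_one], sum_sgn_permsOn]
    obtain h0 | h0 | h0 : C.card = 0 ∨ C.card = 1 ∨ 2 ≤ C.card := by omega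
    · rw [if_pos (by omega), if_pos (by omega), if_neg (by omega), h0]
      simp
    · rw [if_pos (by omega), if_neg (by omega), if_pos (by omega), h0]
      simp
    · rw [if_neg (by omega), if_neg (by omega), if_neg (by omega)]
      simp

theorem wt_one (σ : Perm α) (A : Finset α) : wt (fun _ => 1) σ A = 1 := Finset.prod_const_one

theorem stableSum_of_trivial {φ : Finset α → Perm α → ℝ} (h : Equivariant φ) {k : ℕ}
    (hk : k + 1 ≤ Fintype.card α) (h1 : ∀ E : Finset α, E.card = k + 1 → ∀ τ ∈ permsOn E, φ E τ = 1)
    (σ : Perm α) :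
    stableSum φ (k + 1) σ =
      famSum (fun _ => 1) (orbs σ) (k + 1) - famSum (fun _ => 1) (orbs σ) k := by
  rw [stableSum, ← sum_wt_eq, ← sum_wt_eq, ← Finset.sum_sub_distrib]
  refine Finset.sum_congr rfl fun A _ => ?_
  rw [coef_of_trivial h hk h1 (restr_mem _ _), wt_one]

theorem coef_of_sgn {φ : Finset α → Perm α → ℝ} (h : Equivariant φ) {k : ℕ}
    (hk : k ≤ Fintype.card α) (h1 : ∀ E : Finset α, E.card = k → ∀ τ ∈ permsOn E, φ E τ = sgn τ)
    {A : Finset α} {τ : Perm α} (hτ : τ ∈ permsOn A) :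
    coef φ k A τ = if A.card ≤ k then (-1) ^ (k - A.card) * sgn τ else 0 := by
  split_ifs with hA
  · obtain ⟨C, hC, hc⟩ := exists_disjoint_card hk hA
    rw [coef_eq h hτ hC hc, signAvg_def, Finset.sum_congr rfl fun ρ hρ => by
      rw [h1 (A ∪ C) (by rw [Finset.card_union_of_disjoint hC, hc]) _
        (mul_mem_permsOn_union hτ hρ), sgn_mul, mul_left_comm, sgn_mul_self, mul_one],
      Finset.sum_const, card_permsOn, nsmul_eq_mul, ← hc, Nat.add_sub_cancel_left]
    have : (C.card.factorial : ℝ) ≠ 0 := by exact_mod_cast C.card.factorial_ne_zero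
    field_simp
  · exact coef_eq_zero _ (not_le.1 hA) _

theorem sgn_restr_biUnion (σ : Perm α) {S : Finset (Finset α)} (hS : S ⊆ orbs σ) :
    sgn (restr σ (S.biUnion id)) = ∏ O ∈ S, (-1 : ℝ) ^ (O.card + 1) := by
  induction S using Finset.induction_on with
  | empty => simp [sgn, show restr σ ∅ = 1 by
      simpa [permsOn_empty] using restr_mem σ (∅ : Finset α)]
  | insert O S hO ih =>
    have hS' : S ⊆ orbs σ := (Finset.subset_insert _ _).trans hS
    have hOo : O ∈ orbs σ := hS (Finset.mem_insert_self _ _)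
    have hd : Disjoint O (S.biUnion id) := by
      rw [Finset.disjoint_biUnion_right]
      intro O' hO'
      exact orbs_disjoint hOo (hS' hO') fun h => hO (h ▸ hO')
    rw [Finset.biUnion_insert, Finset.prod_insert hO, ← ih hS', id,
      (inv_of_mem_orbs hOo).restr_union (inv_biUnion hS') hd, sgn_mul]
    congr 1
    obtain ⟨x, hx⟩ := orbs_nonempty hOo
    have h1 := congrArg (fun u : ℤˣ => ((u : ℤ) : ℝ)) (sign_restr_orb σ x)
    rw [eq_orb_of_mem hOo hx, sgn]
    push_cast at h1
    have h2 : ((-1 : ℝ) ^ (orb σ x).card) * (-1) ^ (orb σ x).card = 1 := by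
      rw [← mul_pow]
      norm_num
    linear_combination (-1 : ℝ) ^ (orb σ x).card * h1 - ((Perm.sign (restr σ (orb σ x)) : ℤ) : ℝ) * h2

theorem wt_sgn (σ : Perm α) {A : Finset α} (hA : IsInv σ A) :
    wt (fun l => (-1) ^ (l + 1)) σ A = sgn (restr σ A) := by
  conv_rhs => rw [← biUnion_filter_orbs hA]
  rw [sgn_restr_biUnion σ (Finset.filter_subset _ _)]
  rfl

theorem stableSum_of_sgn {φ : Finset α → Perm α → ℝ} (h : Equivariant φ) {k : ℕ}
    (hk : k ≤ Fintype.card α) (h1 : ∀ E : Finset α, E.card = k → ∀ τ ∈ permsOn E, φ E τ = sgn τ)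
    (σ : Perm α) :
    stableSum φ k σ = ∑ j ∈ Finset.range (k + 1), (-1) ^ (k - j) *
      famSum (fun l => (-1) ^ (l + 1)) (orbs σ) j := by
  simp only [stableSum, ← sum_wt_eq, Finset.mul_sum]
  rw [Finset.sum_comm]
  refine Finset.sum_congr rfl fun A hA => ?_
  rw [coef_of_sgn h hk h1 (restr_mem _ _), wt_sgn σ (Finset.mem_filter.1 hA).2]
  simp only [mul_ite, mul_zero]
  rw [Finset.sum_ite_eq]
  simp only [Finset.mem_range, Nat.lt_succ_iff]

/-- The number of fixed points of `τ` in `A`. -/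
def fixIn (τ : Perm α) (A : Finset α) : ℕ := (A.filter fun x => τ x = x).card

theorem fixIn_union {A C : Finset α} (hC : Disjoint A C) {τ ρ : Perm α} (hτ : τ ∈ permsOn A)
    (hρ : ρ ∈ permsOn C) : fixIn (τ * ρ) (A ∪ C) = fixIn τ A + fixIn ρ C := by
  rw [fixIn, Finset.filter_union, Finset.card_union_of_disjoint (Finset.disjoint_filter_filter hC)]
  congr 2
  · refine Finset.filter_congr fun x hx => ?_
    rw [Perm.mul_apply, mem_permsOn.1 hρ x (Finset.disjoint_left.1 hC hx)]
  · refine Finset.filter_congr fun x hx => ?_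
    rw [Perm.mul_apply, mem_permsOn.1 hτ (ρ x) (Finset.disjoint_right.1 hC
      (apply_mem_of_permsOn hρ hx))]

theorem coef_of_std {φ : Finset α → Perm α → ℝ} (h : Equivariant φ)
    (hk : 3 ≤ Fintype.card α)
    (h1 : ∀ E : Finset α, E.card = 3 → ∀ τ ∈ permsOn E, φ E τ = fixIn τ E - 1)
    (h2 : ∀ E : Finset α, E.card = 3 → ∑ τ ∈ permsOn E, sgn τ * φ E τ = 0)
    {A : Finset α} {τ : Perm α} (hτ : τ ∈ permsOn A) :
    coef φ 3 A τ = (if A.card = 3 then (fixIn τ A : ℝ) - 1 else 0) -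
      (if A.card = 2 then (fixIn τ A : ℝ) else 0) + if A.card = 1 then 1 else 0 := by
  rcases lt_or_ge 3 A.card with hA | hA
  · rw [coef_eq_zero _ hA, if_neg (by omega), if_neg (by omega), if_neg (by omega)]
    norm_num
  · obtain ⟨C, hC, hc⟩ := exists_disjoint_card hk hA
    have hu : (A ∪ C).card = 3 := by rw [Finset.card_union_of_disjoint hC, hc]
    have h3 : ∀ ρ ∈ permsOn C, φ (A ∪ C) (τ * ρ) = fixIn τ A + fixIn ρ C - 1 := fun ρ hρ => by
      rw [h1 _ hu _ (mul_mem_permsOn_union hτ hρ), fixIn_union hC hτ hρ]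
      push_cast
      rfl
    rw [coef_eq h hτ hC hc]
    obtain h0 | h0 | h0 | h0 : C.card = 0 ∨ C.card = 1 ∨ C.card = 2 ∨ C.card = 3 := by omega
    · rw [if_pos (by omega), if_neg (by omega), if_neg (by omega), signAvg_def]
      obtain rfl := Finset.card_eq_zero.1 h0
      rw [Finset.sum_congr rfl fun ρ hρ => by rw [h3 ρ hρ], permsOn_empty]
      simp [fixIn, sgn]
    · rw [if_neg (by omega), if_pos (by omega), if_neg (by omega), signAvg_def]
      obtain ⟨c, rfl⟩ := Finset.card_eq_one.1 h0
      rw [Finset.sum_congr rfl fun ρ hρ => by rw [h3 ρ hρ], show permsOn {c} = {(1 : Perm α)} by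
        refine (Finset.eq_of_subset_of_card_le (fun ρ hρ => ?_) ?_).symm
        · rw [Finset.mem_singleton.1 hρ]
          exact one_mem_permsOn _
        · rw [card_permsOn, Finset.card_singleton]
          simp]
      simp [fixIn, sgn]
    · rw [if_neg (by omega), if_neg (by omega), if_pos (by omega), signAvg_def]
      obtain ⟨a, b, hab, rfl⟩ := Finset.card_eq_two.1 h0
      rw [Finset.sum_congr rfl fun ρ hρ => by rw [h3 ρ hρ], permsOn_pair hab,
        Finset.sum_pair fun h => hab (swap_eq_one_iff.1 h.symm), h0]
      have e1 : fixIn (1 : Perm α) {a, b} = 2 := by simp [fixIn, hab]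
      have e2 : fixIn (swap a b) {a, b} = 0 := by
        simp [fixIn, hab, hab.symm, Finset.filter_eq_empty_iff]
      rw [e1, e2, sgn_one, sgn, Perm.sign_swap hab]
      norm_num
    · rw [if_neg (by omega), if_neg (by omega), if_neg (by omega), signAvg_def]
      obtain rfl : A = ∅ := Finset.card_eq_zero.1 (by omega)
      have : τ = 1 := by simpa [permsOn_empty] using hτ
      subst this
      simp only [Finset.empty_union, one_mul] at hu ⊢
      rw [h2 C hu]
      norm_num

end Cores

section SmallLevels

open Equiv

set_option linter.unusedSectionVars false

variable {α : Type} [Fintype α] [DecidableEq α]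

theorem core_isIrr {χ : Perm α → ℝ} (h : IsChar χ) {E : Finset α}
    (hE : ∑ τ ∈ permsOn E, core χ E τ ^ 2 = E.card.factorial) :
    IsIrr fun ρ : Perm {x // x ∈ E} => core χ E (Perm.ofSubtype ρ) := by
  refine isIrr_of_norm (core_isChar h E) ?_
  rw [sum_permsOn] at hE
  simp only [← pow_two]
  rw [hE, Fintype.card_perm, Fintype.card_coe]

theorem Equivariant.transfer {φ : Finset α → Perm α → ℝ} (h : Equivariant φ) {E E' : Finset α}
    (hc : E.card = E'.card) {f : Perm α → ℝ} (hf : ∀ g τ, f (g * τ * g⁻¹) = f τ)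
    (hE : ∀ τ ∈ permsOn E, φ E τ = f τ) : ∀ τ ∈ permsOn E', φ E' τ = f τ := by
  obtain ⟨g, -, rfl⟩ := exists_perm_map_eq (Finset.subset_univ E) (Finset.subset_univ E') hc
  intro τ hτ
  have h1 : g * (g⁻¹ * τ * g) * g⁻¹ = τ := by group
  rw [← h1] at hτ ⊢
  rw [h, hf]
  exact hE _ ((conj_mem_permsOn g).1 hτ)

theorem IsIrr.core_cases {χ : Perm α → ℝ} (h : IsIrr χ) {k : ℕ} (hk : 2 * k ≤ Fintype.card α)
    (hl : LevGe k χ) (hl' : ¬ LevGe (k + 1) χ) :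
    (∀ E : Finset α, E.card = k → ∀ τ ∈ permsOn E, core χ E τ = 1) ∨
    (∀ E : Finset α, E.card = k → ∀ τ ∈ permsOn E, core χ E τ = sgn τ) ∨
    ∃ u : ℕ, 2 ≤ u ∧ ∀ E : Finset α, E.card = k → core χ E 1 = u := by
  obtain ⟨-, h2⟩ := h.eq_stableSum hk hl hl'
  obtain ⟨u, hu, hu1⟩ := exists_coreDim h.isChar hl hl'
  rcases hu.eq_or_lt with rfl | hu
  · obtain ⟨E₀, hE₀⟩ : ∃ E : Finset α, E.card = k := by
      obtain ⟨E, -, hE⟩ := Finset.exists_subset_card_eq (s := (Finset.univ : Finset α)) (n := k)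
        (by rw [Finset.card_univ]; omega)
      exact ⟨E, hE⟩
    have hirr := core_isIrr h.isChar (E := E₀) (by rw [h2 E₀ hE₀, hE₀])
    have he := core_equivariant h.isChar
    rcases hirr.eq_one_or_sgn (by simpa using hu1 E₀ hE₀) with h3 | h3
    · refine Or.inl fun E hE => he.transfer (hE₀.trans hE.symm) (fun _ _ => rfl) fun τ hτ => ?_
      obtain ⟨ρ, rfl⟩ := exists_ofSubtype_eq hτ
      exact congrFun h3 ρ
    · refine Or.inr (Or.inl fun E hE => he.transfer (hE₀.trans hE.symm) (fun g τ => ?_)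
        fun τ hτ => ?_)
      · rw [sgn_mul, sgn_mul, mul_right_comm, ← sgn_mul, mul_inv_cancel, sgn_one, one_mul]
      obtain ⟨ρ, rfl⟩ := exists_ofSubtype_eq hτ
      have := congrFun h3 ρ
      simpa [sgn, Perm.sign_ofSubtype] using this
  · exact Or.inr (Or.inr ⟨u, hu, hu1⟩)

theorem sum_perm_three (f : Perm (Fin 3) → ℝ) :
    ∑ ρ, f ρ = f 1 + f (swap 0 1) + f (swap 0 2) + f (swap 1 2) + f (swap 0 1 * swap 1 2) +
      f (swap 1 2 * swap 0 1) := by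
  rw [show (Finset.univ : Finset (Perm (Fin 3))) = {1, swap 0 1, swap 0 2, swap 1 2,
    swap 0 1 * swap 1 2, swap 1 2 * swap 0 1} by decide]
  rw [Finset.sum_insert (by decide), Finset.sum_insert (by decide), Finset.sum_insert (by decide),
    Finset.sum_insert (by decide), Finset.sum_insert (by decide), Finset.sum_singleton]
  ring

theorem std_of_sums {f : Perm (Fin 3) → ℝ} (hc : ∀ g τ, f (g * τ * g⁻¹) = f τ) (h1 : f 1 = 2)
    (h0 : ∑ ρ, f ρ = 0) (h2 : ∑ ρ, sgn ρ * f ρ = 0) (ρ : Perm (Fin 3)) :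
    f ρ = ((Finset.univ.filter fun x => ρ x = x).card : ℝ) - 1 := by
  rw [sum_perm_three] at h0 h2
  have e1 : f (swap 0 2) = f (swap 0 1) := by
    rw [← hc (swap 1 2) (swap 0 1)]; congr 1; decide
  have e2 : f (swap 1 2) = f (swap 0 1) := by
    rw [← hc (swap 0 2) (swap 0 1)]; congr 1; decide
  have e3 : f (swap 1 2 * swap 0 1) = f (swap 0 1 * swap 1 2) := by
    rw [← hc (swap 0 1) (swap 1 2 * swap 0 1)]; congr 1; decide
  have s1 : ∀ i j : Fin 3, i ≠ j → sgn (swap i j) = -1 := fun i j h => by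
    rw [sgn, Perm.sign_swap h]; norm_num
  rw [sgn_mul, sgn_mul, sgn_one, s1 _ _ (by decide), s1 _ _ (by decide), s1 _ _ (by decide)] at h2
  rw [e1, e2, e3, h1] at h0 h2
  have hx : f (swap 0 1) = 0 := by linarith
  have hy : f (swap 0 1 * swap 1 2) = -1 := by linarith
  have hρ : ρ ∈ ({1, swap 0 1, swap 0 2, swap 1 2, swap 0 1 * swap 1 2, swap 1 2 * swap 0 1} :
      Finset (Perm (Fin 3))) := by
    revert ρ; decide
  simp only [Finset.mem_insert, Finset.mem_singleton] at hρ
  have hcard : ∀ (τ : Perm (Fin 3)) (m : ℕ), (Finset.univ.filter fun x => τ x = x).card = m →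
      ((Finset.univ.filter fun x => τ x = x).card : ℝ) - 1 = m - 1 := fun τ m h => by rw [h]
  rcases hρ with rfl | rfl | rfl | rfl | rfl | rfl
  · rw [h1, hcard _ 3 (by decide)]; norm_num
  · rw [hx, hcard _ 1 (by decide)]; norm_num
  · rw [e1, hx, hcard _ 1 (by decide)]; norm_num
  · rw [e2, hx, hcard _ 1 (by decide)]; norm_num
  · rw [hy, hcard _ 0 (by decide)]; norm_num
  · rw [e3, hy, hcard _ 0 (by decide)]; norm_num

theorem IsIrr.std_eq {χ : Perm α → ℝ} (h : IsIrr χ) (hα : Fintype.card α = 3) (h1 : χ 1 = 2)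
    (ρ : Perm α) : χ ρ = ((Finset.univ.filter fun x => ρ x = x).card : ℝ) - 1 := by
  obtain ⟨e⟩ : Nonempty (α ≃ Fin 3) := ⟨Fintype.equivFinOfCardEq hα⟩
  have h2 := h.orth (isIrr_of_norm isChar_one (by simp))
  have h3 := h.orth (isIrr_of_norm (isChar_unitHom Perm.sign) (by simp [← Int.cast_mul]))
  rw [if_neg (fun hh => by rw [hh] at h1; norm_num at h1)] at h2 h3
  have key := std_of_sums (f := fun τ => χ (e.symm.permCongr τ))
    (fun g τ => by
      change χ (e.symm.permCongrHom (g * τ * g⁻¹)) = χ (e.symm.permCongrHom τ)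
      rw [map_mul, map_mul, map_inv, h.isChar.conj_eq])
    (by rw [show e.symm.permCongr (1 : Perm (Fin 3)) = 1 by ext x; simp]; exact h1)
    (by rw [Equiv.sum_comp e.symm.permCongr χ]; simpa using h2)
    (by
      rw [← Equiv.sum_comp e.symm.permCongr] at h3
      simpa [sgn, mul_comm] using h3) (e.permCongr ρ)
  have h4 : e.symm.permCongr (e.permCongr ρ) = ρ := by ext x; simp
  simp only [h4] at key
  rw [key]
  congr 2
  exact Finset.card_equiv e.symm fun i => by
    simp [Equiv.permCongr_apply, ← Equiv.eq_symm_apply]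

theorem fixIn_ofSubtype {E : Finset α} (ρ : Perm {x // x ∈ E}) :
    fixIn (Perm.ofSubtype ρ) E = (Finset.univ.filter fun x => ρ x = x).card := by
  rw [fixIn]
  symm
  refine Finset.card_bij (fun x _ => (x : α)) (fun x hx => ?_) (fun x _ y _ => Subtype.ext)
    fun x hx => ?_
  · rw [Finset.mem_filter, Perm.ofSubtype_apply_coe, (Finset.mem_filter.1 hx).2]
    exact ⟨x.2, rfl⟩
  · rw [Finset.mem_filter] at hx
    have := hx.2
    rw [Perm.ofSubtype_apply_of_mem ρ hx.1] at this
    exact ⟨⟨x, hx.1⟩, Finset.mem_filter.2 ⟨Finset.mem_univ _, Subtype.ext this⟩, rfl⟩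

theorem fixIn_restr {σ : Perm α} {A : Finset α} (h : IsInv σ A) :
    fixIn (restr σ A) A = cnIn σ A 1 := by
  rw [fixIn, cnIn]
  refine Finset.card_bij (fun x _ => {x}) (fun x hx => ?_)
    (fun x hx y hy hxy => Finset.singleton_injective hxy) fun O hO => ?_
  · rw [Finset.mem_filter, restr_apply h] at hx
    rw [if_pos hx.1] at hx
    rw [Finset.mem_filter, orbsIn, Finset.mem_filter, ← orb_eq_singleton hx.2,
      orb_eq_singleton hx.2]
    refine ⟨⟨?_, Finset.singleton_subset_iff.2 hx.1⟩, Finset.card_singleton x⟩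
    rw [← orb_eq_singleton hx.2]
    exact orb_mem_orbs σ x
  · rw [Finset.mem_filter, orbsIn, Finset.mem_filter] at hO
    obtain ⟨x, rfl⟩ := Finset.card_eq_one.1 hO.2
    have hx := Finset.singleton_subset_iff.1 hO.1.2
    refine ⟨x, Finset.mem_filter.2 ⟨hx, ?_⟩, rfl⟩
    rw [restr_apply h, if_pos hx]
    exact Finset.mem_singleton.1 (inv_of_mem_orbs hO.1.1 x (Finset.mem_singleton_self x))

theorem stableSum_of_std {φ : Finset α → Perm α → ℝ} (h : Equivariant φ)
    (hk : 3 ≤ Fintype.card α)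
    (h1 : ∀ E : Finset α, E.card = 3 → ∀ τ ∈ permsOn E, φ E τ = fixIn τ E - 1)
    (h2 : ∀ E : Finset α, E.card = 3 → ∑ τ ∈ permsOn E, sgn τ * φ E τ = 0) (σ : Perm α) :
    stableSum φ 3 σ = 2 * famSum (fun l => if l = 1 then 1 else if l = 3 then -1 / 2 else 0)
      (orbs σ) 3 - 2 * famSum (fun l => if l = 1 then 1 else 0) (orbs σ) 2 +
      famSum (fun _ => 1) (orbs σ) 1 := by
  simp only [stableSum, ← sum_wt_eq, Finset.mul_sum]
  rw [← Finset.sum_sub_distrib, ← Finset.sum_add_distrib]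
  refine Finset.sum_congr rfl fun A hA => ?_
  have hA := (Finset.mem_filter.1 hA).2
  rw [coef_of_std h hk h1 h2 (restr_mem _ _), fixIn_restr hA, wt_one]
  obtain h3 | h3 : 5 ≤ A.card ∨ A.card ≤ 4 := by omega
  · rw [if_neg (by omega), if_neg (by omega), if_neg (by omega), if_neg (by omega),
      if_neg (by omega)]
    norm_num
  obtain ⟨h4, -⟩ := cnIn_eq_of_le_four hA h3 fun _ => 1
  rw [(cnIn_eq_of_le_four hA h3 _).2, (cnIn_eq_of_le_four hA h3 _).2]
  set i := cnIn σ A 1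
  set j := cnIn σ A 2
  set k := cnIn σ A 3
  set l := cnIn σ A 4
  obtain h5 | h5 | h5 | h5 | h5 : A.card = 0 ∨ A.card = 1 ∨ A.card = 2 ∨ A.card = 3 ∨ A.card = 4 := by
    omega
  · simp [h5]
  · simp [h5]
  · have hk0 : k = 0 := by omega
    have hl0 : l = 0 := by omega
    obtain ⟨hi, hj, hk, hl⟩ | ⟨hi, hj, hk, hl⟩ : (i = 0 ∧ j = 1 ∧ k = 0 ∧ l = 0) ∨
        (i = 2 ∧ j = 0 ∧ k = 0 ∧ l = 0) := by omega
    all_goals simp [h5, hi, hj, hk, hl]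
  · have hl0 : l = 0 := by omega
    have hk0 : k = 0 ∨ k = 1 := by omega
    obtain ⟨hi, hj, hk, hl⟩ | ⟨hi, hj, hk, hl⟩ | ⟨hi, hj, hk, hl⟩ :
        (i = 0 ∧ j = 0 ∧ k = 1 ∧ l = 0) ∨ (i = 1 ∧ j = 1 ∧ k = 0 ∧ l = 0) ∨
        (i = 3 ∧ j = 0 ∧ k = 0 ∧ l = 0) := by omega
    all_goals simp [h5, hi, hj, hk, hl] <;> norm_num
  · simp [h5]

set_option maxRecDepth 100000 in
theorem four_cycle_sq_le {f : Perm (Fin 4) → ℝ} (hc : ∀ g τ, f (g * τ * g⁻¹) = f τ)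
    (h2 : ∑ ρ, f ρ * f ρ = 24) {ρ : Perm (Fin 4)} (hρ : ∀ x, ρ x ≠ x ∧ ρ (ρ x) ≠ x) :
    6 * f ρ ^ 2 + f 1 ^ 2 ≤ 24 := by
  have h3 : ∀ τ : Perm (Fin 4), (∀ x, τ x ≠ x ∧ τ (τ x) ≠ x) →
      ∃ g : Perm (Fin 4), g * finRotate 4 * g⁻¹ = τ := by decide
  have h4 : ∀ τ : Perm (Fin 4), (∀ x, τ x ≠ x ∧ τ (τ x) ≠ x) → f τ = f (finRotate 4) := by
    intro τ hτ
    obtain ⟨g, hg⟩ := h3 τ hτ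
    rw [← hg, hc]
  have h5 : (Finset.univ.filter fun τ : Perm (Fin 4) => ∀ x, τ x ≠ x ∧ τ (τ x) ≠ x).card = 6 := by
    decide
  rw [← h2, h4 ρ hρ]
  refine le_trans (le_of_eq ?_) (Finset.sum_le_sum_of_subset_of_nonneg (s := insert 1
    (Finset.univ.filter fun τ : Perm (Fin 4) => ∀ x, τ x ≠ x ∧ τ (τ x) ≠ x))
    (Finset.subset_univ _) fun _ _ _ => mul_self_nonneg _)
  rw [Finset.sum_insert (by simp), Finset.sum_congr rfl fun τ hτ => by
    rw [h4 τ (Finset.mem_filter.1 hτ).2], Finset.sum_const, h5, nsmul_eq_mul]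
  push_cast
  ring

theorem IsIrr.four_cycle_sq_le {χ : Perm α → ℝ} (h : IsIrr χ) (hα : Fintype.card α = 4)
    {ρ : Perm α} (hρ : ∀ x, ρ x ≠ x ∧ ρ (ρ x) ≠ x) : 6 * χ ρ ^ 2 + χ 1 ^ 2 ≤ 24 := by
  obtain ⟨e⟩ : Nonempty (α ≃ Fin 4) := ⟨Fintype.equivFinOfCardEq hα⟩
  have h2 := h.norm_eq
  rw [Fintype.card_perm, hα] at h2
  have key := _root_.four_cycle_sq_le (f := fun τ => χ (e.symm.permCongr τ))
    (fun g τ => by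
      change χ (e.symm.permCongrHom (g * τ * g⁻¹)) = χ (e.symm.permCongrHom τ)
      rw [map_mul, map_mul, map_inv, h.isChar.conj_eq])
    (by
      rw [← Equiv.sum_comp e.symm.permCongr] at h2
      rw [h2]
      norm_num [Nat.factorial]) (ρ := e.permCongr ρ) fun x => by
        have := hρ (e.symm x)
        simp only [Equiv.permCongr_apply, Equiv.symm_apply_apply, ne_eq]
        exact ⟨fun hh => this.1 (e.injective (by simpa using hh)),
          fun hh => this.2 (e.injective (by simpa using hh))⟩
  have h4 : e.symm.permCongr (e.permCongr ρ) = ρ := by ext x; simp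
  have h5 : e.symm.permCongr (1 : Perm (Fin 4)) = 1 := by ext x; simp
  simpa only [h4, h5] using key

end SmallLevels

section LevelFormulas

open Equiv

set_option linter.unusedSectionVars false

variable {α : Type} [Fintype α] [DecidableEq α]

theorem IsIrr.eq_of_core_one {χ : Perm α → ℝ} (h : IsIrr χ) {k : ℕ}
    (hk : 2 * (k + 1) ≤ Fintype.card α) (hl : LevGe (k + 1) χ) (hl' : ¬ LevGe (k + 2) χ)
    (h1 : ∀ E : Finset α, E.card = k + 1 → ∀ τ ∈ permsOn E, core χ E τ = 1) (σ : Perm α) :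
    χ σ = famSum (fun _ => 1) (orbs σ) (k + 1) - famSum (fun _ => 1) (orbs σ) k := by
  rw [(h.eq_stableSum hk hl hl').1,
    stableSum_of_trivial (core_equivariant h.isChar) (by omega) h1]

theorem IsIrr.core_sq_le {χ : Perm α → ℝ} (h : IsIrr χ) {k : ℕ} (hk : 2 * k ≤ Fintype.card α)
    (hl : LevGe k χ) (hl' : ¬ LevGe (k + 1) χ) {u : ℕ} (hu : 1 ≤ k)
    (h1 : ∀ E : Finset α, E.card = k → core χ E 1 = u) : u ^ 2 ≤ k.factorial := by
  obtain ⟨E, -, hE⟩ := Finset.exists_subset_card_eq (s := (Finset.univ : Finset α)) (n := k)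
        (by rw [Finset.card_univ]; omega)
  have h2 := (h.eq_stableSum hk hl hl').2 E hE
  have h3 := Finset.single_le_sum (fun τ _ => sq_nonneg (core χ E τ)) (one_mem_permsOn E)
  rw [h2, h1 E hE] at h3
  exact_mod_cast h3

theorem IsIrr.level_one {χ : Perm α → ℝ} (h : IsIrr χ) (hn : 2 ≤ Fintype.card α)
    (hl : LevGe 1 χ) (hl' : ¬ LevGe 2 χ) (σ : Perm α) : χ σ = cn σ 1 - 1 := by
  have key : (∀ E : Finset α, E.card = 1 → ∀ τ ∈ permsOn E, core χ E τ = 1) := by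
    rcases h.core_cases hn hl hl' with h1 | h1 | ⟨u, hu, h1⟩
    · exact h1
    · intro E hE τ hτ
      rw [h1 E hE τ hτ]
      obtain ⟨x, rfl⟩ := Finset.card_eq_one.1 hE
      have : τ = 1 := by
        ext y
        by_cases hy : y = x
        · have := apply_mem_of_permsOn hτ (Finset.mem_singleton.2 hy)
          rw [Finset.mem_singleton.1 this, hy]
          rfl
        · exact mem_permsOn.1 hτ y (by simpa using hy)
      rw [this, sgn_one]
    · have := h.core_sq_le hn hl hl' le_rfl h1
      norm_num at this
      nlinarith
  rw [h.eq_of_core_one hn hl hl' key, famSum_one _ (orbs_card_pos σ),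
    famSum_zero _ (orbs_card_pos σ), one_mul]
  rfl

theorem IsIrr.level_two {χ : Perm α → ℝ} (h : IsIrr χ) (hn : 4 ≤ Fintype.card α)
    (hl : LevGe 2 χ) (hl' : ¬ LevGe 3 χ) :
    (∀ σ, χ σ = (cn σ 1 : ℝ) * (cn σ 1 - 3) / 2 + cn σ 2) ∨
    ∀ σ, χ σ = ((cn σ 1 : ℝ) - 1) * (cn σ 1 - 2) / 2 - cn σ 2 := by
  rcases h.core_cases (k := 2) hn hl hl' with h1 | h1 | ⟨u, hu, h1⟩
  · refine Or.inl fun σ => ?_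
    rw [h.eq_of_core_one (k := 1) hn hl hl' h1, famSum_two _ (orbs_card_pos σ) rfl rfl,
      famSum_one _ (orbs_card_pos σ), cn, cn, orbN, orbN]
    ring
  · refine Or.inr fun σ => ?_
    rw [(h.eq_stableSum (k := 2) hn hl hl').1,
      stableSum_of_sgn (core_equivariant h.isChar) (by omega) h1]
    simp only [Finset.sum_range_succ, Finset.range_zero, Finset.sum_empty]
    rw [famSum_two _ (orbs_card_pos σ) rfl rfl, famSum_zero _ (orbs_card_pos σ),
      famSum_one _ (orbs_card_pos σ), cn, cn, orbN, orbN]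
    norm_num
    ring
  · have := h.core_sq_le (k := 2) hn hl hl' (by norm_num) h1
    norm_num at this
    nlinarith

theorem IsIrr.level_three {χ : Perm α → ℝ} (h : IsIrr χ) (hn : 6 ≤ Fintype.card α)
    (hl : LevGe 3 χ) (hl' : ¬ LevGe 4 χ) :
    (∀ σ, χ σ = (cn σ 1 : ℝ) * (cn σ 1 - 1) * (cn σ 1 - 5) / 6 + (cn σ 1 - 1) * cn σ 2 + cn σ 3) ∨
    (∀ σ, χ σ = (cn σ 1 : ℝ) * (cn σ 1 - 2) * (cn σ 1 - 4) / 3 - cn σ 3) ∨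
    ∀ σ, χ σ = ((cn σ 1 : ℝ) - 1) * (cn σ 1 - 2) * (cn σ 1 - 3) / 6 - (cn σ 1 - 1) * cn σ 2
      + cn σ 3 := by
  rcases h.core_cases (k := 3) hn hl hl' with h1 | h1 | ⟨u, hu, h1⟩
  · refine Or.inl fun σ => ?_
    rw [h.eq_of_core_one (k := 2) hn hl hl' h1, famSum_three _ (orbs_card_pos σ) rfl rfl rfl,
      famSum_two _ (orbs_card_pos σ) rfl rfl]
    simp only [cn, orbN]
    ring
  · refine Or.inr (Or.inr fun σ => ?_)
    rw [(h.eq_stableSum (k := 3) hn hl hl').1,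
      stableSum_of_sgn (core_equivariant h.isChar) (by omega) h1]
    simp only [Finset.sum_range_succ, Finset.range_zero, Finset.sum_empty]
    rw [famSum_two _ (orbs_card_pos σ) rfl rfl, famSum_zero _ (orbs_card_pos σ),
      famSum_one _ (orbs_card_pos σ), famSum_three _ (orbs_card_pos σ) rfl rfl rfl]
    simp only [cn, orbN]
    norm_num
    ring
  · refine Or.inr (Or.inl fun σ => ?_)
    have hu2 := h.core_sq_le (k := 3) hn hl hl' (by norm_num) h1
    norm_num [Nat.factorial] at hu2
    obtain rfl : u = 2 := by nlinarith
    obtain ⟨h2, h3⟩ := h.eq_stableSum (k := 3) hn hl hl'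
    have hirr : ∀ E : Finset α, E.card = 3 → _ := fun E hE =>
      core_isIrr h.isChar (E := E) (by rw [h3 E hE, hE])
    rw [h2, stableSum_of_std (core_equivariant h.isChar) (by omega)]
    · rw [famSum_two _ (orbs_card_pos σ) rfl rfl, famSum_one _ (orbs_card_pos σ),
        famSum_three _ (orbs_card_pos σ) rfl rfl rfl]
      simp only [cn, orbN]
      norm_num
      ring
    · intro E hE τ hτ
      obtain ⟨ρ, rfl⟩ := exists_ofSubtype_eq hτ
      rw [fixIn_ofSubtype, ← (hirr E hE).std_eq (by rw [Fintype.card_coe, hE])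
        (by simpa using h1 E hE)]
    · intro E hE
      rw [sum_permsOn]
      have := (hirr E hE).orth (isIrr_of_norm (isChar_unitHom Perm.sign) (by simp [← Int.cast_mul]))
      rw [if_neg fun hh => by
        have h4 := congrFun hh 1
        simp only [map_one, h1 E hE] at h4
        norm_num at h4] at this
      rw [← this]
      exact Finset.sum_congr rfl fun ρ _ => by rw [sgn, Perm.sign_ofSubtype, mul_comm]

theorem not_small_cycle {σ : Perm α} {A : Finset α} (hA : A ∈ orbs σ) (h3 : 3 ≤ A.card) {x : α}
    (hx : x ∈ A) : σ x ≠ x ∧ σ (σ x) ≠ x := by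
  have h1 := eq_orb_of_mem hA hx
  have h2 : σ (σ x) ≠ x := by
    intro hh
    have h4 : orb σ x ⊆ {x, σ x} := by
      refine orb_subset (fun y hy => ?_) (Finset.mem_insert_self _ _)
      simp only [Finset.mem_insert, Finset.mem_singleton] at hy ⊢
      rcases hy with rfl | rfl
      · exact Or.inr rfl
      · exact Or.inl hh
    have h5 := Finset.card_le_card h4
    rw [← h1] at h5
    have := h5.trans Finset.card_le_two
    omega
  exact ⟨fun hh => h2 (by rw [hh, hh]), h2⟩

theorem IsIrr.core_four_cycle_le {χ : Perm α → ℝ} (h : IsIrr χ) (hn : 8 ≤ Fintype.card α)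
    (hl : LevGe 4 χ) (hl' : ¬ LevGe 5 χ) :
    (∀ σ, χ σ = famSum (fun _ => 1) (orbs σ) 4 - famSum (fun _ => 1) (orbs σ) 3) ∨
    ∃ u : ℕ, 1 ≤ u ∧ (∀ E : Finset α, E.card = 4 → core χ E 1 = u) ∧
      ∀ σ, ∀ A ∈ orbs σ, A.card = 4 → core χ A (restr σ A) ≤ u * (23 / 25) := by
  rcases h.core_cases (k := 4) hn hl hl' with h1 | h1 | ⟨u, hu, h1⟩
  · exact Or.inl fun σ => h.eq_of_core_one (k := 3) hn hl hl' h1 σ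
  · refine Or.inr ⟨1, le_rfl, fun E hE => ?_, fun σ A hA hA4 => ?_⟩
    · rw [h1 E hE _ (one_mem_permsOn E), sgn_one]
      norm_num
    · rw [h1 A hA4 _ (restr_mem _ _)]
      have := sgn_restr_biUnion σ (S := {A}) (Finset.singleton_subset_iff.2 hA)
      rw [Finset.singleton_biUnion, Finset.prod_singleton, hA4] at this
      rw [show restr σ A = restr σ (id A) from rfl, this]
      norm_num
  · refine Or.inr ⟨u, by omega, h1, fun σ A hA hA4 => ?_⟩
    have h3 := (h.eq_stableSum (k := 4) hn hl hl').2 A hA4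
    obtain ⟨ρ, hρ⟩ := exists_ofSubtype_eq (restr_mem σ A)
    have hirr := core_isIrr h.isChar (E := A) (by rw [h3, hA4])
    have h4 := hirr.four_cycle_sq_le (by rw [Fintype.card_coe, hA4]) (ρ := ρ) fun x => by
      have h5 : ∀ y : {x // x ∈ A}, (ρ y : α) = σ y := fun y => by
        rw [← Perm.ofSubtype_apply_coe, hρ, restr_apply (inv_of_mem_orbs hA), if_pos y.2]
      have h6 := not_small_cycle hA (by omega) x.2
      rw [← h5, ← h5] at h6
      exact ⟨fun hh => h6.1 (congrArg _ hh), fun hh => h6.2 (congrArg _ hh)⟩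
    rw [hρ, map_one, h1 A hA4] at h4
    have hu' : (2 : ℝ) ≤ u := by exact_mod_cast hu
    refine le_of_sq_le_sq ?_ (by positivity)
    nlinarith

end LevelFormulas

section LevelFour

open Equiv

set_option linter.unusedSectionVars false

variable {α : Type} [Fintype α] [DecidableEq α]

theorem mem_orbs_of_cnIn {σ : Perm α} {A : Finset α} {l : ℕ} (hA : A.card = l)
    (h : 1 ≤ cnIn σ A l) : A ∈ orbs σ := by
  obtain ⟨O, hO⟩ := Finset.card_pos.1 h
  rw [Finset.mem_filter, orbsIn, Finset.mem_filter] at hO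
  rw [← Finset.eq_of_subset_of_card_le hO.1.2 (by omega)]
  exact hO.1.1

theorem stableSum_le_of_four_cycle {φ : Finset α → Perm α → ℝ} (h : Equivariant φ)
    (hk : 4 ≤ Fintype.card α) {u : ℝ}
    (hu : ∀ E : Finset α, E.card = 4 → ∀ τ ∈ permsOn E, |φ E τ| ≤ u) {σ : Perm α}
    (h4 : ∀ A ∈ orbs σ, A.card = 4 → φ A (restr σ A) ≤ u * (23 / 25)) :
    stableSum φ 4 σ ≤ u * (∑ j ∈ Finset.range 4, famSum (fun _ => 1) (orbs σ) j +
      famSum (fun l => if l = 4 then 23 / 25 else 1) (orbs σ) 4) := by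
  simp only [stableSum, ← sum_wt_eq]
  rw [Finset.sum_comm, ← Finset.sum_add_distrib, Finset.mul_sum]
  refine Finset.sum_le_sum fun A hA => ?_
  have hA := (Finset.mem_filter.1 hA).2
  simp only [wt_one, Finset.sum_ite_eq, Finset.mem_range]
  have h0 : A.card ≤ 4 → coef φ 4 A (restr σ A) ≤ u := fun hc =>
    (le_abs_self _).trans (abs_coef_le h hk hu hc (restr_mem _ _))
  obtain h3 | h3 | h3 : A.card < 4 ∨ A.card = 4 ∨ 4 < A.card := by omega
  · rw [if_pos h3, if_neg (by omega)]
    linarith [h0 h3.le]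
  · rw [if_neg (by omega), if_pos h3, (cnIn_eq_of_le_four hA h3.le _).2]
    have h5 := (cnIn_eq_of_le_four hA h3.le fun _ => 1).1
    obtain h6 | h6 : cnIn σ A 4 = 0 ∨ cnIn σ A 4 = 1 := by omega
    · simp only [h6, Nat.reduceEqDiff, reduceIte, one_pow, pow_zero, mul_one]
      have := h0 h3.le
      norm_num
      linarith
    · have h7 := mem_orbs_of_cnIn (σ := σ) h3 (by omega)
      have h8 := h4 A h7 h3
      have h9 : coef φ 4 A (restr σ A) = φ A (restr σ A) := by
        rw [← coef_of_card h (restr_mem σ A), h3]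
      rw [h9, h6]
      norm_num
      linarith
  · rw [coef_eq_zero _ h3, if_neg (by omega), if_neg (by omega)]
    norm_num

theorem IsIrr.level_four {χ : Perm α → ℝ} (h : IsIrr χ) (hn : 8 ≤ Fintype.card α)
    (hl : LevGe 4 χ) (hl' : ¬ LevGe 5 χ) :
    (∀ σ, χ σ = (cn σ 1 : ℝ) * (cn σ 1 - 1) * (cn σ 1 - 2) * (cn σ 1 - 7) / 24 +
      ((cn σ 1 : ℝ) ^ 2 - 3 * cn σ 1 - 1) * cn σ 2 / 2 + (cn σ 2 : ℝ) ^ 2 / 2 +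
      (cn σ 1 - 1) * cn σ 3 + cn σ 4) ∨
    ∃ u : ℝ, 1 ≤ u ∧ (∀ σ, cn σ 1 = 1 → cn σ 2 ≤ 1 →
        χ σ ≤ u * (23 / 25 * cn σ 4 + 2 * cn σ 3 + 4)) ∧
      u * ((Fintype.card α).choose 4 - ∑ i ∈ Finset.range 4, (Fintype.card α).choose i : ℝ) ≤ χ 1 := by
  rcases h.core_four_cycle_le hn hl hl' with h1 | ⟨u, hu, h1, h2⟩
  · refine Or.inl fun σ => ?_
    rw [h1, famSum_four _ (orbs_card_pos σ) rfl rfl rfl rfl,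
      famSum_three _ (orbs_card_pos σ) rfl rfl rfl]
    simp only [cn, orbN]
    ring
  · have he := core_equivariant h.isChar
    have h3 := (h.eq_stableSum (k := 4) hn hl hl').1
    have h4 : ∀ E : Finset α, E.card = 4 → ∀ τ ∈ permsOn E, |core χ E τ| ≤ u := fun E hE τ hτ => by
      rw [← h1 E hE]
      exact abs_core_le h.isChar hτ
    have hu1 : (1 : ℝ) ≤ u := by exact_mod_cast hu
    refine Or.inr ⟨u, hu1, fun σ hc1 hc2 => ?_, ?_⟩
    · rw [h3]
      refine (stableSum_le_of_four_cycle he (by omega) h4 (h2 σ)).trans ?_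
      refine mul_le_mul_of_nonneg_left ?_ (by positivity)
      simp only [Finset.sum_range_succ, Finset.range_zero, Finset.sum_empty]
      rw [famSum_four _ (orbs_card_pos σ) rfl rfl rfl rfl,
        famSum_three _ (orbs_card_pos σ) rfl rfl rfl, famSum_two _ (orbs_card_pos σ) rfl rfl,
        famSum_one _ (orbs_card_pos σ), famSum_zero _ (orbs_card_pos σ)]
      simp only [cn, orbN] at hc1 hc2 ⊢
      rw [hc1]
      generalize ((orbs σ).filter fun O => O.card = 2).card = b at *
      interval_cases b <;> norm_num <;> linarith
    · rw [mul_sub, h3 1]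
      have := stableSum_one_ge he (by omega) h4 h1
      push_cast at this ⊢
      exact this

end LevelFour

section CycleCounts

open Equiv

set_option linter.unusedSectionVars false

variable {α : Type} [Fintype α] [DecidableEq α]

theorem mul_cn_eq_sum (σ : Perm α) (l : ℕ) :
    l * cn σ l = ∑ O ∈ orbs σ, if O.card = l then l else 0 := by
  rw [← Finset.sum_filter, Finset.sum_const, cn, orbN, smul_eq_mul, mul_comm]

theorem sum_cn_le (σ : Perm α) :
    cn σ 1 + 2 * cn σ 2 + 3 * cn σ 3 + 4 * cn σ 4 ≤ Fintype.card α := by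
  rw [← one_mul (cn σ 1), mul_cn_eq_sum, mul_cn_eq_sum, mul_cn_eq_sum, mul_cn_eq_sum,
    ← Finset.sum_add_distrib, ← Finset.sum_add_distrib, ← Finset.sum_add_distrib,
    ← sum_card_orbs σ]
  refine Finset.sum_le_sum fun O hO => ?_
  split_ifs <;> omega

theorem cn_one_one : cn (1 : Perm α) 1 = Fintype.card α := by
  simp [cn_one]

theorem cn_one_of_two_le {l : ℕ} (hl : 2 ≤ l) : cn (1 : Perm α) l = 0 := by
  simp [cn_of_two_le _ hl]

theorem sgn_eq_of_two_three {σ : Perm α}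
    (h : 2 * cn σ 2 + 3 * cn σ 3 = Fintype.card α) : sgn σ = (-1) ^ cn σ 2 := by
  have h1 : ∀ O ∈ orbs σ, ((if O.card = 2 then 2 else 0) + if O.card = 3 then 3 else 0) = O.card := by
    refine (Finset.sum_eq_sum_iff_of_le fun O _ => by split_ifs <;> omega).1 ?_
    rw [Finset.sum_add_distrib, ← mul_cn_eq_sum, ← mul_cn_eq_sum, h, sum_card_orbs]
  have h2 := sgn_restr_biUnion σ (Finset.Subset.refl (orbs σ))
  have h3 : (orbs σ).biUnion id = Finset.univ := by
    rw [← Finset.card_eq_iff_eq_univ, card_biUnion_orbs (Finset.Subset.refl _), sum_card_orbs]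
  rw [h3, restr_eq_self (by rw [permsOn_univ]; exact Finset.mem_univ _)] at h2
  rw [h2, cn, orbN, ← Finset.prod_const, Finset.prod_filter]
  refine Finset.prod_congr rfl fun O hO => ?_
  have h4 := h1 O hO
  have h5 := (orbs_nonempty hO).card_pos
  split_ifs with h6
  · rw [h6]; norm_num
  · have : O.card = 3 := by split_ifs at h4 <;> omega
    rw [this]; norm_num

theorem level_one_degree {χ : Perm α → ℝ} (h : IsIrr χ) (hn : 2 ≤ Fintype.card α)
    (hl : LevGe 1 χ) (hl' : ¬ LevGe 2 χ) : χ 1 = Fintype.card α - 1 := by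
  rw [h.level_one hn hl hl', cn_one_one]

/-- A fixed point can be removed at the cost of one level. -/
theorem IsIrr.abs_le_of_fixed_succ {s n : ℕ} {b : ℝ}
    (ih : ∀ (α : Type) [Fintype α] [DecidableEq α] (σ : Perm α) (χ : Perm α → ℝ),
      Fintype.card α = n → cn σ 1 + s = n → IsIrr χ → LL 1 χ →
        |χ σ| ≤ max (((cn σ 1 : ℝ) - 1) / (n - 1)) b * χ 1)
    (hn : s + 2 ≤ n) {χ : Perm α → ℝ} (h : IsIrr χ) (hL : LL 1 χ)
    (hc : Fintype.card α = n + 1) {σ : Perm α} (hσ : cn σ 1 + s = n + 1) :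
    |χ σ| ≤ max (((cn σ 1 : ℝ) - 1) / ((n + 1 : ℕ) - 1)) b * χ 1 := by
  have hn0 : (2 : ℝ) ≤ n := by
    have : 2 ≤ n := by omega
    exact_mod_cast this
  have h1 := h.one_pos
  have hc3 : (3 : ℝ) ≤ cn σ 1 := by
    have : 3 ≤ cn σ 1 := by omega
    exact_mod_cast this
  rcases hL.dichotomy 2 with h2 | ⟨k, hk, hkn, -, ψ, hψ, h3, h4⟩
  · have hcard : (Finset.univ.filter fun x => σ x = x).Nonempty := by
      rw [← Finset.card_pos, ← cn_one]; omega
    obtain ⟨x, hx⟩ := hcard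
    have hx := (Finset.mem_filter.1 hx).2
    obtain ⟨ρ, hσρ, hρ⟩ := exists_ofSubtype_support σ (F := {x}) (by simpa using hx)
    have hcard : Fintype.card {y // y ∈ ({x} : Finset α)ᶜ} = n := by
      rw [Fintype.card_coe, Finset.card_compl, Finset.card_singleton]; omega
    have hcn : cn ρ 1 + 1 = cn σ 1 := by
      rw [cn_one, cn_one, ← Finset.card_erase_add_one (a := x)
        (s := Finset.univ.filter fun x => σ x = x) (by simpa using hx)]
      congr 1
      refine Finset.card_bij (fun i _ => (i : α)) ?_ ?_ ?_
      · intro i hi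
        have hi' := congrArg Subtype.val (Finset.mem_filter.1 hi).2
        rw [hρ] at hi'
        have := i.2
        simp only [Finset.mem_compl, Finset.mem_singleton] at this
        simp [hi', this]
      · intro i _ j _ hij
        exact Subtype.ext hij
      · intro y hy
        simp only [Finset.mem_erase, Finset.mem_filter, Finset.mem_univ, true_and] at hy
        refine ⟨⟨y, by simp [hy.1]⟩, ?_, rfl⟩
        simp only [Finset.mem_filter, Finset.mem_univ, true_and]
        exact Subtype.ext (by rw [hρ]; exact hy.2)
    have h5 := h.isChar.abs_le_of_res (B := ({x} : Finset α)ᶜ) (k := 1) (ρ := ρ)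
      (by rw [compl_compl, Finset.card_singleton]; exact h2)
      fun ψ hψ hl => ih _ ρ ψ hcard (by omega) hψ hl
    rw [← hσρ] at h5
    refine h5.trans (mul_le_mul_of_nonneg_right ?_ (by linarith))
    refine max_le_max ?_ le_rfl
    have : (cn σ 1 : ℝ) = cn ρ 1 + 1 := by exact_mod_cast hcn.symm
    have h6 : (cn ρ 1 : ℝ) ≤ n := by
      have : cn ρ 1 ≤ n := by omega
      exact_mod_cast this
    rw [div_le_div_iff₀ (by linarith) (by push_cast; linarith), this]
    push_cast
    nlinarith
  · obtain rfl : k = 1 := by omega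
    have h5 : ∀ ψ : Perm α → ℝ, IsIrr ψ → LevGe 1 ψ → ¬ LevGe 2 ψ →
        |ψ σ| ≤ max (((cn σ 1 : ℝ) - 1) / ((n + 1 : ℕ) - 1)) b * ψ 1 := fun ψ hψ a c => by
      refine le_trans (le_of_eq ?_) (mul_le_mul_of_nonneg_right (le_max_left _ _)
        (by linarith [hψ.one_pos]))
      rw [level_one_degree hψ (by omega) a c, hψ.level_one (by omega) a c, hc,
        abs_of_nonneg (by linarith), div_mul_cancel₀ _ (by push_cast; linarith)]
    rcases hψ with rfl | rfl
    · exact h5 _ h h3 h4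
    · have := h5 _ h.tw h3 h4
      rwa [abs_tw, _root_.tw_one] at this

theorem abs_le_of_base {s m : ℕ} {b : ℝ} (hm : s + 2 ≤ m)
    (base : ∀ (α : Type) [Fintype α] [DecidableEq α] (σ : Perm α) (χ : Perm α → ℝ),
      Fintype.card α = m → cn σ 1 + s = m → IsIrr χ → LL 1 χ →
        |χ σ| ≤ max (((cn σ 1 : ℝ) - 1) / (m - 1)) b * χ 1) {n : ℕ} (hn : m ≤ n) :
    ∀ (α : Type) [Fintype α] [DecidableEq α] (σ : Perm α) (χ : Perm α → ℝ),
      Fintype.card α = n → cn σ 1 + s = n → IsIrr χ → LL 1 χ →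
        |χ σ| ≤ max (((cn σ 1 : ℝ) - 1) / (n - 1)) b * χ 1 := by
  induction n, hn using Nat.le_induction with
  | base => exact base
  | succ n hn ih =>
    intro α _ _ σ χ hc hσ h hL
    exact h.abs_le_of_fixed_succ (fun α _ _ => ih α) (by omega) hL hc hσ

theorem exists_two_fixed : ∃ n₀ : ℕ, ∀ (α : Type) [Fintype α] [DecidableEq α] (σ : Perm α)
    (χ : Perm α → ℝ), n₀ ≤ Fintype.card α → cn σ 1 = 2 → IsIrr χ → LL 1 χ →
      |χ σ| * (Fintype.card α - 1) ≤ χ 1 := by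
  obtain ⟨C, hC, hb⟩ := exists_level_bound (r := 2) (j := 2) (m := 3) le_rfl (by omega)
    (by intro k hk hk'; interval_cases k <;> norm_num)
  refine ⟨72 + ⌈C⌉₊, fun α _ _ σ χ hn hσ h hL => ?_⟩
  have h1 := h.one_pos
  have hn72 : (72 : ℝ) ≤ Fintype.card α := by
    have : 72 ≤ Fintype.card α := by omega
    exact_mod_cast this
  have hsum := sum_cn_le σ
  rcases hL.dichotomy 3 with h2 | ⟨k, hk, hkn, -, ψ, hψ, h3, h4⟩
  · have h5 := hb α σ χ (by omega) (by rw [small_orbits_two, hσ]) h h2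
    have hnC : C ≤ Fintype.card α := (Nat.le_ceil C).trans (by
      have : ⌈C⌉₊ ≤ Fintype.card α := by omega
      exact_mod_cast this)
    set n : ℝ := (Fintype.card α : ℝ)
    have h6 : |χ σ| * n * n ≤ χ 1 * n := by nlinarith
    have h7 : |χ σ| * n ≤ χ 1 := le_of_mul_le_mul_right h6 (by linarith)
    nlinarith [abs_nonneg (χ σ)]
  · have h5 : ∀ ψ : Perm α → ℝ, IsIrr ψ → LevGe k ψ → ¬ LevGe (k + 1) ψ →
        |ψ σ| * (Fintype.card α - 1) ≤ ψ 1 := fun ψ hψ a c => by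
      have hs : 2 * (cn σ 2 : ℝ) + 2 ≤ Fintype.card α := by
        have : 2 * cn σ 2 + 2 ≤ Fintype.card α := by omega
        exact_mod_cast this
      have h0 : (0 : ℝ) ≤ cn σ 2 := by positivity
      interval_cases k
      · rw [level_one_degree hψ (by omega) a c, hψ.level_one (by omega) a c, hσ]
        norm_num
      · rcases hψ.level_two (by omega) a c with h6 | h6
        · rw [h6, h6, hσ, cn_one_one, cn_one_of_two_le le_rfl]
          have : |((2 : ℕ) : ℝ) * ((2 : ℕ) - 3) / 2 + cn σ 2| ≤ (Fintype.card α - 4) / 2 := by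
            rw [abs_le]; constructor <;> push_cast <;> linarith
          refine (mul_le_mul_of_nonneg_right this (by linarith)).trans ?_
          push_cast
          nlinarith
        · rw [h6, h6, hσ, cn_one_one, cn_one_of_two_le le_rfl]
          have : |(((2 : ℕ) : ℝ) - 1) * ((2 : ℕ) - 2) / 2 - cn σ 2| ≤ (Fintype.card α - 2) / 2 := by
            rw [abs_le]; constructor <;> push_cast <;> linarith
          refine (mul_le_mul_of_nonneg_right this (by linarith)).trans ?_
          push_cast
          nlinarith
    rcases hψ with rfl | rfl
    · exact h5 _ h h3 h4
    · have := h5 _ h.tw h3 h4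
      rwa [abs_tw, _root_.tw_one] at this

theorem exists_abs_le_of_two_le_fixed : ∃ n₀ : ℕ, ∀ (α : Type) [Fintype α] [DecidableEq α]
    (σ : Perm α) (χ : Perm α → ℝ), n₀ ≤ Fintype.card α → 2 ≤ cn σ 1 → IsIrr χ → LL 1 χ →
      |χ σ| ≤ ((cn σ 1 : ℝ) - 1) / (Fintype.card α - 1) * χ 1 := by
  obtain ⟨n₀, h0⟩ := exists_two_fixed
  refine ⟨n₀ + 5 + 64 * (n₀ + 5) ^ 2 * (n₀ + 1), fun α _ _ σ χ hn hσ h hL => ?_⟩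
  have hsum := sum_cn_le σ
  have h1 := h.one_pos
  by_cases h1σ : σ = 1
  · have : (1 : ℝ) < Fintype.card α := by
      have : 1 < Fintype.card α := by omega
      exact_mod_cast this
    rw [h1σ, cn_one_one, div_self (by linarith), one_mul, abs_of_nonneg (by linarith)]
  obtain ⟨s, hs⟩ : ∃ s, cn σ 1 + s = Fintype.card α := ⟨_, Nat.add_sub_cancel' (by omega)⟩
  have hc1 : (1 : ℝ) ≤ (cn σ 1 : ℝ) - 1 := by
    have : (2 : ℝ) ≤ cn σ 1 := by exact_mod_cast hσ
    linarith
  have hn1 : (1 : ℝ) ≤ (Fintype.card α : ℝ) - 1 := by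
    have : (2 : ℝ) ≤ Fintype.card α := by
      have : 2 ≤ Fintype.card α := by omega
      exact_mod_cast this
    linarith
  have hpos : 0 ≤ ((cn σ 1 : ℝ) - 1) / (Fintype.card α - 1) := div_nonneg (by linarith) (by linarith)
  rcases le_or_gt n₀ s with hs0 | hs0
  · have := abs_le_of_base (s := s) (m := s + 2) (b := 0) le_rfl (fun β _ _ τ ψ hc hτ hψ hl => by
      have h2 : cn τ 1 = 2 := by omega
      have h3 := h0 β τ ψ (by omega) h2 hψ hl
      refine le_trans ?_ (mul_le_mul_of_nonneg_right (le_max_left _ _) (by linarith [hψ.one_pos]))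
      rw [h2, div_mul_eq_mul_div, le_div_iff₀ (by push_cast; linarith), ← hc]
      refine h3.trans (le_of_eq ?_)
      push_cast; ring) (n := Fintype.card α) (by omega) α σ χ rfl hs h hL
    rwa [max_eq_left hpos] at this
  · have hne : ∀ (β : Type) [Fintype β] [DecidableEq β] (τ : Perm β), cn τ 1 + s = Fintype.card β →
        τ ≠ 1 := by
      rintro β _ _ τ hτ rfl
      rw [cn_one_one] at hτ
      refine h1σ ?_
      ext x
      have : (Finset.univ.filter fun x => σ x = x) = Finset.univ := by
        rw [← Finset.card_eq_iff_eq_univ, ← cn_one]; omega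
      have := this ▸ Finset.mem_univ x
      exact (Finset.mem_filter.1 this).2
    have := abs_le_of_base (s := s) (m := n₀ + 5) (b := 1 - 1 / (64 * ((n₀ + 5 : ℕ) : ℝ) ^ 2))
      (by omega) (fun β _ _ τ ψ hc hτ hψ hl => by
        have h3 := hψ.abs_le_gap hl (by omega) (hne β τ (by omega))
        refine h3.trans (mul_le_mul_of_nonneg_right ?_ (by linarith [hψ.one_pos]))
        rw [hc]
        exact le_max_right _ _) (n := Fintype.card α) (by omega) α σ χ rfl hs h hL
    rwa [max_eq_left] at this
    rw [sub_le_iff_le_add, ← sub_le_iff_le_add', le_div_iff₀ (by positivity)]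
    have h5 : (cn σ 1 : ℝ) = Fintype.card α - s := by rw [← hs]; push_cast; ring
    rw [h5]
    have h6 : 1 - ((Fintype.card α : ℝ) - s - 1) / (Fintype.card α - 1) = s / (Fintype.card α - 1) := by
      field_simp
      ring
    rw [h6, div_mul_eq_mul_div, div_le_one (by linarith)]
    have h7 : s * (64 * (n₀ + 5) ^ 2) + 1 ≤ Fintype.card α := by nlinarith
    have h8 : ((s * (64 * (n₀ + 5) ^ 2) + 1 : ℕ) : ℝ) ≤ Fintype.card α := by exact_mod_cast h7
    push_cast at h8 ⊢
    linarith

end CycleCounts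

section UpperBound

open Equiv

set_option linter.unusedSectionVars false

variable {α : Type} [Fintype α] [DecidableEq α]

/-- `M` is an upper bound for the eight normalized characters at `σ`. -/
structure EightBound (σ : Perm α) (M : ℝ) : Prop where
  std : (cn σ 1 : ℝ) - 1 ≤ M * (Fintype.card α - 1)
  two : (cn σ 1 : ℝ) * (cn σ 1 - 3) / 2 + cn σ 2 ≤
    M * ((Fintype.card α : ℝ) * (Fintype.card α - 3) / 2)
  three : (cn σ 1 : ℝ) * (cn σ 1 - 1) * (cn σ 1 - 5) / 6 + (cn σ 1 - 1) * cn σ 2 + cn σ 3 ≤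
    M * ((Fintype.card α : ℝ) * (Fintype.card α - 1) * (Fintype.card α - 5) / 6)
  twoOne : (cn σ 1 : ℝ) * (cn σ 1 - 2) * (cn σ 1 - 4) / 3 - cn σ 3 ≤
    M * ((Fintype.card α : ℝ) * (Fintype.card α - 2) * (Fintype.card α - 4) / 3)
  four : (cn σ 1 : ℝ) * (cn σ 1 - 1) * (cn σ 1 - 2) * (cn σ 1 - 7) / 24 +
      ((cn σ 1 : ℝ) ^ 2 - 3 * cn σ 1 - 1) * cn σ 2 / 2 + (cn σ 2 : ℝ) ^ 2 / 2 +
      (cn σ 1 - 1) * cn σ 3 + cn σ 4 ≤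
    M * ((Fintype.card α : ℝ) * (Fintype.card α - 1) * (Fintype.card α - 2) *
      (Fintype.card α - 7) / 24)
  sgnStd : sgn σ * ((cn σ 1 : ℝ) - 1) ≤ M * (Fintype.card α - 1)
  sgnTwo : sgn σ * ((cn σ 1 : ℝ) * (cn σ 1 - 3) / 2 + cn σ 2) ≤
    M * ((Fintype.card α : ℝ) * (Fintype.card α - 3) / 2)
  sgnOneOne : sgn σ * (((cn σ 1 : ℝ) - 1) * (cn σ 1 - 2) / 2 - cn σ 2) ≤
    M * (((Fintype.card α : ℝ) - 1) * (Fintype.card α - 2) / 2)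

theorem stableCount_eq_sum_famSum (σ : Perm α) (k : ℕ) :
    (stableCount σ k : ℝ) = ∑ j ∈ Finset.range (k + 1), famSum (fun _ => 1) (orbs σ) j := by
  simp only [← sum_wt_eq, wt_one]
  rw [Finset.sum_comm]
  simp only [Finset.sum_ite_eq, Finset.mem_range]
  rw [stableCount, ← Finset.filter_filter, Finset.card_filter]
  push_cast
  refine Finset.sum_congr rfl fun A _ => ?_
  simp only [Nat.lt_succ_iff]

theorem stableCount_four_le {σ : Perm α} (h1 : cn σ 1 ≤ 1) (hn : 72 ≤ Fintype.card α) :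
    (stableCount σ 4 : ℝ) ≤ Fintype.card α * (1 + cn σ 2) := by
  rw [stableCount_eq_sum_famSum]
  simp only [Finset.sum_range_succ, Finset.range_zero, Finset.sum_empty]
  rw [famSum_zero _ (orbs_card_pos σ), famSum_one _ (orbs_card_pos σ),
    famSum_two _ (orbs_card_pos σ) rfl rfl, famSum_three _ (orbs_card_pos σ) rfl rfl rfl,
    famSum_four _ (orbs_card_pos σ) rfl rfl rfl rfl]
  change 0 + 1 + 1 * (cn σ 1 : ℝ) + (1 ^ 2 * ((cn σ 1 : ℝ) * (cn σ 1 - 1) / 2) + 1 * (cn σ 2 : ℝ)) +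
    (1 ^ 3 * ((cn σ 1 : ℝ) * (cn σ 1 - 1) * (cn σ 1 - 2) / 6) + 1 * 1 * ((cn σ 1 : ℝ) * cn σ 2) +
      1 * (cn σ 3 : ℝ)) + (1 ^ 4 * ((cn σ 1 : ℝ) * (cn σ 1 - 1) * (cn σ 1 - 2) * (cn σ 1 - 3) / 24) +
      1 ^ 2 * 1 * ((cn σ 1 : ℝ) * (cn σ 1 - 1) / 2 * cn σ 2) +
      1 ^ 2 * ((cn σ 2 : ℝ) * (cn σ 2 - 1) / 2) + 1 * 1 * ((cn σ 1 : ℝ) * cn σ 3) +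
      1 * (cn σ 4 : ℝ)) ≤ _
  have hsum : (cn σ 1 : ℝ) + 2 * cn σ 2 + 3 * cn σ 3 + 4 * cn σ 4 ≤ Fintype.card α := by
    exact_mod_cast sum_cn_le σ
  have hn' : (72 : ℝ) ≤ Fintype.card α := by exact_mod_cast hn
  have h2 : (0 : ℝ) ≤ cn σ 2 := by positivity
  have h3 : (0 : ℝ) ≤ cn σ 3 := by positivity
  have h4 : (0 : ℝ) ≤ cn σ 4 := by positivity
  generalize cn σ 1 = c1 at *
  interval_cases c1 <;> push_cast at * <;> nlinarith

theorem choose_four_ge {n : ℕ} (hn : 72 ≤ n) : (n : ℝ) ^ 4 ≤ 48 * n.choose 4 := by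
  have h : (n.choose 4 : ℝ) = n * (n - 1) * (n - 2) * (n - 3) / 24 := by
    rw [Nat.cast_choose_eq_descPochhammer_div]
    simp [descPochhammer_succ_right, Nat.factorial]
  have hn' : (72 : ℝ) ≤ n := by exact_mod_cast hn
  rw [h]
  have : (0 : ℝ) ≤ (n : ℝ) ^ 3 * (n - 12) := by
    have : (0:ℝ) ≤ n - 12 := by linarith
    positivity
  nlinarith

theorem choose_four_sub_ge {n : ℕ} (hn : 72 ≤ n) : (n : ℝ) ^ 3 * (n - 12) / 24 ≤
    n.choose 4 - ∑ i ∈ Finset.range 4, (n.choose i : ℝ) := by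
  have hn' : (72 : ℝ) ≤ n := by exact_mod_cast hn
  simp only [Nat.cast_choose_eq_descPochhammer_div, Finset.sum_range_succ, Finset.range_zero,
    Finset.sum_empty]
  simp [descPochhammer_succ_right, Nat.factorial]
  nlinarith [mul_nonneg (sq_nonneg (n : ℝ)) (by linarith : (0 : ℝ) ≤ n - 72)]

/-- Characters of level at least four, at permutations with at most one fixed point. -/
theorem exists_level_four_bound : ∃ C : ℝ, 0 < C ∧
    ∀ (α : Type) [Fintype α] [DecidableEq α] (σ : Perm α) (χ : Perm α → ℝ),
      72 ≤ Fintype.card α → cn σ 1 ≤ 1 → IsIrr χ → LL 4 χ →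
      |χ σ| * (Fintype.card α) ^ 3 ≤ C * (1 + cn σ 2) * χ 1 := by
  obtain ⟨C, hC, hb⟩ := exists_level_bound (r := 2) (j := 3) (m := 5) le_rfl (by omega)
    (by intro k hk hk'; interval_cases k <;> norm_num)
  refine ⟨C + 96, by positivity, fun α _ _ σ χ hn hσ h hL => ?_⟩
  have h1 := h.one_pos
  have h0 : (0 : ℝ) ≤ cn σ 2 := by positivity
  rcases hL.dichotomy 5 with h2 | ⟨k, hk, hkn, -, ψ, hψ, h3, h4⟩
  · refine (hb α σ χ hn (by rw [small_orbits_two]; omega) h h2).trans ?_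
    refine mul_le_mul_of_nonneg_right ?_ (by linarith)
    nlinarith
  · obtain rfl : k = 4 := by omega
    have h5 : ∀ ψ : Perm α → ℝ, IsIrr ψ → LevGe 4 ψ → ¬ LevGe 5 ψ →
        |ψ σ| * (Fintype.card α) ^ 3 ≤ (C + 96) * (1 + cn σ 2) * ψ 1 := fun ψ hψ a c => by
      obtain ⟨u, hu, hb, hd⟩ := hψ.exists_bound (k := 4) (by omega) a c
      have h6 := (hb σ).trans (mul_le_mul_of_nonneg_left (stableCount_four_le hσ hn) (by linarith))
      calc |ψ σ| * (Fintype.card α) ^ 3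
          ≤ u * (Fintype.card α * (1 + cn σ 2)) * (Fintype.card α) ^ 3 := by gcongr
        _ = u * (1 + cn σ 2) * (Fintype.card α) ^ 4 := by ring
        _ ≤ u * (1 + cn σ 2) * (48 * (Fintype.card α).choose 4) := by
          gcongr; exact choose_four_ge hn
        _ = 48 * (1 + cn σ 2) * (u * (Fintype.card α).choose 4) := by ring
        _ ≤ 48 * (1 + cn σ 2) * (2 * ψ 1) := by gcongr
        _ = 96 * (1 + cn σ 2) * ψ 1 := by ring
        _ ≤ _ := by
          have := hψ.one_pos
          gcongr
          linarith
    rcases hψ with rfl | rfl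
    · exact h5 _ h h3 h4
    · have := h5 _ h.tw h3 h4
      rwa [abs_tw, _root_.tw_one] at this

/-- Levels one and two with at most one fixed point. -/
theorem IsIrr.le_of_level_two {χ : Perm α → ℝ} (h : IsIrr χ) (hn : 72 ≤ Fintype.card α)
    {σ : Perm α} (h1 : cn σ 1 ≤ 1) {M : ℝ} (hM : EightBound σ M) {k : ℕ} (hk : 1 ≤ k) (hk' : k < 3)
    {ψ : Perm α → ℝ} (hψ : ψ = χ ∨ ψ = _root_.tw χ) (hl : LevGe k ψ) (hl' : ¬ LevGe (k + 1) ψ) :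
    χ σ ≤ M * χ 1 := by
  have hn' : (72 : ℝ) ≤ Fintype.card α := by exact_mod_cast hn
  have hc2 : (0 : ℝ) ≤ cn σ 2 := by positivity
  have h0 : cn (1 : Perm α) 1 = Fintype.card α := cn_one_one
  have h02 : cn (1 : Perm α) 2 = 0 := cn_one_of_two_le le_rfl
  have hψi : IsIrr ψ := by rcases hψ with rfl | rfl; exacts [h, h.tw]
  have hχ : (χ σ = ψ σ ∨ χ σ = sgn σ * ψ σ) ∧ χ 1 = ψ 1 := by
    rcases hψ with rfl | rfl
    · exact ⟨Or.inl rfl, rfl⟩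
    · refine ⟨Or.inr ?_, (_root_.tw_one χ).symm⟩
      change _ = sgn σ * (sgn σ * χ σ)
      rw [← mul_assoc, sgn_mul_self, one_mul]
  obtain ⟨hχ, hχ1⟩ := hχ
  rw [hχ1]
  interval_cases k
  · rw [level_one_degree hψi (by omega) hl hl']
    rw [hψi.level_one (by omega) hl hl'] at hχ
    rcases hχ with h2 | h2 <;> rw [h2]
    exacts [hM.std, hM.sgnStd]
  · rcases hψi.level_two (by omega) hl hl' with h3 | h3
    · rw [h3 1, h0, h02]
      rw [h3] at hχ
      push_cast
      rcases hχ with h2 | h2 <;> rw [h2]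
      exacts [by linarith [hM.two], by linarith [hM.sgnTwo]]
    · rw [h3 1, h0, h02]
      rw [h3] at hχ
      push_cast
      rcases hχ with h2 | h2 <;> rw [h2]
      · rcases sgn_eq_one_or σ with he | he
        · have := hM.sgnOneOne
          rw [he] at this
          linarith
        · have h4 := hM.std
          have h5 := hM.sgnStd
          rw [he] at h5
          have hM0 : -1 * ((cn σ 1 : ℝ) - 1) * ((Fintype.card α : ℝ) - 2) ≤
              M * (Fintype.card α - 1) * (Fintype.card α - 2) :=
            mul_le_mul_of_nonneg_right h5 (by linarith)
          generalize cn σ 1 = c1 at *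
          interval_cases c1 <;> push_cast at * <;> linarith
      · linarith [hM.sgnOneOne]

/-- When the bound at `σ` is of order at least `1 / n²`. -/
theorem EightBound.sq_ge {σ : Perm α} {M : ℝ} (hM : EightBound σ M)
    (hn : 72 ≤ Fintype.card α)
    (hσ : cn σ 1 = 0 ∧ sgn σ = 1 ∨ cn σ 1 = 1 ∧ (sgn σ = -1 ∨ 2 ≤ cn σ 2)) :
    2 / 3 * (1 + (cn σ 2 : ℝ)) ≤ M * (Fintype.card α : ℝ) ^ 2 := by
  have hn' : (72 : ℝ) ≤ Fintype.card α := by exact_mod_cast hn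
  have h2 := hM.two
  have h7 := hM.sgnTwo
  have h8 := hM.sgnOneOne
  have h2' : (0 : ℝ) ≤ cn σ 2 := by positivity
  have hM0 : ∀ x : ℝ, 0 ≤ x → x ≤ M * ((Fintype.card α : ℝ) * (Fintype.card α - 3) / 2) →
      2 * x ≤ M * (Fintype.card α : ℝ) ^ 2 := fun x hx h => by
    have h3 : 0 < (Fintype.card α : ℝ) * (Fintype.card α - 3) / 2 := by nlinarith
    have h4 : 0 ≤ M := by
      by_contra hneg
      push Not at hneg
      nlinarith
    nlinarith
  have hM1 : ∀ x : ℝ, 0 ≤ x → x ≤ M * (((Fintype.card α : ℝ) - 1) * (Fintype.card α - 2) / 2) →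
      2 * x ≤ M * (Fintype.card α : ℝ) ^ 2 := fun x hx h => by
    have h3 : 0 < ((Fintype.card α : ℝ) - 1) * (Fintype.card α - 2) / 2 := by nlinarith
    have h4 : 0 ≤ M := by
      by_contra hneg
      push Not at hneg
      nlinarith
    nlinarith
  rcases hσ with ⟨h1, he⟩ | ⟨h1, he | he⟩
  · rw [h1] at h2 h8
    rw [he] at h8
    rcases Nat.eq_zero_or_pos (cn σ 2) with h0 | h0
    · rw [h0] at h8 ⊢
      have := hM1 1 zero_le_one (by push_cast at h8; linarith)
      push_cast
      linarith
    · have h0' : (1 : ℝ) ≤ cn σ 2 := by exact_mod_cast h0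
      have := hM0 (cn σ 2) h2' (by push_cast at h2; linarith)
      linarith
  · rw [h1, he] at h8 h7
    rcases Nat.eq_zero_or_pos (cn σ 2) with h0 | h0
    · rw [h0] at h7 ⊢
      have := hM0 1 zero_le_one (by push_cast at h7; linarith)
      push_cast
      linarith
    · have h0' : (1 : ℝ) ≤ cn σ 2 := by exact_mod_cast h0
      have := hM1 (cn σ 2) h2' (by push_cast at h8; linarith)
      linarith
  · rw [h1] at h2
    have h0' : (2 : ℝ) ≤ cn σ 2 := by exact_mod_cast he
    have := hM0 (cn σ 2 - 1) (by linarith) (by push_cast at h2; linarith)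
    linarith

end UpperBound

section UpperBoundLevelThree

open Equiv

set_option linter.unusedSectionVars false

variable {α : Type} [Fintype α] [DecidableEq α]

/-- Level three with at most one fixed point. -/
theorem IsIrr.le_of_level_three {χ : Perm α → ℝ} (h : IsIrr χ) (hn : 72 ≤ Fintype.card α)
    {σ : Perm α} (h1 : cn σ 1 = 0 ∧ sgn σ = 1 ∨ cn σ 1 = 1) {M : ℝ} (hM : EightBound σ M)
    {ψ : Perm α → ℝ} (hψ : ψ = χ ∨ ψ = _root_.tw χ) (hl : LevGe 3 ψ) (hl' : ¬ LevGe 4 ψ) :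
    χ σ ≤ M * χ 1 := by
  have hn' : (72 : ℝ) ≤ Fintype.card α := by exact_mod_cast hn
  have hc2 : (0 : ℝ) ≤ cn σ 2 := by positivity
  have hc3 : (0 : ℝ) ≤ cn σ 3 := by positivity
  have h0 : cn (1 : Perm α) 1 = Fintype.card α := cn_one_one
  have h02 : cn (1 : Perm α) 2 = 0 := cn_one_of_two_le le_rfl
  have h03 : cn (1 : Perm α) 3 = 0 := cn_one_of_two_le (by omega)
  have hsum := sum_cn_le σ
  have hsum' : (cn σ 1 : ℝ) + 2 * cn σ 2 + 3 * cn σ 3 ≤ Fintype.card α := by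
    have : cn σ 1 + 2 * cn σ 2 + 3 * cn σ 3 ≤ Fintype.card α := by omega
    exact_mod_cast this
  have hψi : IsIrr ψ := by rcases hψ with rfl | rfl; exacts [h, h.tw]
  have hχ : (χ σ = ψ σ ∨ χ σ = sgn σ * ψ σ) ∧ χ 1 = ψ 1 := by
    rcases hψ with rfl | rfl
    · exact ⟨Or.inl rfl, rfl⟩
    · refine ⟨Or.inr ?_, (_root_.tw_one χ).symm⟩
      change _ = sgn σ * (sgn σ * χ σ)
      rw [← mul_assoc, sgn_mul_self, one_mul]
  obtain ⟨hχ, hχ1⟩ := hχ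
  rw [hχ1]
  rcases h1 with ⟨h1, he⟩ | h1
  · rw [he, one_mul, or_self] at hχ
    rw [hχ]
    rw [h1] at hsum'
    rcases hψi.level_three (by omega) hl hl' with h3 | h3 | h3
    · rw [h3, h3, h0, h02, h03]
      refine hM.three.trans (le_of_eq ?_)
      push_cast; ring
    · rw [h3, h3, h0, h03]
      refine hM.twoOne.trans (le_of_eq ?_)
      push_cast; ring
    · rw [h3, h3, h0, h02, h03, h1]
      have h2 := hM.two
      have h8 := hM.sgnOneOne
      rw [h1] at h2 h8
      rw [he] at h8
      push_cast at h2 h8 hsum' ⊢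
      set n : ℝ := (Fintype.card α : ℝ)
      have key : ∀ x : ℝ, 3 * n * x ≤ cn σ 2 * ((n - 1) * (n - 2)) →
          x ≤ M * ((n - 1) * (n - 2) * (n - 3) / 6) := fun x hx => by
        have h9 := mul_le_mul_of_nonneg_right (show (cn σ 2 : ℝ) ≤ M * (n * (n - 3) / 2) by linarith)
          (show 0 ≤ (n - 1) * (n - 2) by nlinarith)
        have h10 : x * (3 * n) ≤ M * ((n - 1) * (n - 2) * (n - 3) / 6) * (3 * n) := by linarith
        exact le_of_mul_le_mul_right h10 (by linarith)
      rcases Nat.lt_or_ge (cn σ 2) 2 with h20 | h20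
      · have h20' : cn σ 2 = 0 ∨ cn σ 2 = 1 := by omega
        rcases h20' with h20 | h20
        · rw [h20] at h8 hsum' ⊢
          have h9 := mul_le_mul_of_nonneg_right h8 (show 0 ≤ (n - 3) / 3 by linarith)
          push_cast at h9 hsum' ⊢
          linarith
        · have h11 : 3 * cn σ 3 + 3 ≤ Fintype.card α := by
            by_contra hcon
            have h12 : 2 * cn σ 2 + 3 * cn σ 3 = Fintype.card α := by omega
            have h13 := sgn_eq_of_two_three h12
            rw [he, h20] at h13
            norm_num at h13
          have h11' : 3 * (cn σ 3 : ℝ) + 3 ≤ n := by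
            have : ((3 * cn σ 3 + 3 : ℕ) : ℝ) ≤ n := Nat.cast_le.2 h11
            push_cast at this
            linarith
          rw [h20] at key ⊢
          push_cast at key ⊢
          have := key (cn σ 3) (by nlinarith)
          linarith
      · have h20' : (2 : ℝ) ≤ cn σ 2 := by exact_mod_cast h20
        have h11 : 3 * n * (cn σ 2 + cn σ 3 - 1 : ℝ) ≤ n * (n + cn σ 2 - 3) := by
          nlinarith
        have h12 : 0 ≤ ((cn σ 2 : ℝ) - 2) * (n ^ 2 - 4 * n + 2) :=
          mul_nonneg (by linarith) (by nlinarith)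
        have := key (cn σ 2 + cn σ 3 - 1) (h11.trans (by nlinarith))
        linarith
  · have h2 := hM.std
    have h33 := hM.three
    have h7 := hM.sgnTwo
    have h8 := hM.sgnOneOne
    rw [h1] at h2 h7 h8 h33
    push_cast at h2 h7 h8 h33
    have hM0 : 0 ≤ M := by
      by_contra hneg
      push Not at hneg
      nlinarith
    set n : ℝ := (Fintype.card α : ℝ)
    have hd3 : 0 ≤ n * (n - 1) * (n - 5) / 6 :=
      div_nonneg (mul_nonneg (mul_nonneg (by linarith) (by linarith)) (by linarith)) (by norm_num)
    have hdh : n * (n - 1) * (n - 5) / 6 ≤ (n - 1) * (n - 2) * (n - 3) / 6 := by nlinarith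
    have he : (χ σ = ψ σ) ∨ sgn σ = -1 ∧ χ σ = - ψ σ := by
      rcases hχ with h | h
      · exact Or.inl h
      · rcases sgn_eq_one_or σ with he | he
        · left; rw [h, he, one_mul]
        · right; exact ⟨he, by rw [h, he]; ring⟩
    rcases hψi.level_three (by omega) hl hl' with h3 | h3 | h3
    · rw [h3 1, h0, h02, h03]
      rw [h3, h1] at he
      push_cast at he ⊢
      rcases he with he | ⟨-, he⟩ <;> rw [he]
      · linarith
      · have := mul_nonneg hM0 hd3
        linarith
    · rw [h3 1, h0, h03]
      rcases he with he | ⟨hs, he⟩ <;> rw [he, h3]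
      · refine hM.twoOne.trans (le_of_eq ?_)
        push_cast; ring
      · rw [h1] at hsum' ⊢
        rw [hs] at h7 h8
        push_cast at hsum' ⊢
        have h10 : 1 ≤ M * (n * (n - 2)) := by
          rcases Nat.eq_zero_or_pos (cn σ 2) with h20 | h20
          · rw [h20] at h7
            push_cast at h7
            nlinarith
          · have h20' : (1 : ℝ) ≤ cn σ 2 := by exact_mod_cast h20
            nlinarith
        have h11 := mul_le_mul_of_nonneg_right h10 (show 0 ≤ (n - 4) / 3 by linarith)
        linarith
    · rw [h3 1, h0, h02, h03]
      rw [h3, h1] at he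
      have h10 := mul_le_mul_of_nonneg_left hdh hM0
      have := mul_nonneg hM0 hd3
      push_cast at he ⊢
      rcases he with he | ⟨-, he⟩ <;> rw [he] <;> linarith

/-- One fixed point, even, at most one transposition: level four. -/
theorem IsIrr.le_of_level_four {χ : Perm α → ℝ} (h : IsIrr χ) (hn : 2000 ≤ Fintype.card α)
    {σ : Perm α} (h1 : cn σ 1 = 1) (h2 : cn σ 2 ≤ 1) (hs : sgn σ = 1) {M : ℝ} (hM : EightBound σ M)
    {ψ : Perm α → ℝ} (hψ : ψ = χ ∨ ψ = _root_.tw χ) (hl : LevGe 4 ψ) (hl' : ¬ LevGe 5 ψ) :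
    χ σ ≤ M * χ 1 := by
  have hn' : (2000 : ℝ) ≤ Fintype.card α := by exact_mod_cast hn
  have hψi : IsIrr ψ := by rcases hψ with rfl | rfl; exacts [h, h.tw]
  have hχ : χ σ = ψ σ ∧ χ 1 = ψ 1 := by
    rcases hψ with rfl | rfl
    · exact ⟨rfl, rfl⟩
    · refine ⟨?_, (_root_.tw_one χ).symm⟩
      change _ = sgn σ * χ σ
      rw [hs, one_mul]
  rw [hχ.1, hχ.2]
  rcases hψi.level_four (by omega) hl hl' with h3 | ⟨u, hu, h3, hd⟩
  · rw [h3, h3, cn_one_one, cn_one_of_two_le (l := 2) (by omega),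
      cn_one_of_two_le (l := 3) (by omega), cn_one_of_two_le (l := 4) (by omega)]
    refine hM.four.trans (le_of_eq ?_)
    push_cast; ring
  · refine (h3 σ h1 h2).trans ?_
    have hsum := sum_cn_le σ
    have hsum' : 1 + 3 * cn σ 3 + 4 * cn σ 4 ≤ (Fintype.card α : ℝ) := by
      have : 1 + 3 * cn σ 3 + 4 * cn σ 4 ≤ Fintype.card α := by omega
      exact_mod_cast this
    have g1 := hM.std
    have g3 := hM.three
    have g4 := hM.twoOne
    have g5 := hM.four
    rw [h1] at g1 g3 g4 g5
    push_cast at g1 g3 g4 g5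
    have hD := choose_four_sub_ge (n := Fintype.card α) (by omega)
    push_cast at hd
    set D := ((Fintype.card α).choose 4 : ℝ) -
      ∑ i ∈ Finset.range 4, ((Fintype.card α).choose i : ℝ)
    set n : ℝ := (Fintype.card α : ℝ)
    have hM0 : 0 ≤ M := by
      by_contra hneg
      push Not at hneg
      nlinarith
    have hc4 : (0 : ℝ) ≤ cn σ 4 := by positivity
    have hMn : ∀ x d : ℝ, x ≤ M * d → d ≤ n ^ 3 → x ≤ M * n ^ 3 := fun x d a b =>
      a.trans (mul_le_mul_of_nonneg_left b hM0)
    have hMD : M * n ^ 3 * ((n - 12) / 24) ≤ M * D := by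
      have := mul_le_mul_of_nonneg_left hD hM0
      linarith
    have key : (23 / 25 * cn σ 4 + 2 * cn σ 3 + 4 : ℝ) ≤ M * D := by
      refine le_trans ?_ hMD
      rcases Nat.eq_zero_or_pos (cn σ 3) with h30 | h30
      · rw [h30] at g4 g5 ⊢
        push_cast at g4 g5 ⊢
        have h5 : 3 ≤ M * n ^ 3 := hMn 3 (n * (n - 2) * (n - 4)) (by linarith) (by nlinarith)
        rcases le_total (8 * (cn σ 4 : ℝ)) n with h8 | h8
        · have := mul_le_mul_of_nonneg_right h5 (show 0 ≤ (n - 12) / 24 by linarith)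
          linarith
        · have h6 : 24 * ((cn σ 4 : ℝ) - 1) ≤ M * n ^ 3 * n := by
            have h7 : 24 * ((cn σ 4 : ℝ) - 1) ≤ M * (n * (n - 1) * (n - 2) * (n - 7)) := by
              have : cn σ 2 = 0 ∨ cn σ 2 = 1 := by omega
              rcases this with h | h <;> rw [h] at g5 <;> push_cast at g5 <;> linarith
            refine h7.trans ?_
            rw [mul_assoc M (n ^ 3) n]
            refine mul_le_mul_of_nonneg_left ?_ hM0
            have hn7 : 0 ≤ n - 7 := by linarith
            have hn2 : 0 ≤ n - 2 := by linarith
            calc n * (n - 1) * (n - 2) * (n - 7) ≤ n * n * n * n := by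
                  gcongr <;> linarith
              _ = n ^ 3 * n := by ring
          have h9 : M * n ^ 3 * ((n - 12) / 24) = M * n ^ 3 * n / 24 - M * n ^ 3 / 2 := by ring
          have h10 : M * n ^ 3 * 2000 ≤ M * n ^ 3 * n := mul_le_mul_of_nonneg_left hn' (by linarith)
          linarith
      · have h30' : (1 : ℝ) ≤ cn σ 3 := by exact_mod_cast h30
        have h5 : 6 * (cn σ 3 : ℝ) ≤ M * n ^ 3 :=
          hMn _ (n * (n - 1) * (n - 5)) (by linarith) (by nlinarith)
        have h6 := mul_le_mul_of_nonneg_right h5 (show 0 ≤ (n - 12) / 24 by linarith)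
        have h7 : 0 ≤ ((cn σ 3 : ℝ) - 1) * (n - 20) := mul_nonneg (by linarith) (by linarith)
        nlinarith
    have hD0 : 0 ≤ D := le_trans (div_nonneg (mul_nonneg (by positivity) (by linarith)) (by norm_num)) hD
    calc u * (23 / 25 * cn σ 4 + 2 * cn σ 3 + 4) ≤ u * (M * D) := by gcongr
      _ = M * (u * D) := by ring
      _ ≤ M * ψ 1 := by gcongr

/-- For large `n` the eight normalized characters bound all the others. -/
theorem exists_le_of_eightBound : ∃ n₀ : ℕ, ∀ (α : Type) [Fintype α] [DecidableEq α]
    (σ : Perm α) (χ : Perm α → ℝ) (M : ℝ), n₀ ≤ Fintype.card α → EightBound σ M → IsIrr χ →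
      LL 1 χ → χ σ ≤ M * χ 1 := by
  obtain ⟨n₁, hb1⟩ := exists_abs_le_of_two_le_fixed
  obtain ⟨C₂, hC₂, hb2⟩ := exists_level_bound (r := 2) (j := 2) (m := 3) le_rfl (by omega)
    (by intro k hk hk'; interval_cases k <;> norm_num)
  obtain ⟨C₃, hC₃, hb3⟩ := exists_level_four_bound
  obtain ⟨C₄, hC₄, hb4⟩ := exists_level_bound (r := 3) (j := 4) (m := 5) (by omega) le_rfl
    (by intro k hk hk'; interval_cases k <;> norm_num)
  refine ⟨2000 + n₁ + ⌈C₂⌉₊ + ⌈2 * C₃⌉₊ + ⌈C₄⌉₊, fun α _ _ σ χ M hn hM h hL => ?_⟩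
  have hχ1 := h.one_pos
  have hn' : (2000 : ℝ) ≤ Fintype.card α := by
    have : 2000 ≤ Fintype.card α := by omega
    exact_mod_cast this
  have hnC₂ : C₂ ≤ Fintype.card α := (Nat.le_ceil _).trans (by
    have : ⌈C₂⌉₊ ≤ Fintype.card α := by omega
    exact_mod_cast this)
  have hnC₃ : 2 * C₃ ≤ Fintype.card α := (Nat.le_ceil _).trans (by
    have : ⌈2 * C₃⌉₊ ≤ Fintype.card α := by omega
    exact_mod_cast this)
  have hnC₄ : C₄ ≤ Fintype.card α := (Nat.le_ceil _).trans (by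
    have : ⌈C₄⌉₊ ≤ Fintype.card α := by omega
    exact_mod_cast this)
  rcases Nat.lt_or_ge (cn σ 1) 2 with h1 | h1
  swap
  · refine (le_abs_self _).trans ((hb1 α σ χ (by omega) h1 h hL).trans
      (mul_le_mul_of_nonneg_right ?_ (by linarith)))
    rw [div_le_iff₀ (by linarith)]
    exact hM.std
  have hone : ((cn σ 1 : ℕ) : ℝ) ≤ 1 := by exact_mod_cast Nat.lt_succ_iff.1 h1
  rcases hL.dichotomy 3 with hL3 | ⟨k, hk, hk', -, ψ, hψ, hl, hl'⟩
  swap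
  · exact h.le_of_level_two (by omega) (by omega) hM hk hk' hψ hl hl'
  have hs2 : ((orbs σ).filter fun O => O.card < 2).card ≤ 2 := by rw [small_orbits_two]; omega
  by_cases hA : cn σ 1 = 0 ∧ sgn σ = -1
  · have h2 := (le_abs_self (χ σ)).trans' (le_refl _)
    have h3 := hb2 α σ χ (by omega) hs2 h hL3
    have h4 := hM.sgnStd
    rw [hA.1, hA.2] at h4
    push_cast at h4
    set n : ℝ := (Fintype.card α : ℝ)
    have h5 : 1 ≤ M * n := by
      have : 0 ≤ M := by
        by_contra hneg
        push Not at hneg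
        nlinarith
      linarith
    have h6 : |χ σ| * n ^ 2 ≤ M * n * n * χ 1 := h3.trans (by
      refine mul_le_mul_of_nonneg_right ?_ (by linarith)
      nlinarith)
    have h7 : |χ σ| * n ^ 2 ≤ M * χ 1 * n ^ 2 := by linarith
    exact h2.trans (le_of_mul_le_mul_right h7 (by positivity))
  have hse := sgn_eq_one_or σ
  have h01 : cn σ 1 = 0 ∧ sgn σ = 1 ∨ cn σ 1 = 1 := by
    have : cn σ 1 = 0 ∨ cn σ 1 = 1 := by omega
    tauto
  rcases hL3.dichotomy 4 with hL4 | ⟨k, hk, hk', -, ψ, hψ, hl, hl'⟩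
  swap
  · obtain rfl : k = 3 := by omega
    exact h.le_of_level_three (by omega) h01 hM hψ hl hl'
  by_cases hB : cn σ 1 = 0 ∧ sgn σ = 1 ∨ cn σ 1 = 1 ∧ (sgn σ = -1 ∨ 2 ≤ cn σ 2)
  · have h2 := hM.sq_ge (by omega) hB
    have h3 := hb3 α σ χ (by omega) (by omega) h hL4
    set n : ℝ := (Fintype.card α : ℝ)
    have h6 : |χ σ| * n ^ 3 ≤ M * χ 1 * n ^ 3 := by
      refine h3.trans ?_
      have h7 : C₃ * (1 + (cn σ 2 : ℝ)) ≤ M * n ^ 3 := by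
        have h8 := mul_le_mul hnC₃ h2 (by positivity) (by linarith)
        have h9 : (0 : ℝ) ≤ C₃ * (1 + (cn σ 2 : ℝ)) := by positivity
        nlinarith
      have := mul_le_mul_of_nonneg_right h7 (show 0 ≤ χ 1 by linarith)
      linarith
    exact (le_abs_self _).trans (le_of_mul_le_mul_right h6 (by positivity))
  have h1 : cn σ 1 = 1 := by tauto
  have hs : sgn σ = 1 := by tauto
  have h2 : cn σ 2 ≤ 1 := by
    by_contra hcon
    exact hB (Or.inr ⟨h1, Or.inr (by omega)⟩)
  rcases hL4.dichotomy 5 with hL5 | ⟨k, hk, hk', -, ψ, hψ, hl, hl'⟩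
  swap
  · obtain rfl : k = 4 := by omega
    exact h.le_of_level_four (by omega) h1 h2 hs hM hψ hl hl'
  have h3 := hb4 α σ χ (by omega) (by rw [small_orbits_three]; omega) h hL5
  have g1 := hM.std
  have g3 := hM.three
  have g4 := hM.twoOne
  rw [h1] at g1 g3 g4
  push_cast at g1 g3 g4
  set n : ℝ := (Fintype.card α : ℝ)
  have hM0 : 0 ≤ M := by
    by_contra hneg
    push Not at hneg
    nlinarith
  have hMn : ∀ x d : ℝ, x ≤ M * d → d ≤ n ^ 3 → x ≤ M * n ^ 3 := fun x d a b =>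
    a.trans (mul_le_mul_of_nonneg_left b hM0)
  have h5 : 1 ≤ M * n ^ 3 := by
    rcases Nat.eq_zero_or_pos (cn σ 3) with h30 | h30
    · rw [h30] at g4
      push_cast at g4
      have := hMn 3 (n * (n - 2) * (n - 4)) (by linarith) (by nlinarith)
      linarith
    · have h30' : (1 : ℝ) ≤ cn σ 3 := by exact_mod_cast h30
      have := hMn (6 * (cn σ 3 : ℝ)) (n * (n - 1) * (n - 5)) (by linarith) (by nlinarith)
      linarith
  have h6 : |χ σ| * n ^ 4 ≤ M * χ 1 * n ^ 4 := by
    refine h3.trans ?_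
    have h7 : C₄ ≤ M * n ^ 3 * n := by nlinarith
    have := mul_le_mul_of_nonneg_right h7 (show 0 ≤ χ 1 by linarith)
    linarith
  exact (le_abs_self _).trans (le_of_mul_le_mul_right h6 (by positivity))

end UpperBoundLevelThree

section CharacterExistence

open Equiv Representation

section PermCharacters


variable {G : Type} [Group G]

/-- The character of a permutation representation. -/
theorem isChar_perm {X : Type} [Fintype X] [DecidableEq X] (f : G →* Perm X) :
    IsChar fun g => ((Finset.univ.filter fun x => f g x = x).card : ℝ) := by
  let r : G →* ((X → ℂ) →ₗ[ℂ] (X → ℂ)) :=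
    { toFun := fun g => LinearMap.funLeft ℂ ℂ (f g⁻¹)
      map_one' := by ext; simp
      map_mul' := fun x y => by ext; simp }
  refine ⟨X → ℂ, _, _, inferInstance, r, ?_⟩
  funext g
  simp only [character]
  have h1 : r g = Matrix.toLin' ((f g⁻¹).permMatrix ℂ) := by
    refine LinearMap.ext fun v => ?_
    rw [Matrix.toLin'_apply, Matrix.permMatrix_mulVec]
    rfl
  rw [h1, Matrix.trace_toLin'_eq, Matrix.trace_permutation]
  have h2 : Function.fixedPoints (f g⁻¹) =
      ((Finset.univ.filter fun x => f g x = x : Finset X) : Set X) := by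
    ext x
    rw [Function.mem_fixedPoints_iff, map_inv, Perm.inv_eq_iff_eq]
    simp [eq_comm]
  rw [h2, Set.ncard_coe_finset]
  simp

theorem IsChar.pow {χ : G → ℝ} (h : IsChar χ) (k : ℕ) : IsChar fun g => χ g ^ k := by
  induction k with
  | zero => simpa using isChar_one
  | succ k ih => simpa only [pow_succ] using ih.mul h

theorem inner_ne_zero_of_mem [Fintype G] {s : Multiset (G → ℝ)} (hs : ∀ ψ ∈ s, IsIrr ψ) {ψ : G → ℝ}
    (hψ : ψ ∈ s) : ∑ g, s.sum g * ψ g ≠ 0 := by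
  obtain ⟨t, rfl⟩ := Multiset.exists_cons_of_mem hψ
  have h1 : IsChar t.sum := isChar_multiset_sum fun φ hφ => (hs φ (by simp [hφ])).isChar
  obtain ⟨d, hd⟩ := h1.inner_eq (hs ψ hψ).isChar
  rw [Multiset.sum_cons]
  simp only [Pi.add_apply, add_mul, Finset.sum_add_distrib]
  rw [hd, (hs ψ hψ).norm_eq]
  have : 0 < (Fintype.card G : ℝ) := by exact_mod_cast Fintype.card_pos
  positivity

/-- A linear functional of evaluations that does not vanish on a sum does not vanish on some
summand. -/
theorem exists_mem_sum_ne_zero {ι X : Type} [Fintype ι] (w : ι → ℝ) (u : ι → X)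
    (s : Multiset (X → ℝ)) (h : ∑ i, w i * s.sum (u i) ≠ 0) :
    ∃ ψ ∈ s, ∑ i, w i * ψ (u i) ≠ 0 := by
  induction s using Multiset.induction with
  | empty => simp at h
  | cons a s ih =>
    by_cases ha : ∑ i, w i * a (u i) = 0
    · rw [Multiset.sum_cons] at h
      simp only [Pi.add_apply, mul_add, Finset.sum_add_distrib, ha, zero_add] at h
      obtain ⟨ψ, hψ, h⟩ := ih h
      exact ⟨ψ, by simp [hψ], h⟩
    · exact ⟨a, by simp, ha⟩

end PermCharacters

section Existence

set_option linter.unusedSectionVars false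

variable {α : Type} [Fintype α] [DecidableEq α]

theorem isChar_cn_one : IsChar fun σ : Perm α => (cn σ 1 : ℝ) := by
  have := isChar_perm (MonoidHom.id (Perm α))
  simpa only [MonoidHom.id_apply, ← cn_one] using this

theorem sum_cn_one_pow_mul (ψ : Perm α → ℝ) (k : ℕ) :
    ∑ σ, (cn σ 1 : ℝ) ^ k * ψ σ =
      ∑ v : Fin k → α, ∑ σ ∈ permsOn (Finset.univ.image v)ᶜ, ψ σ := by
  have h1 (σ : Perm α) : (cn σ 1 : ℝ) ^ k =
      ∑ v : Fin k → α, if ∀ i, σ (v i) = v i then 1 else 0 := by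
    rw [cn_one, Finset.sum_boole]
    norm_cast
    rw [← Fintype.card_piFinset_const]
    congr 1
    ext v
    simp [Fintype.mem_piFinset]
  simp only [h1, Finset.sum_mul, ite_mul, one_mul, zero_mul]
  rw [Finset.sum_comm]
  refine Finset.sum_congr rfl fun v _ => ?_
  rw [← Finset.sum_filter]
  refine Finset.sum_congr ?_ fun _ _ => rfl
  ext σ
  simp [mem_permsOn]

theorem not_levGe_of_mem_cn_one_pow {k : ℕ} {s : Multiset (Perm α → ℝ)}
    (hs : ∀ ψ ∈ s, IsIrr ψ) (h : s.sum = fun σ => (cn σ 1 : ℝ) ^ k) {ψ : Perm α → ℝ}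
    (hψ : ψ ∈ s) : ¬ LevGe (k + 1) ψ := by
  intro hl
  apply inner_ne_zero_of_mem hs hψ
  rw [h, sum_cn_one_pow_mul]
  refine Finset.sum_eq_zero fun v _ => hl _ ?_
  have : (Finset.univ.image v).card ≤ k := Finset.card_image_le.trans (by simp)
  rw [Finset.card_compl]
  omega

/-- Permutations with a prescribed cycle type. -/
theorem exists_perm_cn (m : Multiset ℕ) (hm : ∀ a ∈ m, 2 ≤ a) (h : m.sum ≤ Fintype.card α) :
    ∃ σ : Perm α, cn σ 1 + m.sum = Fintype.card α ∧ ∀ l, 2 ≤ l → cn σ l = m.count l := by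
  obtain ⟨σ, rfl⟩ := (Perm.exists_with_cycleType_iff α).2 ⟨h, hm⟩
  refine ⟨σ, ?_, fun l hl => cn_of_two_le σ hl⟩
  rw [Perm.sum_cycleType, cn_one]
  have := Finset.card_filter_add_card_filter_not (s := (Finset.univ : Finset α)) (fun x => σ x = x)
  exact this

end Existence

end CharacterExistence

section SubsetCharacter

open Equiv

set_option linter.unusedSectionVars false

variable {α : Type} [Fintype α] [DecidableEq α]

/-- The action of permutations on the subsets of size `k`. -/
def subsetAction (k : ℕ) : Perm α →* Perm {A : Finset α // A.card = k} :=
  MonoidHom.toHomPerm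
    { toFun := fun σ A => ⟨A.1.map σ.toEmbedding, by rw [Finset.card_map, A.2]⟩
      map_one' := by
        funext A
        exact Subtype.ext Finset.map_refl
      map_mul' := fun σ τ => by
        funext A
        exact Subtype.ext (Finset.map_map τ.toEmbedding σ.toEmbedding A.1).symm }

theorem subsetAction_eq_iff (k : ℕ) (σ : Perm α) (A : {A : Finset α // A.card = k}) :
    subsetAction k σ A = A ↔ IsInv σ A.1 := by
  rw [Subtype.ext_iff]
  change A.1.map σ.toEmbedding = A.1 ↔ _
  refine ⟨fun h x hx => ?_, fun h => h.map_eq⟩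
  rw [← h]
  exact Finset.mem_map_of_mem _ hx

theorem famSum_eq_sum (σ : Perm α) (k : ℕ) : famSum (fun _ => 1) (orbs σ) k =
    ∑ A : Finset α with A.card = k, if IsInv σ A then 1 else 0 := by
  rw [← sum_wt_eq, Finset.sum_filter, Finset.sum_filter]
  refine Finset.sum_congr rfl fun A _ => ?_
  rw [wt_one]
  split_ifs <;> rfl

theorem isChar_famSum (k : ℕ) : IsChar fun σ : Perm α => famSum (fun _ => 1) (orbs σ) k := by
  have := isChar_perm (subsetAction (α := α) k)
  convert this using 2 with σ
  rw [famSum_eq_sum, ← Finset.sum_boole]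
  simp only [subsetAction_eq_iff]
  rw [Finset.sum_subtype (p := fun A : Finset α => A.card = k) _ (by simp)]

theorem sum_famSum_mul (ψ : Perm α → ℝ) (k : ℕ) :
    ∑ σ, famSum (fun _ => 1) (orbs σ) k * ψ σ =
      ∑ A : Finset α with A.card = k, ∑ τ ∈ permsOn A, ∑ η ∈ permsOn Aᶜ, ψ (τ * η) := by
  simp only [famSum_eq_sum, Finset.sum_mul, ite_mul, one_mul, zero_mul]
  rw [Finset.sum_comm]
  refine Finset.sum_congr rfl fun A _ => ?_
  rw [← Finset.sum_filter]
  have := sum_inv_restr (Finset.subset_univ A) fun τ η => ψ (τ * η)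
  rw [← Finset.compl_eq_univ_sdiff, permsOn_univ] at this
  rw [← this]
  refine Finset.sum_congr rfl fun σ hσ => ?_
  rw [← (Finset.mem_filter.1 hσ).2.eq_mul]

theorem not_levGe_of_mem_famSum {k : ℕ} {s : Multiset (Perm α → ℝ)} (hs : ∀ ψ ∈ s, IsIrr ψ)
    (h : s.sum = fun σ => famSum (fun _ => 1) (orbs σ) k) {ψ : Perm α → ℝ} (hψ : ψ ∈ s) :
    ¬ LevGe (k + 1) ψ := by
  intro hl
  apply inner_ne_zero_of_mem hs hψ
  rw [h, sum_famSum_mul]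
  refine Finset.sum_eq_zero fun A hA => Finset.sum_eq_zero fun τ hτ => ?_
  refine (hs ψ hψ).isChar.partial_sum_eq_zero disjoint_compl_right (hl _ ?_) hτ
  rw [Finset.card_compl, (Finset.mem_filter.1 hA).2]
  omega

theorem core_eq_one_of_mem_famSum {k : ℕ} (hk : 2 * k ≤ Fintype.card α)
    {s : Multiset (Perm α → ℝ)} (hs : ∀ ψ ∈ s, IsIrr ψ)
    (h : s.sum = fun σ => famSum (fun _ => 1) (orbs σ) k) {ψ : Perm α → ℝ} (hψ : ψ ∈ s)
    (hl : LevGe k ψ) : ∀ E : Finset α, E.card = k → ∀ τ ∈ permsOn E, core ψ E τ = 1 := by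
  have hl' := not_levGe_of_mem_famSum hs h hψ
  have h1 := inner_ne_zero_of_mem hs hψ
  rw [h, sum_famSum_mul] at h1
  obtain ⟨A, hA, h1⟩ := Finset.exists_ne_zero_of_sum_ne_zero h1
  have hA := (Finset.mem_filter.1 hA).2
  have h2 : ∑ τ ∈ permsOn A, core ψ A τ ≠ 0 := by
    simp only [core]
    rw [← Finset.sum_div]
    exact div_ne_zero h1 (by positivity)
  have hirr := core_isIrr (hs ψ hψ).isChar (E := A)
    (by rw [((hs ψ hψ).eq_stableSum hk hl hl').2 A hA, hA])
  have h3 : (fun ρ : Perm {x // x ∈ A} => core ψ A (Perm.ofSubtype ρ)) = fun _ => 1 := by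
    by_contra hne
    have := hirr.orth (isIrr_of_norm isChar_one (by simp))
    rw [if_neg hne] at this
    simp only [mul_one] at this
    exact h2 (by rw [sum_permsOn, this])
  refine fun E hE => (core_equivariant (hs ψ hψ).isChar).transfer (hA.trans hE.symm)
    (fun _ _ => rfl) fun τ hτ => ?_
  obtain ⟨ρ, rfl⟩ := exists_ofSubtype_eq hτ
  exact congrFun h3 ρ

theorem inv_empty (σ : Perm α) : IsInv σ ∅ := fun _ h => absurd h (Finset.notMem_empty _)

theorem stableSum_of_no_small (φ : Finset α → Perm α → ℝ) {k : ℕ} {σ : Perm α}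
    (h : ∀ i, 1 ≤ i → i ≤ k → cn σ i = 0) : stableSum φ k σ = coef φ k ∅ 1 := by
  have h0 : restr σ ∅ = 1 := by simpa [permsOn_empty] using restr_mem σ ∅
  rw [← h0, stableSum]
  refine Finset.sum_eq_single_of_mem ∅ (by simp [inv_empty]) fun A hA hne => coef_eq_zero φ ?_ _
  obtain ⟨x, hx⟩ := Finset.nonempty_iff_ne_empty.2 hne
  by_contra hc
  have hs := orb_subset (Finset.mem_filter.1 hA).2 hx
  have h1 := h (orb σ x).card (Finset.card_pos.2 ⟨x, self_mem_orb σ x⟩)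
    ((Finset.card_le_card hs).trans (not_lt.1 hc))
  rw [cn, Finset.card_eq_zero] at h1
  have h2 : orb σ x ∈ orbN σ (orb σ x).card :=
    Finset.mem_filter.2 ⟨orb_mem_orbs σ x, rfl⟩
  rw [h1] at h2
  exact Finset.notMem_empty _ h2

/-- The irreducible character of level `k + 1` with trivial core. -/
theorem exists_isIrr_of_core_one {k : ℕ} (hk : 2 * (k + 1) ≤ Fintype.card α) {σ σ' : Perm α}
    (h : ∀ i, 1 ≤ i → i ≤ k → cn σ i = 0) (h' : ∀ i, 1 ≤ i → i ≤ k → cn σ' i = 0)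
    (hne : famSum (fun _ => 1) (orbs σ) (k + 1) ≠ famSum (fun _ => 1) (orbs σ') (k + 1)) :
    ∃ χ : Perm α → ℝ, IsIrr χ ∧ ∀ ξ, χ ξ =
      famSum (fun _ => 1) (orbs ξ) (k + 1) - famSum (fun _ => 1) (orbs ξ) k := by
  obtain ⟨s, hs, hsum⟩ := (isChar_famSum (α := α) (k + 1)).exists_multiset
  by_cases hl : ∃ ψ ∈ s, LevGe (k + 1) ψ
  · obtain ⟨ψ, hψ, hl⟩ := hl
    exact ⟨ψ, hs ψ hψ, (hs ψ hψ).eq_of_core_one hk hl (not_levGe_of_mem_famSum hs hsum hψ)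
      (core_eq_one_of_mem_famSum hk hs hsum hψ hl)⟩
  · push Not at hl
    refine absurd ?_ hne
    have h1 := congrFun hsum
    rw [← h1 σ, ← h1 σ', multiset_sum_apply, multiset_sum_apply]
    refine congrArg _ (Multiset.map_congr rfl fun ψ hψ => ?_)
    obtain ⟨j, -, -, hj, hj'⟩ := exists_exact_level
      (by have := (hs ψ hψ).one_pos; linarith) (levGe_zero ψ)
    have hjk : j ≤ k := by
      by_contra hc
      exact hl ψ hψ (hj.mono (by omega))
    rw [((hs ψ hψ).eq_stableSum (by omega) hj hj').1, ((hs ψ hψ).eq_stableSum (by omega) hj hj').1,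
      stableSum_of_no_small _ fun i hi hi' => h i hi (by omega),
      stableSum_of_no_small _ fun i hi hi' => h' i hi (by omega)]

end SubsetCharacter

section EightExist

open Equiv

set_option linter.unusedSectionVars false

variable {α : Type} [Fintype α] [DecidableEq α]

theorem exists_full_cycle (hn : 2 ≤ Fintype.card α) :
    ∃ σ : Perm α, ∀ i, i < Fintype.card α → cn σ i = 0 ∨ i = 0 := by
  obtain ⟨σ, h1, h2⟩ := exists_perm_cn (α := α) {Fintype.card α} (by simpa using hn) (by simp)
  refine ⟨σ, fun i hi => ?_⟩
  rcases i with _ | _ | i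
  · exact Or.inr rfl
  · left
    simpa using h1
  · left
    rw [h2 _ (by omega), Multiset.count_singleton, if_neg hi.ne]

theorem exists_two_cycles {k : ℕ} (hk : 2 ≤ k) (hn : 2 * k < Fintype.card α) :
    ∃ σ : Perm α, (∀ i, 1 ≤ i → i < k → cn σ i = 0) ∧ cn σ k = 1 := by
  obtain ⟨σ, h1, h2⟩ := exists_perm_cn (α := α) {k, Fintype.card α - k}
    (by simp only [Multiset.insert_eq_cons, Multiset.mem_cons, Multiset.mem_singleton]; omega)
    (by simp; omega)
  simp only [Multiset.insert_eq_cons, Multiset.sum_cons, Multiset.sum_singleton] at h1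
  refine ⟨σ, fun i hi hi' => ?_, ?_⟩
  · rcases hi.eq_or_lt with rfl | hi
    · omega
    · rw [h2 _ hi]
      simp [Multiset.count_cons, Multiset.count_singleton]
      omega
  · rw [h2 _ hk]
    simp [Multiset.count_singleton]
    omega

theorem exists_isIrr_std (hn : 4 ≤ Fintype.card α) :
    ∃ χ : Perm α → ℝ, IsIrr χ ∧ ∀ σ, χ σ = cn σ 1 - 1 := by
  obtain ⟨σ, h⟩ := exists_full_cycle (α := α) (by omega)
  obtain ⟨χ, hχ, h⟩ := exists_isIrr_of_core_one (k := 0) (by omega) (σ := (1 : Perm α)) (σ' := σ)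
    (by omega) (by omega) (by
      rw [famSum_one _ (orbs_card_pos _), famSum_one _ (orbs_card_pos _)]
      have h1 := h 1 (by omega)
      have h2 : cn (1 : Perm α) 1 = Fintype.card α := cn_one_one
      change (1 : ℝ) * cn (1 : Perm α) 1 ≠ 1 * cn σ 1
      rw [h2, show cn σ 1 = 0 by omega]
      norm_num
      omega)
  refine ⟨χ, hχ, fun ξ => ?_⟩
  rw [h, famSum_one _ (orbs_card_pos ξ), famSum_zero _ (orbs_card_pos ξ), one_mul]
  rfl

theorem exists_isIrr_two (hn : 9 ≤ Fintype.card α) :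
    ∃ χ : Perm α → ℝ, IsIrr χ ∧ ∀ σ, χ σ = (cn σ 1 : ℝ) * (cn σ 1 - 3) / 2 + cn σ 2 := by
  obtain ⟨σ, h⟩ := exists_full_cycle (α := α) (by omega)
  obtain ⟨σ', h1, h2⟩ := exists_two_cycles (α := α) (k := 2) (by omega) (by omega)
  have e1 := h 1 (by omega)
  have e2 := h 2 (by omega)
  have e3 := h1 1 (by omega) (by omega)
  obtain ⟨χ, hχ, h⟩ := exists_isIrr_of_core_one (k := 1) (by omega) (σ := σ) (σ' := σ')
    (fun i hi hi' => by have := h i (by omega); omega) (fun i hi hi' => h1 i hi (by omega)) (by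
      rw [famSum_two _ (orbs_card_pos _) (a := cn σ 1) (b := cn σ 2) rfl rfl,
        famSum_two _ (orbs_card_pos _) (a := cn σ' 1) (b := cn σ' 2) rfl rfl,
        e3, h2, show cn σ 1 = 0 by omega, show cn σ 2 = 0 by omega]
      norm_num)
  refine ⟨χ, hχ, fun ξ => ?_⟩
  rw [h, famSum_two _ (orbs_card_pos ξ) (a := cn ξ 1) (b := cn ξ 2) rfl rfl,
    famSum_one _ (orbs_card_pos ξ)]
  change _ - 1 * (cn ξ 1 : ℝ) = _
  ring

theorem exists_isIrr_three (hn : 9 ≤ Fintype.card α) :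
    ∃ χ : Perm α → ℝ, IsIrr χ ∧ ∀ σ, χ σ =
      (cn σ 1 : ℝ) * (cn σ 1 - 1) * (cn σ 1 - 5) / 6 + (cn σ 1 - 1) * cn σ 2 + cn σ 3 := by
  obtain ⟨σ, h⟩ := exists_full_cycle (α := α) (by omega)
  obtain ⟨σ', h1, h2⟩ := exists_two_cycles (α := α) (k := 3) (by omega) (by omega)
  have e1 := h 1 (by omega)
  have e2 := h 2 (by omega)
  have e3 := h 3 (by omega)
  have e4 := h1 1 (by omega) (by omega)
  have e5 := h1 2 (by omega) (by omega)
  obtain ⟨χ, hχ, h⟩ := exists_isIrr_of_core_one (k := 2) (by omega) (σ := σ) (σ' := σ')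
    (fun i hi hi' => by have := h i (by omega); omega) (fun i hi hi' => h1 i hi (by omega)) (by
      rw [famSum_three _ (orbs_card_pos _) (a := cn σ 1) (b := cn σ 2) (c := cn σ 3) rfl rfl rfl,
        famSum_three _ (orbs_card_pos _) (a := cn σ' 1) (b := cn σ' 2) (c := cn σ' 3) rfl rfl rfl,
        e4, e5, h2, show cn σ 1 = 0 by omega, show cn σ 2 = 0 by omega, show cn σ 3 = 0 by omega]
      norm_num)
  refine ⟨χ, hχ, fun ξ => ?_⟩
  rw [h, famSum_three _ (orbs_card_pos ξ) (a := cn ξ 1) (b := cn ξ 2) (c := cn ξ 3) rfl rfl rfl,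
    famSum_two _ (orbs_card_pos ξ) (a := cn ξ 1) (b := cn ξ 2) rfl rfl]
  ring

theorem exists_isIrr_four (hn : 9 ≤ Fintype.card α) :
    ∃ χ : Perm α → ℝ, IsIrr χ ∧ ∀ σ, χ σ =
      (cn σ 1 : ℝ) * (cn σ 1 - 1) * (cn σ 1 - 2) * (cn σ 1 - 7) / 24 +
      ((cn σ 1 : ℝ) ^ 2 - 3 * cn σ 1 - 1) * cn σ 2 / 2 + (cn σ 2 : ℝ) ^ 2 / 2 +
      (cn σ 1 - 1) * cn σ 3 + cn σ 4 := by
  obtain ⟨σ, h⟩ := exists_full_cycle (α := α) (by omega)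
  obtain ⟨σ', h1, h2⟩ := exists_two_cycles (α := α) (k := 4) (by omega) (by omega)
  have e1 := h 1 (by omega)
  have e2 := h 2 (by omega)
  have e3 := h 3 (by omega)
  have e4 := h 4 (by omega)
  have e5 := h1 1 (by omega) (by omega)
  have e6 := h1 2 (by omega) (by omega)
  have e7 := h1 3 (by omega) (by omega)
  obtain ⟨χ, hχ, h⟩ := exists_isIrr_of_core_one (k := 3) (by omega) (σ := σ) (σ' := σ')
    (fun i hi hi' => by have := h i (by omega); omega) (fun i hi hi' => h1 i hi (by omega)) (by
      rw [famSum_four _ (orbs_card_pos _) (a := cn σ 1) (b := cn σ 2) (c := cn σ 3) (d := cn σ 4)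
          rfl rfl rfl rfl,
        famSum_four _ (orbs_card_pos _) (a := cn σ' 1) (b := cn σ' 2) (c := cn σ' 3)
          (d := cn σ' 4) rfl rfl rfl rfl,
        e5, e6, e7, h2, show cn σ 1 = 0 by omega, show cn σ 2 = 0 by omega,
        show cn σ 3 = 0 by omega, show cn σ 4 = 0 by omega]
      norm_num)
  refine ⟨χ, hχ, fun ξ => ?_⟩
  rw [h, famSum_four _ (orbs_card_pos ξ) (a := cn ξ 1) (b := cn ξ 2) (c := cn ξ 3) (d := cn ξ 4)
      rfl rfl rfl rfl,
    famSum_three _ (orbs_card_pos ξ) (a := cn ξ 1) (b := cn ξ 2) (c := cn ξ 3) rfl rfl rfl]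
  ring

/-- Permutations with few prescribed short cycles. -/
theorem exists_perm_small {a : ℕ} {m : Multiset ℕ} (hm : ∀ l ∈ m, 2 ≤ l)
    (hn : a + m.sum + 4 ≤ Fintype.card α) :
    ∃ σ : Perm α, cn σ 1 = a ∧ cn σ 2 = m.count 2 ∧ cn σ 3 = m.count 3 := by
  obtain ⟨σ, h1, h2⟩ := exists_perm_cn (α := α) ((Fintype.card α - (a + m.sum)) ::ₘ m)
    (by
      intro l hl
      rcases Multiset.mem_cons.1 hl with rfl | hl
      · omega
      · exact hm l hl) (by rw [Multiset.sum_cons]; omega)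
  rw [Multiset.sum_cons] at h1
  refine ⟨σ, by omega, ?_, ?_⟩
  · rw [h2 2 le_rfl, Multiset.count_cons_of_ne (by omega)]
  · rw [h2 3 (by omega), Multiset.count_cons_of_ne (by omega)]

theorem IsIrr.eq_one_of_not_levGe {χ : Perm α → ℝ} (h : IsIrr χ) (hl : ¬ LevGe 1 χ) :
    χ = fun _ => 1 := by
  rw [levGe_one_iff h, not_not] at hl
  exact hl

theorem exists_isIrr_oneOne (hn : 9 ≤ Fintype.card α) :
    ∃ χ : Perm α → ℝ, IsIrr χ ∧ ∀ σ, χ σ = ((cn σ 1 : ℝ) - 1) * (cn σ 1 - 2) / 2 - cn σ 2 := by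
  obtain ⟨s, hs, hsum⟩ := (isChar_cn_one (α := α).pow 2).exists_multiset
  obtain ⟨σ₁, a1, b1, -⟩ := exists_perm_small (α := α) (a := 2) (m := 0) (by simp) (by simp; omega)
  obtain ⟨σ₂, a2, b2, -⟩ := exists_perm_small (α := α) (a := 1) (m := 0) (by simp) (by simp; omega)
  obtain ⟨σ₃, a3, b3, -⟩ := exists_perm_small (α := α) (a := 0) (m := 0) (by simp) (by simp; omega)
  obtain ⟨σ₄, a4, b4, -⟩ := exists_perm_small (α := α) (a := 0) (m := {2}) (by simp)
    (by simp; omega)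
  simp only [Multiset.count_zero, Multiset.count_singleton_self] at b1 b2 b3 b4
  obtain ⟨ψ, hψ, h⟩ := exists_mem_sum_ne_zero ![1, -2, 2, -1] ![σ₁, σ₂, σ₃, σ₄] s (by
    rw [hsum]
    simp only [Fin.sum_univ_four, Matrix.cons_val]
    rw [a1, a2, a3, a4]
    norm_num)
  simp only [Fin.sum_univ_four, Matrix.cons_val] at h
  have hirr := hs ψ hψ
  have hl3 := not_levGe_of_mem_cn_one_pow hs hsum hψ
  by_cases hl2 : LevGe 2 ψ
  · rcases hirr.level_two (by omega) hl2 hl3 with h1 | h1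
    · rw [h1, h1, h1, h1, a1, a2, a3, a4, b1, b2, b3, b4] at h
      norm_num at h
    · exact ⟨ψ, hirr, h1⟩
  · exfalso
    by_cases hl1 : LevGe 1 ψ
    · rw [hirr.level_one (by omega) hl1 hl2, hirr.level_one (by omega) hl1 hl2,
        hirr.level_one (by omega) hl1 hl2, hirr.level_one (by omega) hl1 hl2, a1, a2, a3, a4] at h
      norm_num at h
    · rw [hirr.eq_one_of_not_levGe hl1] at h
      norm_num at h

theorem exists_isIrr_twoOne (hn : 9 ≤ Fintype.card α) :
    ∃ χ : Perm α → ℝ, IsIrr χ ∧ ∀ σ, χ σ =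
      (cn σ 1 : ℝ) * (cn σ 1 - 2) * (cn σ 1 - 4) / 3 - cn σ 3 := by
  obtain ⟨s, hs, hsum⟩ := (isChar_cn_one (α := α).pow 3).exists_multiset
  obtain ⟨σ₁, a1, b1, c1⟩ := exists_perm_small (α := α) (a := 3) (m := 0) (by simp) (by simp; omega)
  obtain ⟨σ₂, a2, b2, c2⟩ := exists_perm_small (α := α) (a := 2) (m := 0) (by simp) (by simp; omega)
  obtain ⟨σ₃, a3, b3, c3⟩ := exists_perm_small (α := α) (a := 1) (m := 0) (by simp) (by simp; omega)
  obtain ⟨σ₄, a4, b4, c4⟩ := exists_perm_small (α := α) (a := 0) (m := {3}) (by simp)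
    (by simp; omega)
  simp only [Multiset.count_zero, Multiset.count_singleton_self] at b1 b2 b3 b4 c1 c2 c3 c4
  rw [Multiset.count_singleton, if_neg (by norm_num)] at b4
  obtain ⟨ψ, hψ, h⟩ := exists_mem_sum_ne_zero ![1, -3, 3, -1] ![σ₁, σ₂, σ₃, σ₄] s (by
    rw [hsum]
    simp only [Fin.sum_univ_four, Matrix.cons_val]
    rw [a1, a2, a3, a4]
    norm_num)
  simp only [Fin.sum_univ_four, Matrix.cons_val] at h
  have hirr := hs ψ hψ
  have hl4 := not_levGe_of_mem_cn_one_pow hs hsum hψ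
  by_cases hl3 : LevGe 3 ψ
  · rcases hirr.level_three (by omega) hl3 hl4 with h1 | h1 | h1
    · rw [h1, h1, h1, h1, a1, a2, a3, a4, b1, b2, b3, b4, c1, c2, c3, c4] at h
      norm_num at h
    · exact ⟨ψ, hirr, h1⟩
    · rw [h1, h1, h1, h1, a1, a2, a3, a4, b1, b2, b3, b4, c1, c2, c3, c4] at h
      norm_num at h
  · exfalso
    by_cases hl2 : LevGe 2 ψ
    · rcases hirr.level_two (by omega) hl2 hl3 with h1 | h1 <;>
      · rw [h1, h1, h1, h1, a1, a2, a3, a4, b1, b2, b3, b4] at h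
        norm_num at h
    by_cases hl1 : LevGe 1 ψ
    · rw [hirr.level_one (by omega) hl1 hl2, hirr.level_one (by omega) hl1 hl2,
        hirr.level_one (by omega) hl1 hl2, hirr.level_one (by omega) hl1 hl2, a1, a2, a3, a4] at h
      norm_num at h
    · rw [hirr.eq_one_of_not_levGe hl1] at h
      norm_num at h

end EightExist

section FDRepBridge

open Equiv

theorem isCChar_character {G : Type} [Group G] (V : FDRep ℂ G) : IsCChar V.character :=
  ⟨V, inferInstance, inferInstance, inferInstance, V.ρ, rfl⟩

theorem exists_isIrr_of_simple {G : Type} [Group G] [Fintype G] [Ambivalent G] (V : FDRep ℂ G)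
    (hV : Simple V) : ∃ χ : G → ℝ, IsIrr χ ∧ V.character = fun g => (χ g : ℂ) := by
  obtain ⟨χ, hχ⟩ := (isCChar_character V).exists_real
  have hc : IsChar χ := by
    have := isCChar_character V
    rwa [hχ] at this
  refine ⟨χ, isIrr_of_norm hc ?_, hχ⟩
  have h1 := (FDRep.simple_iff_char_is_norm_one V).1 hV
  simp only [hχ, hc.inv] at h1
  rw [Nat.card_eq_fintype_card] at h1
  exact_mod_cast h1

theorem IsIrr.exists_simple {G : Type} [Group G] [Fintype G] {χ : G → ℝ} (h : IsIrr χ) :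
    ∃ V : FDRep ℂ G, Simple V ∧ V.character = fun g => (χ g : ℂ) := by
  obtain ⟨W, _, _, _, ρ, hρ⟩ := h.isChar
  have hV : (FDRep.of ρ).character = fun g => (χ g : ℂ) := hρ
  refine ⟨FDRep.of ρ, (FDRep.simple_iff_char_is_norm_one _).2 ?_, hV⟩
  simp only [hV, h.isChar.inv]
  rw [Nat.card_eq_fintype_card]
  have := h.norm_eq
  exact_mod_cast this

theorem normChar_eq_div {n : ℕ} {V : FDRep ℂ (Perm (Fin n))} {χ : Perm (Fin n) → ℝ}
    (h : V.character = fun g => (χ g : ℂ)) (σ : Perm (Fin n)) :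
    normChar V σ = χ σ / χ 1 := by
  rw [normChar, h, ← Complex.ofReal_div, Complex.ofReal_re]

theorem isNontrivIrr_iff {n : ℕ} {V : FDRep ℂ (Perm (Fin n))} {χ : Perm (Fin n) → ℝ}
    (hχ : IsIrr χ) (h : V.character = fun g => (χ g : ℂ)) (hV : Simple V) :
    IsNontrivIrr V ↔ LL 1 χ := by
  rw [LL_one_iff hχ, IsNontrivIrr, h]
  have h1 : ((fun g => (χ g : ℂ)) = fun _ => 1) ↔ χ = fun _ => 1 := by
    simp only [funext_iff]
    norm_cast
  have h2 : ((fun g => (χ g : ℂ)) = fun σ => ((Perm.sign σ : ℤ) : ℂ)) ↔ χ = sgn := by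
    simp only [funext_iff, sgn]
    norm_cast
  rw [Ne, Ne, h1, h2]
  exact and_iff_right hV

theorem IsIrr.div_mem {n : ℕ} {χ : Perm (Fin n) → ℝ} (h : IsIrr χ) (h1 : 1 < χ 1)
    (σ : Perm (Fin n)) :
    χ σ / χ 1 ∈ {x : ℝ | ∃ V : FDRep ℂ (Perm (Fin n)), IsNontrivIrr V ∧ x = normChar V σ} := by
  obtain ⟨V, hV, hχ⟩ := h.exists_simple
  refine ⟨V, (isNontrivIrr_iff h hχ hV).2 ((LL_one_iff h).2 ⟨?_, ?_⟩),
    (normChar_eq_div hχ σ).symm⟩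
  · rintro rfl
    exact lt_irrefl _ h1
  · rintro rfl
    rw [sgn_one] at h1
    exact lt_irrefl _ h1

theorem max_mem {S : Set ℝ} {a b : ℝ} (ha : a ∈ S) (hb : b ∈ S) : max a b ∈ S := by
  rcases max_choice a b with h | h <;> rwa [h]

theorem eightBound_maxF {n : ℕ} (hn : 8 ≤ n) (σ : Perm (Fin n)) : EightBound σ (maxF n σ) := by
  have hn' : (8 : ℝ) ≤ n := by exact_mod_cast hn
  have p0 : (0 : ℝ) < n := by linarith
  have p1 : (0 : ℝ) < n - 1 := by linarith
  have p2 : (0 : ℝ) < n - 2 := by linarith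
  have p3 : (0 : ℝ) < n - 3 := by linarith
  have p4 : (0 : ℝ) < n - 4 := by linarith
  have p5 : (0 : ℝ) < n - 5 := by linarith
  have p7 : (0 : ℝ) < n - 7 := by linarith
  have c1 : fixCount σ = cn σ 1 := (cn_one σ).symm
  have c2 : cyc 2 σ = cn σ 2 := (cn_of_two_le σ (by norm_num)).symm
  have c3 : cyc 3 σ = cn σ 3 := (cn_of_two_le σ (by norm_num)).symm
  have c4 : cyc 4 σ = cn σ 4 := (cn_of_two_le σ (by norm_num)).symm
  constructor <;> rw [← div_le_iff₀ (by rw [Fintype.card_fin]; positivity), Fintype.card_fin] <;>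
    simp only [maxF, c1, c2, c3, c4, mul_div_assoc, sgn, le_max_iff, le_refl, true_or, or_true]

theorem maxF_mem {n : ℕ} (hn : 9 ≤ n) (σ : Perm (Fin n)) :
    maxF n σ ∈ {x : ℝ | ∃ V : FDRep ℂ (Perm (Fin n)), IsNontrivIrr V ∧ x = normChar V σ} := by
  have hn' : (9 : ℝ) ≤ n := by exact_mod_cast hn
  have hc : Fintype.card (Fin n) = n := Fintype.card_fin n
  have c1 : fixCount σ = cn σ 1 := (cn_one σ).symm
  have c2 : cyc 2 σ = cn σ 2 := (cn_of_two_le σ (by norm_num)).symm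
  have c3 : cyc 3 σ = cn σ 3 := (cn_of_two_le σ (by norm_num)).symm
  have c4 : cyc 4 σ = cn σ 4 := (cn_of_two_le σ (by norm_num)).symm
  have d1 : cn (1 : Perm (Fin n)) 1 = n := by rw [cn_one_one, hc]
  have d2 : cn (1 : Perm (Fin n)) 2 = 0 := cn_one_of_two_le (by norm_num)
  have d3 : cn (1 : Perm (Fin n)) 3 = 0 := cn_one_of_two_le (by norm_num)
  have d4 : cn (1 : Perm (Fin n)) 4 = 0 := cn_one_of_two_le (by norm_num)
  obtain ⟨χ₁, h₁, f₁⟩ := exists_isIrr_std (α := Fin n) (by omega)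
  obtain ⟨χ₂, h₂, f₂⟩ := exists_isIrr_two (α := Fin n) (by omega)
  obtain ⟨χ₃, h₃, f₃⟩ := exists_isIrr_three (α := Fin n) (by omega)
  obtain ⟨χ₄, h₄, f₄⟩ := exists_isIrr_twoOne (α := Fin n) (by omega)
  obtain ⟨χ₅, h₅, f₅⟩ := exists_isIrr_four (α := Fin n) (by omega)
  obtain ⟨χ₈, h₈, f₈⟩ := exists_isIrr_oneOne (α := Fin n) (by omega)
  have e₁ : χ₁ 1 = n - 1 := by rw [f₁, d1]
  have e₂ : χ₂ 1 = n * (n - 3) / 2 := by rw [f₂, d1, d2]; simp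
  have e₃ : χ₃ 1 = n * (n - 1) * (n - 5) / 6 := by rw [f₃, d1, d2, d3]; simp
  have e₄ : χ₄ 1 = n * (n - 2) * (n - 4) / 3 := by rw [f₄, d1, d3]; simp
  have e₅ : χ₅ 1 = n * (n - 1) * (n - 2) * (n - 7) / 24 := by rw [f₅, d1, d2, d3, d4]; simp
  have e₈ : χ₈ 1 = (n - 1) * (n - 2) / 2 := by rw [f₈, d1, d2]; simp
  obtain ⟨m, hm, hnm⟩ : ∃ m : ℝ, 0 ≤ m ∧ (n : ℝ) = m + 9 := ⟨n - 9, by linarith, by ring⟩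
  have hm2 := pow_nonneg hm 2
  have hm3 := pow_nonneg hm 3
  have hm4 := pow_nonneg hm 4
  have g₁ : 1 < χ₁ 1 := by rw [e₁, hnm]; linarith
  have g₂ : 1 < χ₂ 1 := by rw [e₂, hnm]; nlinarith
  have g₃ : 1 < χ₃ 1 := by rw [e₃, hnm]; nlinarith
  have g₄ : 1 < χ₄ 1 := by rw [e₄, hnm]; nlinarith
  have g₅ : 1 < χ₅ 1 := by rw [e₅, hnm]; nlinarith
  have g₈ : 1 < χ₈ 1 := by rw [e₈, hnm]; nlinarith
  have htw {χ : Perm (Fin n) → ℝ} (h : IsIrr χ) (h1 : 1 < χ 1) :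
      sgn σ * (χ σ / χ 1) ∈
        {x : ℝ | ∃ V : FDRep ℂ (Perm (Fin n)), IsNontrivIrr V ∧ x = normChar V σ} := by
    have := h.tw.div_mem (by rwa [tw_one]) σ
    rwa [tw_one, tw, mul_div_assoc] at this
  have key : maxF n σ = max (max (max (χ₁ σ / χ₁ 1) (χ₂ σ / χ₂ 1))
      (max (χ₃ σ / χ₃ 1) (χ₄ σ / χ₄ 1))) (max (max (χ₅ σ / χ₅ 1) (sgn σ * (χ₁ σ / χ₁ 1)))
      (max (sgn σ * (χ₂ σ / χ₂ 1)) (sgn σ * (χ₈ σ / χ₈ 1)))) := by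
    rw [e₁, e₂, e₃, e₄, e₅, e₈, f₁, f₂, f₃, f₄, f₅, f₈, ← mul_div_assoc (sgn σ) (_ - _ : ℝ)
      (((n : ℝ) - 1) * (n - 2) / 2)]
    simp only [maxF, c1, c2, c3, c4, sgn]
  rw [key]
  exact max_mem (max_mem (max_mem (h₁.div_mem g₁ σ) (h₂.div_mem g₂ σ))
    (max_mem (h₃.div_mem g₃ σ) (h₄.div_mem g₄ σ)))
    (max_mem (max_mem (h₅.div_mem g₅ σ) (htw h₁ g₁)) (max_mem (htw h₂ g₂) (htw h₈ g₈)))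

end FDRepBridge

/-- **Theorem (single conjugacy class).** There is `N₀` such that for all `n ≥ N₀` and all
`σ ∈ S_n`, the maximum of the normalized characters `χ̃(σ)` over all irreducible characters
`χ ∉ {triv, sgn}` of `S_n` is attained and equals `max {F₁(σ), …, F₈(σ)}`. -/
theorem single_conjugacy_class_eight_rule :
    ∃ N₀ : ℕ, ∀ n : ℕ, n ≥ N₀ → ∀ σ : Equiv.Perm (Fin n),
      IsGreatest {x : ℝ | ∃ V : FDRep ℂ (Equiv.Perm (Fin n)), IsNontrivIrr V ∧ x = normChar V σ}
        (maxF n σ) := by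
  obtain ⟨n₀, h⟩ := exists_le_of_eightBound
  refine ⟨max n₀ 9, fun n hn σ => ⟨maxF_mem ((le_max_right _ _).trans hn) σ, ?_⟩⟩
  rintro x ⟨V, hV, rfl⟩
  have h9 : 9 ≤ n := (le_max_right _ _).trans hn
  obtain ⟨χ, hχ, hVχ⟩ := exists_isIrr_of_simple V hV.1
  rw [normChar_eq_div hVχ, div_le_iff₀ (zero_lt_one.trans_le hχ.one_pos)]
  exact h (Fin n) σ χ _ (by rw [Fintype.card_fin]; exact (le_max_left _ _).trans hn)
    (eightBound_maxF (by omega) σ) hχ ((isNontrivIrr_iff hχ hVχ hV.1).1 hV)
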